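/- Assume that for every number field K, the Dedekind zeta function of K satisfies the Riemann Hypothesis (every nontrivial zero has real part 1/2). Then there is an absolute constant c > 0 such that for every n, the characteristic polynomial φ(t) = det(t·I_n − M_n) of the n×n random symmetric Rademacher matrix M_n is irreducible over ℚ with probability at least 1 − 2·exp(−c·n^{1/4}). -/

import Mathlib

open Finset

noncomputable section

/-- The sign `±1` associated to a Boolean. -/
def signb (R : Type*) [Ring R] (b : Bool) : R := if b then 1 else -1

open Classical in
/-- Uniform/counting probability of an event on a finite sample space. -/
def prob {Ω : Type*} [Fintype Ω] (E : Ω → Prop) : ℝ :=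
  ((Finset.univ.filter E).card : ℝ) / (Fintype.card Ω : ℝ)

/-- The symmetric random sign matrix determined by the Boolean data `ω`
(only the entries `ω i j` with `i ≤ j` are used); it is uniformly distributed
over symmetric `±1` matrices when `ω` is uniform. -/
def symMat (R : Type*) [Ring R] {n : ℕ} (ω : Fin n → Fin n → Bool) :
    Matrix (Fin n) (Fin n) R :=
  Matrix.of fun i j => signb R (ω (min i j) (max i j))

/-- Atom probability of a vector over `ZMod p` w.r.t. i.i.d. Rademacher signs. -/
def rho (p : ℕ) {ι : Type*} [Fintype ι] [DecidableEq ι] (w : ι → ZMod p) : ℝ :=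
  ⨆ r : ZMod p, prob (fun ξ : ι → Bool => ∑ i, signb (ZMod p) (ξ i) * w i = r)

/-- Discrepancy of a vector over `ZMod p` w.r.t. i.i.d. Rademacher signs. -/
def disc (p : ℕ) {ι : Type*} [Fintype ι] [DecidableEq ι] (w : ι → ZMod p) : ℝ :=
  ⨆ x : ZMod p,
    |prob (fun ξ : ι → Bool => ∑ i, signb (ZMod p) (ξ i) * w i = x) - 1 / (p : ℝ)|

/-- The Riemann hypothesis for the Dedekind zeta function of a number field `K`:
any analytic continuation of the Dirichlet series `∑ 1/N(I)^s` (summed over nonzero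
ideals of the ring of integers) to `ℂ \ {1}` has all its zeros in the critical strip
on the line `Re s = 1/2`. -/
def DedekindZetaRH (K : Type*) [Field K] [NumberField K] : Prop :=
  ∀ Z : ℂ → ℂ,
    DifferentiableOn ℂ Z {s : ℂ | s ≠ 1} →
    (∀ s : ℂ, 1 < s.re →
      Z s = ∑' I : {I : Ideal (NumberField.RingOfIntegers K) // I ≠ ⊥},
        (Ideal.absNorm I.1 : ℂ) ^ (-s)) →
    ∀ s : ℂ, Z s = 0 → 0 < s.re → s.re < 1 → s.re = 1 / 2

set_option linter.unusedSectionVars false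
set_option linter.style.haveILetI false

namespace RM

section smalldoubling
variable {V : Type*} [AddCommGroup V] [Fintype V] [DecidableEq V]

lemma small_doubling (A A' : Finset V) (h0 : (0 : V) ∈ A) (hs : ∀ a ∈ A, -a ∈ A)
    (hadd : ∀ a ∈ A, ∀ b ∈ A, a + b ∈ A') (hc : 2 * #A' < 3 * #A) :
    ∃ H : AddSubgroup V, (∀ a ∈ A, a ∈ H) ∧ Nat.card H ≤ #A' := by
  have key : ∀ a ∈ A, ∀ b ∈ A, #A < 2 * #(A.filter (fun t => t + (a + b) ∈ A)) := by
    intro a ha b hb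
    have h1 : (A.image (fun t => t - b)) ∪ (A.image (fun t => t + a)) ⊆ A' := by
      intro x hx
      rcases mem_union.1 hx with h | h <;> obtain ⟨t, ht, rfl⟩ := mem_image.1 h
      · rw [sub_eq_add_neg]; exact hadd _ ht _ (hs _ hb)
      · exact hadd _ ht _ ha
    have h2 := card_union_add_card_inter (A.image (fun t => t - b)) (A.image (fun t => t + a))
    rw [card_image_of_injective _ (sub_left_injective),
      card_image_of_injective _ (add_left_injective a)] at h2
    have h3 := card_le_card h1
    have h4 : #((A.image (fun t => t - b)) ∩ (A.image (fun t => t + a))) ≤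
        #(A.filter (fun t => t + (a + b) ∈ A)) := by
      apply card_le_card_of_injOn (fun x => x - a)
      · intro x hx
        simp only [coe_inter, coe_image, Set.mem_inter_iff, Set.mem_image, mem_coe] at hx
        obtain ⟨⟨t, ht, rfl⟩, ⟨t', ht', h⟩⟩ := hx
        simp only [coe_filter, Set.mem_ofPred_eq]
        constructor
        · rw [← h]; simpa using ht'
        · convert ht using 1; abel
      · intro x _ y _ h; simpa using h
    omega
  refine ⟨⟨⟨⟨{x | ∃ a ∈ A, ∃ b ∈ A, x = a + b}, ?_⟩, ?_⟩, ?_⟩, ?_, ?_⟩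
  · rintro x y ⟨a, ha, b, hb, rfl⟩ ⟨a', ha', b', hb', rfl⟩
    have k1 := key (-a) (hs _ ha) (-b) (hs _ hb)
    have k2 := key a' ha' b' hb'
    have : ((A.filter (fun t => t + (-a + -b) ∈ A)) ∩ (A.filter (fun t => t + (a' + b') ∈ A))).Nonempty := by
      by_contra hcon
      rw [not_nonempty_iff_eq_empty] at hcon
      have h2 := card_union_add_card_inter (A.filter (fun t => t + (-a + -b) ∈ A)) (A.filter (fun t => t + (a' + b') ∈ A))
      rw [hcon] at h2
      have := card_le_card (union_subset (filter_subset (fun t => t + (-a + -b) ∈ A) A) (filter_subset (fun t => t + (a' + b') ∈ A) A))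
      simp at h2
      omega
    obtain ⟨t, ht⟩ := this
    simp only [mem_inter, mem_filter] at ht
    exact ⟨_, ht.2.2, _, hs _ ht.1.2, by abel⟩
  · exact ⟨0, h0, 0, h0, by simp⟩
  · rintro x ⟨a, ha, b, hb, rfl⟩
    exact ⟨-a, hs _ ha, -b, hs _ hb, by abel⟩
  · intro a ha
    exact ⟨a, ha, 0, h0, by simp⟩
  · refine le_trans (Nat.card_mono (t := (A' : Set V)) (Finset.finite_toSet A') ?_) (by simp)
    rintro x ⟨a, ha, b, hb, rfl⟩
    exact hadd _ ha _ hb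
end smalldoubling

section chars
variable (p : ℕ) [Fact p.Prime]

def cc (x : ZMod p) : ℝ := |(ZMod.stdAddChar x).re|
def sn (x : ZMod p) : ℝ := (ZMod.stdAddChar x).im ^ 2

lemma re_sq_add (x : ZMod p) : (ZMod.stdAddChar x).re ^ 2 + (ZMod.stdAddChar x).im ^ 2 = 1 := by
  have := AddChar.norm_apply (ZMod.stdAddChar : AddChar (ZMod p) ℂ) x
  have h := Complex.sq_norm (ZMod.stdAddChar x)
  rw [this, Complex.normSq_apply] at h
  linarith

lemma cc_nonneg (x : ZMod p) : 0 ≤ cc p x := abs_nonneg _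
lemma sn_nonneg (x : ZMod p) : 0 ≤ sn p x := sq_nonneg _
lemma cc_sq (x : ZMod p) : cc p x ^ 2 = 1 - sn p x := by
  rw [cc, sn, sq_abs]; linarith [re_sq_add p x]
lemma cc_le_one (x : ZMod p) : cc p x ≤ 1 := by
  nlinarith [cc_sq p x, sn_nonneg p x, cc_nonneg p x]
lemma cc_le (x : ZMod p) : cc p x ≤ 1 - sn p x / 2 := by
  nlinarith [cc_sq p x, sq_nonneg (cc p x - 1)]
lemma sn_zero : sn p 0 = 0 := by simp [sn]
lemma sn_neg (x : ZMod p) : sn p (-x) = sn p x := by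
  simp [sn, AddChar.map_neg_eq_conj]
lemma sn_add (x y : ZMod p) : sn p (x + y) ≤ 2 * sn p x + 2 * sn p y := by
  simp only [sn, AddChar.map_add_eq_mul, Complex.mul_im]
  have h1 := re_sq_add p x
  have h2 := re_sq_add p y
  set a := (ZMod.stdAddChar x).re
  set b := (ZMod.stdAddChar x).im
  set c := (ZMod.stdAddChar y).re
  set d := (ZMod.stdAddChar y).im
  have : (a*d + b*c)^2 ≤ 2 * (a*d)^2 + 2 * (b*c)^2 := by nlinarith [sq_nonneg (a*d-b*c)]
  nlinarith [sq_nonneg (b*d)]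
lemma re_two (x : ZMod p) : (ZMod.stdAddChar (2 * x)).re = 1 - 2 * sn p x := by
  rw [two_mul, AddChar.map_add_eq_mul, Complex.mul_re, sn]; nlinarith [re_sq_add p x]

lemma two_ne (hp : p ≠ 2) : (2 : ZMod p) ≠ 0 := by
  intro h
  have : ((2 : ℕ) : ZMod p) = 0 := by exact_mod_cast h
  rw [ZMod.natCast_eq_zero_iff] at this
  exact hp ((Nat.prime_dvd_prime_iff_eq Fact.out Nat.prime_two).1 this)

lemma sum_cc (hp : p ≠ 2) : ∑ x : ZMod p, cc p x ≤ 3 / 4 * p := by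
  have h1 : ∑ x : ZMod p, sn p x = p / 2 := by
    have h := AddChar.sum_mulShift (2 : ZMod p) (ZMod.isPrimitive_stdAddChar p)
    rw [if_neg (two_ne p hp)] at h
    have h' := congrArg Complex.re h
    simp only [Complex.re_sum, mul_comm _ (2 : ZMod p), re_two] at h'
    rw [sum_sub_distrib, ← mul_sum] at h'
    simp [ZMod.card] at h'
    linarith
  have h2 : ∑ x : ZMod p, cc p x ^ 2 = p / 2 := by
    simp only [cc_sq, sum_sub_distrib, h1]; simp [ZMod.card]; ring
  have h3 := sq_sum_le_card_mul_sum_sq (s := (univ : Finset (ZMod p))) (f := cc p)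
  rw [h2, card_univ, ZMod.card] at h3
  have hp0 : (0 : ℝ) ≤ p := Nat.cast_nonneg _
  apply abs_le_of_sq_le_sq' _ (by positivity) |>.2
  nlinarith

abbrev V2 := ZMod p × ZMod p
def BB (u v : V2 p) : ZMod p := u.1 * v.2 + v.1 * u.2

lemma BB_add (u v w : V2 p) : BB p (u + v) w = BB p u w + BB p v w := by
  simp [BB]; ring
lemma BB_add_right (u v w : V2 p) : BB p u (v + w) = BB p u v + BB p u w := by
  simp [BB]; ring
lemma BB_neg (u w : V2 p) : BB p (-u) w = - BB p u w := by
  simp [BB]; ring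
lemma BB_comm (u v : V2 p) : BB p u v = BB p v u := by simp [BB]; ring

lemma parseval (hp : p ≠ 2) (f : V2 p → ℝ) :
    ∑ v : V2 p, ‖∑ u, (f u : ℂ) * ZMod.stdAddChar (2 * BB p v u)‖ ^ 2 = p ^ 2 * ∑ u, f u ^ 2 := by
  have horth : ∀ d : V2 p, ∑ v : V2 p, ZMod.stdAddChar (2 * BB p v d) = if d = 0 then (p : ℂ) ^ 2 else 0 := by
    intro d
    have e : ∀ v : V2 p, ZMod.stdAddChar (2 * BB p v d) =
        ZMod.stdAddChar (v.1 * (2 * d.2)) * ZMod.stdAddChar (v.2 * (2 * d.1)) := by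
      intro v; rw [← AddChar.map_add_eq_mul]; congr 1; simp [BB]; ring
    simp only [e]
    rw [Fintype.sum_prod_type]
    simp only
    simp only [← mul_sum]
    rw [← sum_mul, AddChar.sum_mulShift _ (ZMod.isPrimitive_stdAddChar p),
      AddChar.sum_mulShift _ (ZMod.isPrimitive_stdAddChar p)]
    have := two_ne p hp
    by_cases h1 : d.1 = 0 <;> by_cases h2 : d.2 = 0 <;> simp [h1, h2, this, Prod.ext_iff, ZMod.card, sq]
  have hC : ∑ v : V2 p, ((‖∑ u, (f u : ℂ) * ZMod.stdAddChar (2 * BB p v u)‖ ^ 2 : ℝ) : ℂ) =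
      p ^ 2 * ∑ u, (f u : ℂ) ^ 2 := by
    calc _ = ∑ v : V2 p, ∑ u, ∑ u', (f u : ℂ) * f u' * ZMod.stdAddChar (2 * BB p v (u - u')) := by
          refine sum_congr rfl fun v _ => ?_
          rw [Complex.ofReal_pow, ← Complex.mul_conj', map_sum, sum_mul_sum]
          refine sum_congr rfl fun u _ => sum_congr rfl fun u' _ => ?_
          rw [sub_eq_add_neg, BB_add_right, show BB p v (-u') = - BB p v u' by rw [BB_comm, BB_neg, BB_comm],
            mul_add, AddChar.map_add_eq_mul, mul_neg, AddChar.map_neg_eq_conj]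
          simp
          ring
      _ = ∑ u, ∑ u', (f u : ℂ) * f u' * (if u - u' = 0 then (p : ℂ) ^ 2 else 0) := by
          rw [sum_comm]
          refine sum_congr rfl fun u _ => ?_
          rw [sum_comm]
          refine sum_congr rfl fun u' _ => ?_
          rw [← mul_sum, horth]
      _ = _ := by
          simp only [sub_eq_zero, mul_ite, mul_zero, sum_ite_eq, mem_univ, if_true]
          rw [mul_sum]
          refine sum_congr rfl fun u _ => ?_
          ring
  exact_mod_cast hC

end chars

section wsum
variable (p : ℕ) [Fact p.Prime] {ι : Type*} [Fintype ι] [DecidableEq ι]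

def fJ (u : ι → V2 p) (J : Finset ι) (v : V2 p) : ℝ := ∏ i ∈ J, cc p (BB p (u i) v)
def GJ (u : ι → V2 p) (J : Finset ι) : ℝ := ∑ v, fJ p u J v
open Classical in
def TT (u : ι → V2 p) (J : Finset ι) (β : ℝ) : Finset (V2 p) :=
  univ.filter fun v => ∑ x, fJ p u J x * sn p (BB p v x) ≤ β * GJ p u J

variable (u : ι → V2 p) (J : Finset ι)

lemma fJ_nonneg (v) : 0 ≤ fJ p u J v := prod_nonneg fun _ _ => cc_nonneg _ _
lemma fJ_le_one (v) : fJ p u J v ≤ 1 := prod_le_one (fun _ _ => cc_nonneg _ _) fun _ _ => cc_le_one _ _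
lemma GJ_pos_aux : 1 ≤ GJ p u J := by
  refine le_trans ?_ (single_le_sum (f := fJ p u J) (fun v _ => fJ_nonneg p u J v) (mem_univ 0))
  simp [fJ, BB, cc]
lemma GJ_nonneg : 0 ≤ GJ p u J := zero_le_one.trans (GJ_pos_aux p u J)

variable {p u J}
lemma mem_TT {β : ℝ} {v : V2 p} : v ∈ TT p u J β ↔ ∑ x, fJ p u J x * sn p (BB p v x) ≤ β * GJ p u J := by
  simp [TT]
lemma zero_mem_TT {β : ℝ} (hβ : 0 ≤ β) : 0 ∈ TT p u J β := by
  rw [mem_TT]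
  have : 0 ≤ β * GJ p u J := mul_nonneg hβ (GJ_nonneg _ _ _)
  simpa [BB, sn_zero]
lemma neg_mem_TT {β : ℝ} {v : V2 p} (h : v ∈ TT p u J β) : -v ∈ TT p u J β := by
  rw [mem_TT] at *
  simpa [BB_neg, sn_neg] using h
lemma add_mem_TT {β : ℝ} {v w : V2 p} (h : v ∈ TT p u J β) (h' : w ∈ TT p u J β) :
    v + w ∈ TT p u J (4 * β) := by
  rw [mem_TT] at *
  calc _ ≤ ∑ x, (2 * (fJ p u J x * sn p (BB p v x)) + 2 * (fJ p u J x * sn p (BB p w x))) := by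
        refine sum_le_sum fun x _ => ?_
        rw [BB_add]
        nlinarith [fJ_nonneg p u J x, sn_add p (BB p v x) (BB p w x)]
    _ ≤ _ := by rw [sum_add_distrib, ← mul_sum, ← mul_sum]; linarith
lemma TT_mono {β β' : ℝ} (h : β ≤ β') : TT p u J β ⊆ TT p u J β' := by
  intro v hv
  rw [mem_TT] at *
  exact hv.trans (mul_le_mul_of_nonneg_right h (GJ_nonneg _ _ _))

lemma GJ_insert {β : ℝ} {i : ι} (hi : i ∉ J) (h : u i ∉ TT p u J β) :
    GJ p u (insert i J) ≤ (1 - β / 2) * GJ p u J := by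
  rw [mem_TT, not_le] at h
  calc GJ p u (insert i J) = ∑ v, cc p (BB p (u i) v) * fJ p u J v := by
        simp [GJ, fJ, prod_insert hi]
    _ ≤ ∑ v, (fJ p u J v - (fJ p u J v * sn p (BB p (u i) v)) / 2) := by
        refine sum_le_sum fun x _ => ?_
        nlinarith [fJ_nonneg p u J x, cc_le p (BB p (u i) x)]
    _ ≤ _ := by
        rw [sum_sub_distrib, ← sum_div]
        change GJ p u J - _ ≤ _
        linarith

lemma card_TT (hp : p ≠ 2) : (#(TT p u J (1/4)) : ℝ) * GJ p u J ≤ 4 * p ^ 2 := by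
  have h1 := parseval p hp (fJ p u J)
  have h2 : ∑ x, fJ p u J x ^ 2 ≤ GJ p u J := sum_le_sum fun x _ => by
    nlinarith [fJ_nonneg p u J x, fJ_le_one p u J x]
  have h3 : (#(TT p u J (1/4)) : ℝ) * (GJ p u J / 2) ^ 2 ≤
      ∑ v : V2 p, ‖∑ x, (fJ p u J x : ℂ) * ZMod.stdAddChar (2 * BB p v x)‖ ^ 2 := by
    rw [← nsmul_eq_mul]
    refine le_trans (card_nsmul_le_sum (TT p u J (1/4)) (fun v => ‖∑ x, (fJ p u J x : ℂ) * ZMod.stdAddChar (2 * BB p v x)‖ ^ 2) _ ?_)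
      (sum_le_sum_of_subset_of_nonneg (subset_univ _) fun _ _ _ => by positivity)
    intro v hv
    rw [mem_TT] at hv
    refine pow_le_pow_left₀ (by linarith [GJ_nonneg p u J]) ?_ 2
    refine le_trans ?_ (Complex.re_le_norm _)
    rw [Complex.re_sum]
    simp only [Complex.re_ofReal_mul, re_two]
    have : ∑ x, fJ p u J x * (1 - 2 * sn p (BB p v x)) = GJ p u J - 2 * ∑ x, fJ p u J x * sn p (BB p v x) := by
      rw [GJ, mul_sum, ← sum_sub_distrib]
      exact sum_congr rfl fun x _ => by ring
    rw [this]; linarith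
  have h4 := GJ_pos_aux p u J
  have h5 : (#(TT p u J (1/4)) : ℝ) * GJ p u J * GJ p u J ≤ 4 * p ^ 2 * GJ p u J := by
    nlinarith [sq_nonneg (p : ℝ)]
  exact le_of_mul_le_mul_right h5 (by linarith)

def β0 : ℝ := 1 / 4 ^ 8

lemma dichotomy (hp : 12 ≤ p) (hG : (p : ℝ) / 2 < GJ p u J) :
    (#(TT p u J β0) : ℝ) ≤ p / 2 ∨
    Nat.card (AddSubgroup.closure (TT p u J β0 : Set (V2 p))) ≤ p := by
  have hp2 : p ≠ 2 := by omega
  have hp0 : (0 : ℝ) < p := by exact_mod_cast (by omega : 0 < p)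
  have hT : (#(TT p u J (1/4)) : ℝ) ≤ 8 * p := by
    have := card_TT (u := u) (J := J) hp2
    have h' : (#(TT p u J (1/4)) : ℝ) * (p / 2) ≤ 4 * p ^ 2 :=
      (mul_le_mul_of_nonneg_left hG.le (Nat.cast_nonneg _)).trans this
    nlinarith
  by_cases hd : ∀ j < 7, 3 * #(TT p u J (1 / 4 ^ (j + 2))) ≤ 2 * #(TT p u J (1 / 4 ^ (j + 1)))
  · left
    have hd' : ∀ j < 7, 3 * (#(TT p u J (1 / 4 ^ (j + 2))) : ℝ) ≤ 2 * #(TT p u J (1 / 4 ^ (j + 1))) :=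
      fun j hj => by exact_mod_cast hd j hj
    have e0 := hd' 0 (by norm_num)
    have e1 := hd' 1 (by norm_num)
    have e2 := hd' 2 (by norm_num)
    have e3 := hd' 3 (by norm_num)
    have e4 := hd' 4 (by norm_num)
    have e5 := hd' 5 (by norm_num)
    have e6 := hd' 6 (by norm_num)
    simp only [Nat.reduceAdd, zero_add, pow_one] at e0 e1 e2 e3 e4 e5 e6
    rw [β0]; linarith
  · right
    push Not at hd
    obtain ⟨j, hj, hlt⟩ := hd
    obtain ⟨H, hH, hc⟩ := small_doubling (TT p u J (1 / 4 ^ (j + 2))) (TT p u J (1 / 4 ^ (j + 1)))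
      (zero_mem_TT (by positivity)) (fun a ha => neg_mem_TT ha)
      (fun a ha b hb => by
        have := add_mem_TT ha hb
        convert this using 2
        rw [pow_succ 4 (j+1)]; field_simp) hlt
    have hsub : TT p u J β0 ⊆ TT p u J (1 / 4 ^ (j + 2)) := by
      apply TT_mono
      rw [β0]
      exact one_div_le_one_div_of_le (by positivity) (pow_le_pow_right₀ (by norm_num) (by omega))
    have hle : AddSubgroup.closure (TT p u J β0 : Set (V2 p)) ≤ H := by
      rw [AddSubgroup.closure_le]
      exact fun x hx => hH x (hsub hx)
    have hc2 : Nat.card H ≤ 8 * p := by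
      have h1 : #(TT p u J (1 / 4 ^ (j + 1))) ≤ #(TT p u J (1/4)) := by
        apply card_le_card
        apply TT_mono
        exact one_div_le_one_div_of_le (by positivity) (le_self_pow₀ (by norm_num) (by omega))
      have h2 : #(TT p u J (1/4)) ≤ 8 * p := by exact_mod_cast hT
      omega
    have hdvd : Nat.card H ∣ p ^ 2 := by
      have := AddSubgroup.card_addSubgroup_dvd_card H
      simpa [Nat.card_eq_fintype_card, Fintype.card_prod, ZMod.card, sq] using this
    have hpr : p.Prime := Fact.out
    obtain ⟨e, he, hce⟩ := (Nat.dvd_prime_pow hpr).1 hdvd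
    have : Nat.card H ≤ p := by
      interval_cases e
      · rw [hce]; simp; omega
      · simp [hce]
      · exfalso; nlinarith
    exact (AddSubgroup.card_le_of_le hle).trans this

end wsum
end RM

namespace RM
section wsum2
variable {p : ℕ} [Fact p.Prime] {m : ℕ}

lemma greedy (u : Fin m → V2 p) (s : ℕ) (hs : (1 - β0 / 2) ^ s * (p : ℝ) ^ 2 ≤ p / 2) :
    ∃ J : Finset (Fin m), #J ≤ s ∧ (GJ p u J ≤ p / 2 ∨ ∀ i ∉ J, u i ∈ TT p u J β0) := by
  have key : ∀ t : ℕ, ∃ J : Finset (Fin m), #J ≤ t ∧ (GJ p u J ≤ (1 - β0 / 2) ^ t * (p : ℝ) ^ 2 ∨ ∀ i ∉ J, u i ∈ TT p u J β0) := by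
    intro t
    induction t with
    | zero =>
      refine ⟨∅, by simp, Or.inl ?_⟩
      simp [GJ, fJ, Fintype.card_prod, ZMod.card, sq]
    | succ t ih =>
      obtain ⟨J, hJ, h | h⟩ := ih
      · by_cases hT : ∀ i ∉ J, u i ∈ TT p u J β0
        · exact ⟨J, by omega, Or.inr hT⟩
        · push Not at hT
          obtain ⟨i, hi, hiT⟩ := hT
          refine ⟨insert i J, by rw [card_insert_of_notMem hi]; omega, Or.inl ?_⟩
          refine (GJ_insert hi hiT).trans ?_
          rw [pow_succ', mul_assoc]
          exact mul_le_mul_of_nonneg_left h (by norm_num [β0])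
      · exact ⟨J, by omega, Or.inr h⟩
  obtain ⟨J, hJ, h | h⟩ := key s
  · exact ⟨J, hJ, Or.inl (h.trans hs)⟩
  · exact ⟨J, hJ, Or.inr h⟩

lemma fJ_congr {u u' : Fin m → V2 p} {J : Finset (Fin m)} (h : ∀ i ∈ J, u i = u' i) :
    fJ p u J = fJ p u' J := by
  funext v
  exact prod_congr rfl fun i hi => by rw [h i hi]
lemma TT_congr {u u' : Fin m → V2 p} {J : Finset (Fin m)} (h : ∀ i ∈ J, u i = u' i) (β : ℝ) :
    TT p u J β = TT p u' J β := by
  ext v; rw [mem_TT, mem_TT]; simp only [GJ, fJ_congr h]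

lemma gen (J : Finset (Fin m)) (h : (Fin m → V2 p) → V2 p → ℝ) (q : ℝ) (h0 : ∀ u v, 0 ≤ h u v)
    (hc : ∀ u u', (∀ i ∈ J, u i = u' i) → h u = h u') (hq : ∀ u, ∑ v, h u v ≤ q) :
    ∑ u : Fin m → V2 p, ∏ j ∈ Jᶜ, h u (u j) ≤ ((p : ℝ) ^ 2) ^ #J * q ^ (m - #J) := by
  let e := Equiv.piEquivPiSubtypeProd (fun i => i ∈ J) (fun _ : Fin m => V2 p)
  let ex : ((i : {x // x ∈ J}) → V2 p) → (Fin m → V2 p) := fun a i => if hi : i ∈ J then a ⟨i, hi⟩ else 0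
  have h1 : ∀ u : Fin m → V2 p, ∏ j ∈ Jᶜ, h u (u j) = ∏ j : {x // ¬ x ∈ J}, h (ex (e u).1) ((e u).2 j) := by
    intro u
    have : h u = h (ex (e u).1) := by
      apply hc; intro i hi; simp [ex, hi, e, Equiv.piEquivPiSubtypeProd]
    rw [← this]
    rw [prod_subtype (Jᶜ) (p := fun x => ¬ x ∈ J) (by simp)]
    rfl
  simp only [h1]
  rw [Fintype.sum_equiv e _ (fun ab => ∏ j : {x // ¬ x ∈ J}, h (ex ab.1) (ab.2 j)) (fun u => rfl),
    Fintype.sum_prod_type]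
  have h2 : ∀ a : (i : {x // x ∈ J}) → V2 p, ∑ b : (i : {x // ¬ x ∈ J}) → V2 p, ∏ j, h (ex a) (b j) ≤ q ^ (m - #J) := by
    intro a
    have := sum_prod_piFinset (ι := {x // ¬ x ∈ J}) (univ : Finset (V2 p)) (fun _ v => h (ex a) v)
    rw [Fintype.piFinset_univ] at this
    rw [this, prod_const, card_univ]
    have hcard : Fintype.card {x // ¬ x ∈ J} = m - #J := by
      rw [Fintype.card_subtype_compl]; simp
    rw [hcard]
    exact pow_le_pow_left₀ (sum_nonneg fun v _ => h0 _ _) (hq _) _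
  refine (sum_le_sum fun a _ => h2 a).trans ?_
  rw [sum_const, nsmul_eq_mul]
  simp [Fintype.card_prod, ZMod.card, ← sq]

def WW (u : Fin m → V2 p) : ℝ :=
  ∏ q : Fin m × Fin m, if q.1 < q.2 then cc p (BB p (u q.1) (u q.2)) else 1

lemma WW_le (u : Fin m → V2 p) (J : Finset (Fin m)) :
    WW u ≤ ∏ j ∈ Jᶜ, ∏ i ∈ J, cc p (BB p (u i) (u j)) := by
  let t : Fin m × Fin m → ℝ := fun q => if q.1 < q.2 then cc p (BB p (u q.1) (u q.2)) else 1
  have t0 : ∀ q, 0 ≤ t q := fun q => by simp only [t]; split_ifs; exacts [cc_nonneg _ _, zero_le_one]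
  have t1 : ∀ q, t q ≤ 1 := fun q => by simp only [t]; split_ifs; exacts [cc_le_one _ _, le_rfl]
  have hd : Disjoint (Jᶜ ×ˢ J) (J ×ˢ Jᶜ) := by
    rw [disjoint_left]; rintro ⟨a, b⟩ h h'
    simp at h h'; tauto
  have h1 : WW u ≤ ∏ q ∈ (Jᶜ ×ˢ J) ∪ (J ×ˢ Jᶜ), t q := by
    rw [WW, ← prod_sdiff (subset_univ ((Jᶜ ×ˢ J) ∪ (J ×ˢ Jᶜ)))]
    exact mul_le_of_le_one_left (prod_nonneg fun q _ => t0 q) (prod_le_one (fun q _ => t0 q) fun q _ => t1 q)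
  refine h1.trans (le_of_eq ?_)
  rw [prod_union hd, prod_product, prod_product_right, ← prod_mul_distrib]
  refine prod_congr rfl fun j hj => ?_
  rw [← prod_mul_distrib]
  refine prod_congr rfl fun i hi => ?_
  have hne : i ≠ j := by rintro rfl; simp at hj; exact hj hi
  simp only [t]
  rcases lt_or_gt_of_ne hne with h | h
  · rw [if_neg (not_lt.2 h.le), if_pos h, one_mul]
  · rw [if_pos h, if_neg (not_lt.2 h.le), mul_one, BB_comm]

open Classical in
def hh (J : Finset (Fin m)) (i0 : Fin m) (t : Fin 4) (u : Fin m → V2 p) (v : V2 p) : ℝ :=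
  match t with
  | 0 => if GJ p u J ≤ p / 2 then fJ p u J v else 0
  | 1 => if (#(TT p u J β0) : ℝ) ≤ p / 2 ∧ v ∈ TT p u J β0 then 1 else 0
  | 2 => if v = 0 then 1 else 0
  | 3 => if Nat.card (AddSubgroup.closure (TT p u J β0 : Set (V2 p))) ≤ p ∧
      (∃ x ∈ AddSubgroup.closure (TT p u J β0 : Set (V2 p)), BB p (u i0) x ≠ 0) ∧
      v ∈ AddSubgroup.closure (TT p u J β0 : Set (V2 p)) then cc p (BB p (u i0) v) else 0

lemma hh_nonneg (J : Finset (Fin m)) (i0 : Fin m) (t : Fin 4) (u : Fin m → V2 p) (v : V2 p) :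
    0 ≤ hh J i0 t u v := by
  fin_cases t <;> simp only [hh] <;> split_ifs <;>
    first | exact le_rfl | exact zero_le_one | exact fJ_nonneg _ _ _ _ | exact cc_nonneg _ _

open Classical in
lemma hh_sum (hp : 12 ≤ p) (J : Finset (Fin m)) (i0 : Fin m) (t : Fin 4) (u : Fin m → V2 p) :
    ∑ v, hh J i0 t u v ≤ 3 / 4 * p := by
  have hp0 : (12 : ℝ) ≤ p := by exact_mod_cast hp
  fin_cases t
  · simp only [hh]
    split_ifs with h
    · exact le_trans h (by linarith)
    · simp
  · simp only [hh]
    by_cases h : (#(TT p u J β0) : ℝ) ≤ p / 2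
    · simp [h]; linarith
    · simp [h]
  · simp [hh]; linarith
  · simp only [hh]
    set H := AddSubgroup.closure (TT p u J β0 : Set (V2 p))
    by_cases h : Nat.card H ≤ p ∧ ∃ x ∈ H, BB p (u i0) x ≠ 0
    · obtain ⟨hc, x, hx, hBx⟩ := h
      have h' : ∀ v, (Nat.card H ≤ p ∧ (∃ x ∈ H, BB p (u i0) x ≠ 0) ∧ v ∈ H) ↔ v ∈ H :=
        fun v => ⟨fun h => h.2.2, fun h => ⟨hc, ⟨x, hx, hBx⟩, h⟩⟩
      have h'' : ∀ v, (if (Nat.card H ≤ p ∧ (∃ x ∈ H, BB p (u i0) x ≠ 0) ∧ v ∈ H) then cc p (BB p (u i0) v) else 0) =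
          if v ∈ H then cc p (BB p (u i0) v) else 0 := fun v => if_congr (h' v) rfl rfl
      rw [sum_congr rfl fun v _ => h'' v, ← sum_filter]
      refine le_trans ?_ (sum_cc p (by omega))
      rw [← sum_image (f := cc p) (g := fun v => BB p (u i0) v)]
      · exact sum_le_sum_of_subset_of_nonneg (subset_univ _) fun _ _ _ => cc_nonneg _ _
      · -- injectivity on H
        let φ : H →+ ZMod p := AddMonoidHom.mk' (fun v => BB p (u i0) v) (fun a b => BB_add_right p _ _ _)
        have hr : φ.range = ⊤ := by
          have hpr : (Nat.card (ZMod p)).Prime := by rw [Nat.card_zmod]; exact Fact.out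
          have := Fact.mk hpr
          rcases AddSubgroup.eq_bot_or_eq_top_of_prime_card φ.range with h | h
          · exfalso; apply hBx
            have : φ ⟨x, hx⟩ ∈ φ.range := ⟨_, rfl⟩
            rw [h, AddSubgroup.mem_bot] at this; exact this
          · exact h
        have hsurj : Function.Surjective φ := AddMonoidHom.range_eq_top.1 hr
        have hbij : Function.Bijective φ := by
          apply hsurj.bijective_of_nat_card_le
          rw [Nat.card_zmod]; exact hc
        intro a ha b hb hab
        simp only [coe_filter, mem_univ, true_and] at ha hb
        have := hbij.1 (a₁ := ⟨a, ha⟩) (a₂ := ⟨b, hb⟩) hab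
        simpa using this
    · have h' : ∀ v, ¬ (Nat.card H ≤ p ∧ (∃ x ∈ H, BB p (u i0) x ≠ 0) ∧ v ∈ H) :=
        fun v hv => h ⟨hv.1, hv.2.1⟩
      rw [sum_eq_zero fun v _ => if_neg (h' v)]; linarith

lemma hh_congr (J : Finset (Fin m)) (i0 : Fin m) (t : Fin 4) (u u' : Fin m → V2 p)
    (h : ∀ i ∈ insert i0 J, u i = u' i) : hh J i0 t u = hh J i0 t u' := by
  have hJ : ∀ i ∈ J, u i = u' i := fun i hi => h i (mem_insert_of_mem hi)
  have h0 := h i0 (mem_insert_self _ _)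
  funext v
  have hT := TT_congr hJ β0
  have hf := fJ_congr hJ
  have hG : GJ p u J = GJ p u' J := by simp only [GJ, hf]
  fin_cases t <;> simp only [hh]
  · rw [hG, hf]
  · rw [hT]
  · rw [hT, h0]

lemma cover (hp : 12 ≤ p) (s : ℕ) (hs : (1 - β0 / 2) ^ s * (p : ℝ) ^ 2 ≤ p / 2) (u : Fin m → V2 p)
    (h1 : ∃ i, (u i).1 ≠ 0) (h2 : ∃ i, (u i).2 ≠ 0) :
    ∃ J : Finset (Fin m), #J ≤ s ∧ ∃ i0 t, WW u ≤ ∏ j ∈ (insert i0 J)ᶜ, hh J i0 t u (u j) := by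
  have hp2 : (2 : ZMod p) ≠ 0 := two_ne p (by omega)
  obtain ⟨J, hJ, hc⟩ := greedy u s hs
  refine ⟨J, hJ, ?_⟩
  obtain ⟨ia, hia⟩ := h1
  have hone : WW u ≤ 1 := by simpa using WW_le u ∅
  have hmem : ∀ i0 j, j ∈ (insert i0 J)ᶜ → j ∉ J := fun i0 j hj hjJ => by
    simp at hj; exact hj.2 hjJ
  by_cases hG : GJ p u J ≤ p / 2
  · refine ⟨ia, 0, (WW_le u (insert ia J)).trans ?_⟩
    refine prod_le_prod (fun j _ => prod_nonneg fun _ _ => cc_nonneg _ _) fun j hj => ?_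
    simp only [hh, hG, if_true, fJ]
    by_cases hiJ : ia ∈ J
    · rw [insert_eq_of_mem hiJ]
    · rw [prod_insert hiJ]
      exact mul_le_of_le_one_left (prod_nonneg fun _ _ => cc_nonneg _ _) (cc_le_one _ _)
  have hc' : ∀ i ∉ J, u i ∈ TT p u J β0 := by tauto
  rcases dichotomy hp (not_le.1 hG) with hd | hd
  · refine ⟨ia, 1, hone.trans (le_of_eq ?_)⟩
    symm; apply prod_eq_one
    intro j hj
    simp [hh, hd, hc' j (hmem _ _ hj)]
  by_cases hz : ∀ j ∉ J, u j = 0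
  · refine ⟨ia, 2, hone.trans (le_of_eq ?_)⟩
    symm; apply prod_eq_one
    intro j hj
    simp [hh, hz j (hmem _ _ hj)]
  push Not at hz
  obtain ⟨j, hj, hj0⟩ := hz
  set H := AddSubgroup.closure (TT p u J β0 : Set (V2 p)) with hH
  have hin : ∀ i ∉ J, u i ∈ H := fun i hi => AddSubgroup.subset_closure (by exact_mod_cast hc' i hi)
  have hex : ∃ i0, BB p (u i0) (u j) ≠ 0 := by
    by_contra hcon
    push Not at hcon
    obtain ⟨ib, hib⟩ := h2
    have e1 := hcon j
    have e2 := hcon ia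
    have e3 := hcon ib
    simp only [BB] at e1 e2 e3
    have e4 : (u j).1 * (u j).2 = 0 := by
      have : 2 * ((u j).1 * (u j).2) = 0 := by rw [← e1]; ring
      exact (mul_eq_zero.1 this).resolve_left hp2
    rcases mul_eq_zero.1 e4 with h | h
    · have h' : (u j).2 ≠ 0 := fun h' => hj0 (Prod.ext h h')
      rw [h, zero_mul, add_zero] at e2
      exact (mul_ne_zero hia h') e2
    · have h' : (u j).1 ≠ 0 := fun h' => hj0 (Prod.ext h' h)
      rw [h, mul_zero, zero_add] at e3
      exact (mul_ne_zero h' hib) e3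
  obtain ⟨i0, hi0⟩ := hex
  refine ⟨i0, 3, (WW_le u (insert i0 J)).trans ?_⟩
  refine prod_le_prod (fun j _ => prod_nonneg fun _ _ => cc_nonneg _ _) fun k hk => ?_
  have : Nat.card H ≤ p ∧ (∃ x ∈ H, BB p (u i0) x ≠ 0) ∧ u k ∈ H :=
    ⟨hd, ⟨u j, hin j hj, hi0⟩, hin k (hmem _ _ hk)⟩
  simp only [hh]
  rw [if_pos this, ← mul_prod_erase _ _ (mem_insert_self i0 J)]
  exact mul_le_of_le_one_right (cc_nonneg _ _) (prod_le_one (fun _ _ => cc_nonneg _ _) fun _ _ => cc_le_one _ _)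

lemma card_small (s : ℕ) : #((univ : Finset (Finset (Fin m))).filter (fun J => #J ≤ s)) ≤ (m + 1) ^ s := by
  have h1 : (univ : Finset (Finset (Fin m))).filter (fun J => #J ≤ s) ⊆
      (range (s + 1)).biUnion fun i => powersetCard i univ := by
    intro J hJ
    simp at hJ ⊢; omega
  refine (card_le_card h1).trans (card_biUnion_le.trans ?_)
  simp only [card_powersetCard, card_univ, Fintype.card_fin]
  clear h1
  induction s with
  | zero => simp
  | succ s ih =>
    rw [sum_range_succ, pow_succ, mul_add, mul_one]
    have : m.choose (s + 1) ≤ (m + 1) ^ s * m := by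
      refine (Nat.choose_le_pow _ _).trans ?_
      rw [pow_succ]
      exact Nat.mul_le_mul_right _ (Nat.pow_le_pow_left (by omega) _)
    omega

open Classical in
theorem sum_WW (hp : 12 ≤ p) (s : ℕ) (hs : (1 - β0 / 2) ^ s * (p : ℝ) ^ 2 ≤ p / 2) :
    ∑ u : Fin m → V2 p, (if (∃ i, (u i).1 ≠ 0) ∧ (∃ i, (u i).2 ≠ 0) then WW u else 0) ≤
      (m + 1) ^ s * m * 4 * (p ^ (m + s + 1) * (3 / 4) ^ (m - (s + 1))) := by
  have hp1 : (1 : ℝ) ≤ p := by exact_mod_cast (by omega : 1 ≤ p)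
  have h1 : ∀ u : Fin m → V2 p, (if (∃ i, (u i).1 ≠ 0) ∧ (∃ i, (u i).2 ≠ 0) then WW u else 0) ≤
      ∑ J ∈ univ.filter (fun J : Finset (Fin m) => #J ≤ s), ∑ i0, ∑ t, ∏ j ∈ (insert i0 J)ᶜ, hh J i0 t u (u j) := by
    intro u
    have nn : ∀ J : Finset (Fin m), ∀ i0 t, 0 ≤ ∏ j ∈ (insert i0 J)ᶜ, hh J i0 t u (u j) :=
      fun J i0 t => prod_nonneg fun j _ => hh_nonneg _ _ _ _ _
    split_ifs with h
    · obtain ⟨J, hJ, i0, t, hle⟩ := cover hp s hs u h.1 h.2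
      refine hle.trans ?_
      refine le_trans ?_ (single_le_sum (fun J _ => sum_nonneg fun i _ => sum_nonneg fun t _ => nn J i t)
        (mem_filter.2 ⟨mem_univ J, hJ⟩))
      refine le_trans ?_ (single_le_sum (fun i _ => sum_nonneg fun t _ => nn J i t) (mem_univ i0))
      exact single_le_sum (f := fun t => ∏ j ∈ (insert i0 J)ᶜ, hh J i0 t u (u j)) (fun t _ => nn J i0 t) (mem_univ t)
    · exact sum_nonneg fun J _ => sum_nonneg fun i _ => sum_nonneg fun t _ => nn J i t
  refine (sum_le_sum fun u _ => h1 u).trans ?_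
  rw [sum_comm]
  have h2 : ∀ J ∈ univ.filter (fun J : Finset (Fin m) => #J ≤ s),
      ∑ u : Fin m → V2 p, ∑ i0, ∑ t, ∏ j ∈ (insert i0 J)ᶜ, hh J i0 t u (u j) ≤
      m * 4 * (p ^ (m + s + 1) * (3 / 4) ^ (m - (s + 1))) := by
    intro J hJ
    rw [mem_filter] at hJ
    rw [sum_comm]
    have h3 : ∀ i0 : Fin m, ∑ u : Fin m → V2 p, ∑ t, ∏ j ∈ (insert i0 J)ᶜ, hh J i0 t u (u j) ≤
        4 * ((p : ℝ) ^ (m + s + 1) * (3 / 4) ^ (m - (s + 1))) := by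
      intro i0
      rw [sum_comm]
      have h4 : ∀ t, ∑ u : Fin m → V2 p, ∏ j ∈ (insert i0 J)ᶜ, hh J i0 t u (u j) ≤
          (p : ℝ) ^ (m + s + 1) * (3 / 4) ^ (m - (s + 1)) := by
        intro t
        refine (gen (insert i0 J) (hh J i0 t) (3 / 4 * p) (fun u v => hh_nonneg _ _ _ _ _)
          (fun u u' h => hh_congr _ _ _ _ _ h) (fun u => hh_sum hp _ _ _ _)).trans ?_
        have hk : #(insert i0 J) ≤ s + 1 := (card_insert_le _ _).trans (by omega)
        have hkm : #(insert i0 J) ≤ m := (card_le_univ _).trans (by simp)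
        set k := #(insert i0 J)
        rw [mul_pow, ← pow_mul, mul_left_comm, ← pow_add, mul_comm]
        gcongr ?_ * ?_
        · exact pow_le_pow_right₀ hp1 (by omega)
        · exact pow_le_pow_of_le_one (by norm_num) (by norm_num) (by omega)
      refine (sum_le_sum fun t _ => h4 t).trans ?_
      simp
    refine (sum_le_sum fun i0 _ => h3 i0).trans ?_
    simp [mul_assoc]
  refine (sum_le_card_nsmul _ _ _ h2).trans ?_
  rw [nsmul_eq_mul]
  have : ((#(univ.filter (fun J : Finset (Fin m) => #J ≤ s)) : ℕ) : ℝ) ≤ (m + 1) ^ s := by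
    exact_mod_cast card_small s
  calc _ ≤ ((m : ℝ) + 1) ^ s * (m * 4 * (p ^ (m + s + 1) * (3 / 4) ^ (m - (s + 1)))) :=
        mul_le_mul_of_nonneg_right this (by positivity)
    _ = _ := by ring

end wsum2
end RM

namespace RM
section firstmom
variable {p : ℕ} [Fact p.Prime] {m : ℕ}

def bq (u : Fin m → V2 p) (i j : Fin m) : ZMod p :=
  if i < j then BB p (u i) (u j) else if i = j then (u i).1 * (u i).2 else 0

lemma quad (ω : Fin m → Fin m → Bool) (u : Fin m → V2 p) :
    ∑ i, ∑ j, (u i).1 * (symMat (ZMod p) ω i j * (u j).2) =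
      ∑ i, ∑ j, signb (ZMod p) (ω i j) * bq u i j := by
  have h1 : ∀ i j : Fin m, (u i).1 * (symMat (ZMod p) ω i j * (u j).2) =
      (if i < j then signb (ZMod p) (ω i j) * ((u i).1 * (u j).2) else 0) +
      (if i = j then signb (ZMod p) (ω i j) * ((u i).1 * (u j).2) else 0) +
      (if j < i then signb (ZMod p) (ω j i) * ((u i).1 * (u j).2) else 0) := by
    intro i j
    rcases lt_trichotomy i j with h | h | h
    · simp [symMat, h, h.le, h.ne, h.not_gt]; ring
    · subst h; simp [symMat]; ring
    · simp [symMat, h, h.le, h.ne', h.not_gt]; ring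
  simp only [h1, sum_add_distrib]
  rw [sum_comm (f := fun i j => if j < i then signb (ZMod p) (ω j i) * ((u i).1 * (u j).2) else 0)]
  simp only [← sum_add_distrib]
  refine sum_congr rfl fun i _ => sum_congr rfl fun j _ => ?_
  simp only [bq, BB]
  rcases lt_trichotomy i j with h | h | h
  · simp [h, h.ne]; ring
  · subst h; simp
  · simp [h.ne', h.not_gt]

lemma achar_sum {ι : Type*} (ψ : AddChar (ZMod p) ℂ) (t : Finset ι) (f : ι → ZMod p) :
    ψ (∑ i ∈ t, f i) = ∏ i ∈ t, ψ (f i) := by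
  classical
  induction t using Finset.induction_on with
  | empty => simp
  | insert a t ha ih => rw [sum_insert ha, prod_insert ha, AddChar.map_add_eq_mul, ih]

lemma sum_split {R : Type*} [AddCommMonoid R] (F : (Fin m → ZMod p) → (Fin m → ZMod p) → R) :
    ∑ u : Fin m → V2 p, F (fun i => (u i).1) (fun i => (u i).2) = ∑ w, ∑ z, F z w := by
  rw [← Fintype.sum_prod_type_right (f := fun q : (Fin m → ZMod p) × (Fin m → ZMod p) => F q.1 q.2)]
  exact Fintype.sum_equiv (Equiv.arrowProdEquivProdArrow _ _ _) _ _ (fun u => rfl)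

lemma char_norm (lam : ZMod p) (u : Fin m → V2 p) :
    ‖∑ ω : Fin m → Fin m → Bool, ZMod.stdAddChar
      (∑ i, (u i).1 * (((Matrix.scalar (Fin m) lam - symMat (ZMod p) ω).mulVec fun j => (u j).2) i))‖ ≤
      Fintype.card (Fin m → Fin m → Bool) * WW u := by
  have h1 : ∀ ω : Fin m → Fin m → Bool, ZMod.stdAddChar
      (∑ i, (u i).1 * (((Matrix.scalar (Fin m) lam - symMat (ZMod p) ω).mulVec fun j => (u j).2) i)) =
      ZMod.stdAddChar (∑ i, (u i).1 * (lam * (u i).2)) *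
      ∏ i, ∏ j, ZMod.stdAddChar (- (signb (ZMod p) (ω i j) * bq u i j)) := by
    intro ω
    have : ∑ i, (u i).1 * (((Matrix.scalar (Fin m) lam - symMat (ZMod p) ω).mulVec fun j => (u j).2) i) =
        (∑ i, (u i).1 * (lam * (u i).2)) + ∑ i, ∑ j, (- (signb (ZMod p) (ω i j) * bq u i j)) := by
      simp only [sum_neg_distrib]
      rw [← quad, ← sub_eq_add_neg, ← sum_sub_distrib]
      refine sum_congr rfl fun i _ => ?_
      rw [Matrix.sub_mulVec, Pi.sub_apply, mul_sub]
      congr 2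
      · simp [Matrix.scalar_apply, Matrix.mulVec_diagonal]
      · simp only [Matrix.mulVec, dotProduct, mul_sum]
    rw [this, AddChar.map_add_eq_mul, achar_sum]
    simp only [achar_sum]
  simp only [h1]
  rw [← mul_sum, norm_mul, AddChar.norm_apply, one_mul]
  have h2 : ∑ ω : Fin m → Fin m → Bool, ∏ i, ∏ j, (ZMod.stdAddChar (- (signb (ZMod p) (ω i j) * bq u i j)) : ℂ) =
      ∏ i, ∏ j, ∑ b : Bool, (ZMod.stdAddChar (- (signb (ZMod p) b * bq u i j)) : ℂ) := by
    rw [← Fintype.prod_sum (fun i (r : Fin m → Bool) => ∏ j, (ZMod.stdAddChar (- (signb (ZMod p) (r j) * bq u i j)) : ℂ))]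
    refine prod_congr rfl fun i _ => ?_
    rw [← Fintype.prod_sum (fun j (b : Bool) => (ZMod.stdAddChar (- (signb (ZMod p) b * bq u i j)) : ℂ))]
  rw [h2]
  have h3 : ∀ x : ZMod p, ‖∑ b : Bool, ZMod.stdAddChar (- (signb (ZMod p) b * x))‖ = 2 * cc p x := by
    intro x
    have : ∑ b : Bool, ZMod.stdAddChar (- (signb (ZMod p) b * x)) = ((2 * (ZMod.stdAddChar x).re : ℝ) : ℂ) := by
      simp only [Fintype.sum_bool, signb, if_true]
      simp only [Bool.false_eq_true, if_false, one_mul, neg_mul, neg_neg]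
      rw [AddChar.map_neg_eq_conj, add_comm, Complex.add_conj]
    rw [this, Complex.norm_real, Real.norm_eq_abs, abs_mul, cc]; simp
  simp only [norm_prod, h3]
  have h4 : ∀ i j, 2 * cc p (bq u i j) ≤ 2 * (if i < j then cc p (BB p (u i) (u j)) else 1) := by
    intro i j
    refine mul_le_mul_of_nonneg_left ?_ (by norm_num)
    by_cases h : i < j
    · simp [bq, h]
    · rw [if_neg h]; exact cc_le_one _ _
  refine (prod_le_prod (fun i _ => prod_nonneg fun j _ => by have := cc_nonneg p (bq u i j); positivity) fun i _ =>
    prod_le_prod (fun j _ => by have := cc_nonneg p (bq u i j); positivity) fun j _ => h4 i j).trans (le_of_eq ?_)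
  rw [WW, Fintype.prod_prod_type]
  simp only [prod_mul_distrib]
  simp

lemma orth (v : Fin m → ZMod p) :
    ∑ z : Fin m → ZMod p, ZMod.stdAddChar (∑ i, z i * v i) = if v = 0 then (p : ℂ) ^ m else 0 := by
  have : ∀ z : Fin m → ZMod p, (ZMod.stdAddChar (∑ i, z i * v i) : ℂ) = ∏ i, ZMod.stdAddChar (z i * v i) :=
    fun z => achar_sum _ _ _
  simp only [this]
  rw [← Fintype.prod_sum (fun i (x : ZMod p) => (ZMod.stdAddChar (x * v i) : ℂ))]
  simp only [AddChar.sum_mulShift _ (ZMod.isPrimitive_stdAddChar p), ZMod.card]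
  split_ifs with h
  · subst h; simp
  · obtain ⟨i, hi⟩ := Function.ne_iff.1 h
    exact prod_eq_zero (mem_univ i) (by simp at hi; simp [hi])

def epsm (p m s : ℕ) : ℝ := (m + 1) ^ s * m * 4 * (p ^ (s + 1) * (3 / 4) ^ (m - (s + 1)))

open Classical in
lemma first_moment (hp : 12 ≤ p) (s : ℕ) (hs : (1 - β0 / 2) ^ s * (p : ℝ) ^ 2 ≤ p / 2) (lam : ZMod p) :
    ∑ ω : Fin m → Fin m → Bool, (#{w | (Matrix.scalar (Fin m) lam - symMat (ZMod p) ω).mulVec w = 0} : ℝ) ≤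
      Fintype.card (Fin m → Fin m → Bool) * (2 + epsm p m s) := by
  have hp0 : (0 : ℝ) < p := by exact_mod_cast (by omega : 0 < p)
  have h1 : ∀ ω : Fin m → Fin m → Bool,
      (p : ℂ) ^ m * (#{w | (Matrix.scalar (Fin m) lam - symMat (ZMod p) ω).mulVec w = 0} : ℂ) =
      ∑ u : Fin m → V2 p, ZMod.stdAddChar
      (∑ i, (u i).1 * (((Matrix.scalar (Fin m) lam - symMat (ZMod p) ω).mulVec fun j => (u j).2) i)) := by
    intro ω
    rw [sum_split (fun z w => (ZMod.stdAddChar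
      (∑ i, z i * (((Matrix.scalar (Fin m) lam - symMat (ZMod p) ω).mulVec w) i)) : ℂ))]
    simp only [orth]
    rw [sum_ite]
    simp [mul_comm]
  have h2 : (p : ℝ) ^ m * ∑ ω : Fin m → Fin m → Bool,
      (#{w | (Matrix.scalar (Fin m) lam - symMat (ZMod p) ω).mulVec w = 0} : ℝ) ≤
      ∑ u : Fin m → V2 p, Fintype.card (Fin m → Fin m → Bool) * WW u := by
    have : (((p : ℝ) ^ m * ∑ ω : Fin m → Fin m → Bool,
      (#{w | (Matrix.scalar (Fin m) lam - symMat (ZMod p) ω).mulVec w = 0} : ℝ) : ℝ) : ℂ) =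
      ∑ u : Fin m → V2 p, ∑ ω : Fin m → Fin m → Bool, ZMod.stdAddChar
      (∑ i, (u i).1 * (((Matrix.scalar (Fin m) lam - symMat (ZMod p) ω).mulVec fun j => (u j).2) i)) := by
      rw [sum_comm]
      simp only [← h1]
      push_cast
      rw [mul_sum]
    calc _ ≤ ‖(((p : ℝ) ^ m * ∑ ω : Fin m → Fin m → Bool,
      (#{w | (Matrix.scalar (Fin m) lam - symMat (ZMod p) ω).mulVec w = 0} : ℝ) : ℝ) : ℂ)‖ := by
          rw [Complex.norm_real]; exact le_abs_self _
      _ ≤ _ := by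
          rw [this]
          exact (norm_sum_le _ _).trans (sum_le_sum fun u _ => char_norm lam u)
  rw [← mul_sum] at h2
  have h3 : ∑ u : Fin m → V2 p, WW u ≤ 2 * (p : ℝ) ^ m + p ^ m * epsm p m s := by
    have a1 : ∀ u : Fin m → V2 p, WW u ≤ (if (∀ i, (u i).1 = 0) then (1 : ℝ) else 0) +
        (if (∀ i, (u i).2 = 0) then (1 : ℝ) else 0) +
        (if (∃ i, (u i).1 ≠ 0) ∧ (∃ i, (u i).2 ≠ 0) then WW u else 0) := by
      intro u
      have hone : WW u ≤ 1 := by simpa using WW_le u ∅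
      have hnn : 0 ≤ WW u := prod_nonneg fun q _ => by split_ifs; exacts [cc_nonneg _ _, zero_le_one]
      by_cases ha : ∀ i, (u i).1 = 0
      · rw [if_pos ha]
        have : (0 : ℝ) ≤ (if (∀ i, (u i).2 = 0) then (1 : ℝ) else 0) := by split_ifs <;> norm_num
        have : (0 : ℝ) ≤ (if (∃ i, (u i).1 ≠ 0) ∧ (∃ i, (u i).2 ≠ 0) then WW u else 0) := by
          split_ifs <;> simp [hnn]
        linarith
      · by_cases hb : ∀ i, (u i).2 = 0
        · rw [if_neg ha, if_pos hb]
          have : (0 : ℝ) ≤ (if (∃ i, (u i).1 ≠ 0) ∧ (∃ i, (u i).2 ≠ 0) then WW u else 0) := by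
            split_ifs <;> simp [hnn]
          linarith
        · rw [if_neg ha, if_neg hb, if_pos ⟨by simpa using ha, by simpa using hb⟩]; simp
    refine (sum_le_sum fun u _ => a1 u).trans ?_
    rw [sum_add_distrib, sum_add_distrib]
    have a2 := sum_WW (m := m) hp s hs
    have a3 : ∑ u : Fin m → V2 p, (if (∀ i, (u i).1 = 0) then (1 : ℝ) else 0) = p ^ m := by
      rw [sum_split (fun z w => if (∀ i, z i = 0) then (1 : ℝ) else 0)]
      have : ∀ x : Fin m → ZMod p, (∀ i, x i = 0) ↔ x = 0 := fun x => by rw [funext_iff]; rfl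
      simp [this]
    have a4 : ∑ u : Fin m → V2 p, (if (∀ i, (u i).2 = 0) then (1 : ℝ) else 0) = p ^ m := by
      rw [sum_split (fun z w => if (∀ i, w i = 0) then (1 : ℝ) else 0)]
      have : ∀ x : Fin m → ZMod p, (∀ i, x i = 0) ↔ x = 0 := fun x => by rw [funext_iff]; rfl
      simp [this]
    rw [a3, a4]
    have : ((m : ℝ) + 1) ^ s * m * 4 * (p ^ (m + s + 1) * (3 / 4) ^ (m - (s + 1))) = p ^ m * epsm p m s := by
      rw [epsm, show m + s + 1 = m + (s + 1) by ring, pow_add _ m]; ring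
    linarith
  have h4 : (p : ℝ) ^ m * ∑ ω : Fin m → Fin m → Bool,
      (#{w | (Matrix.scalar (Fin m) lam - symMat (ZMod p) ω).mulVec w = 0} : ℝ) ≤
      p ^ m * (Fintype.card (Fin m → Fin m → Bool) * (2 + epsm p m s)) := by
    refine h2.trans ((mul_le_mul_of_nonneg_left h3 (by positivity)).trans (le_of_eq (by ring)))
  exact le_of_mul_le_mul_left h4 (by positivity)

open Classical in
lemma sing_card (A : Matrix (Fin m) (Fin m) (ZMod p)) :
    1 + ((p : ℝ) - 1) * (if A.det = 0 then 1 else 0) ≤ (#{w | A.mulVec w = 0} : ℝ) := by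
  split_ifs with h
  · obtain ⟨v, hv0, hv⟩ := Matrix.exists_mulVec_eq_zero_iff.2 h
    have : #((univ : Finset (ZMod p)).image fun c => c • v) ≤ #{w | A.mulVec w = 0} := by
      refine card_le_card fun w hw => ?_
      obtain ⟨c, -, rfl⟩ := mem_image.1 hw
      simp [Matrix.mulVec_smul, hv]
    rw [card_image_of_injective _ (smul_left_injective _ hv0), card_univ, ZMod.card] at this
    have : (p : ℝ) ≤ #{w | A.mulVec w = 0} := by exact_mod_cast this
    linarith
  · have : 0 < #{w | A.mulVec w = 0} := card_pos.2 ⟨0, by simp⟩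
    have : (1 : ℝ) ≤ #{w | A.mulVec w = 0} := by exact_mod_cast this
    linarith

open Classical in
theorem expected_roots (hp : 12 ≤ p) (s : ℕ) (hs : (1 - β0 / 2) ^ s * (p : ℝ) ^ 2 ≤ p / 2) :
    ∑ ω : Fin m → Fin m → Bool, (#{x : ZMod p | (symMat (ZMod p) ω).charpoly.eval x = 0} : ℝ) * (p - 1) ≤
      Fintype.card (Fin m → Fin m → Bool) * (p * (1 + epsm p m s)) := by
  have h1 : ∀ lam : ZMod p, ∑ ω : Fin m → Fin m → Bool,
      ((p : ℝ) - 1) * (if (symMat (ZMod p) ω).charpoly.eval lam = 0 then 1 else 0) ≤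
      Fintype.card (Fin m → Fin m → Bool) * (1 + epsm p m s) := by
    intro lam
    have a1 := first_moment (m := m) hp s hs lam
    have a2 := sum_le_sum fun (ω : Fin m → Fin m → Bool) (_ : ω ∈ univ) =>
      sing_card (Matrix.scalar (Fin m) lam - symMat (ZMod p) ω)
    have a3 := a2.trans a1
    rw [sum_add_distrib] at a3
    simp only [Matrix.eval_charpoly]
    rw [sum_const, nsmul_eq_mul, card_univ] at a3
    linarith
  have h2 := sum_le_sum fun (lam : ZMod p) (_ : lam ∈ univ) => h1 lam
  rw [sum_comm] at h2
  simp only [sum_const, card_univ, ZMod.card, nsmul_eq_mul] at h2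
  refine (le_of_eq ?_).trans (h2.trans (le_of_eq (by ring)))
  refine sum_congr rfl fun ω _ => ?_
  rw [← mul_sum, card_filter]; push_cast; ring

end firstmom
end RM

namespace PS
open MeasureTheory Matrix
section summ
variable {ι : Type*} [Fintype ι] [DecidableEq ι]

lemma summable_int_gauss {b : ℝ} (hb : 0 < b) : Summable fun k : ℤ => Real.exp (-b * (k : ℝ) ^ 2) := by
  have h : Summable fun k : ℕ => Real.exp (-b * (k : ℝ) ^ 2) := by
    refine Summable.of_nonneg_of_le (fun k => (Real.exp_pos _).le) (fun k => ?_)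
      (summable_geometric_of_lt_one (Real.exp_pos (-b)).le (by rw [Real.exp_lt_one_iff]; linarith))
    rw [← Real.exp_nat_mul]
    apply Real.exp_le_exp.2
    have : (k : ℝ) ≤ (k : ℝ) ^ 2 := by
      rcases Nat.eq_zero_or_pos k with h | h
      · simp [h]
      · have : (1 : ℝ) ≤ k := by exact_mod_cast h
        nlinarith
    nlinarith
  refine Summable.of_nat_of_neg (by simpa using h) (by simpa using h)

lemma summable_pi_prod (f : ℤ → ℝ) (h0 : ∀ k, 0 ≤ f k) (hf : Summable f) :
    Summable fun m : ι → ℤ => ∏ i, f (m i) := by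
  refine summable_of_sum_le (c := (∑' k, f k) ^ Fintype.card ι) (fun m => prod_nonneg fun i _ => h0 _) fun S => ?_
  have hS : S ⊆ Fintype.piFinset fun i => S.image fun m => m i := fun m hm => by
    rw [Fintype.mem_piFinset]; intro i; exact mem_image_of_mem _ hm
  refine (sum_le_sum_of_subset_of_nonneg hS fun m _ _ => prod_nonneg fun i _ => h0 _).trans ?_
  rw [← prod_univ_sum (fun i => S.image fun m => m i) (fun _ k => f k), ← card_univ, ← prod_const]
  exact prod_le_prod (fun i _ => sum_nonneg fun k _ => h0 k) fun i _ => hf.sum_le_tsum _ fun k _ => h0 k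

def gA (A : Matrix ι ι ℝ) (x : ι → ℝ) : ℝ := Real.exp (-Real.pi * ∑ i, (A.mulVec x i) ^ 2)

lemma gA_pos (A : Matrix ι ι ℝ) (x : ι → ℝ) : 0 < gA A x := Real.exp_pos _

lemma gA_cont (A : Matrix ι ι ℝ) : Continuous (gA A) := by
  unfold gA mulVec dotProduct
  fun_prop

lemma quad_lower (A : Matrix ι ι ℝ) (hA : A.det ≠ 0) :
    ∃ c > 0, ∀ x : ι → ℝ, c * ∑ i, x i ^ 2 ≤ ∑ i, (A.mulVec x i) ^ 2 := by
  set C : ℝ := ∑ i, ∑ j, (A⁻¹ i j) ^ 2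
  have hC : 0 ≤ C := sum_nonneg fun i _ => sum_nonneg fun j _ => sq_nonneg _
  refine ⟨1 / (C + 1), by positivity, fun x => ?_⟩
  rw [div_mul_eq_mul_div, one_mul, div_le_iff₀ (by positivity)]
  have hx : ∀ i, x i = ∑ j, A⁻¹ i j * A.mulVec x j := by
    intro i
    have : A⁻¹.mulVec (A.mulVec x) = x := by
      rw [mulVec_mulVec, nonsing_inv_mul _ (isUnit_iff_ne_zero.2 hA), one_mulVec]
    nth_rewrite 1 [← this]; rfl
  have : ∀ i, x i ^ 2 ≤ (∑ j, (A⁻¹ i j) ^ 2) * ∑ i, (A.mulVec x i) ^ 2 := fun i => by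
    nth_rewrite 1 [hx i]
    exact sum_mul_sq_le_sq_mul_sq _ _ _
  have h2 := sum_le_sum fun i (_ : i ∈ univ) => this i
  rw [← sum_mul] at h2
  have : 0 ≤ ∑ i, (A.mulVec x i) ^ 2 := sum_nonneg fun i _ => sq_nonneg _
  nlinarith

lemma gA_bound (A : Matrix ι ι ℝ) (hA : A.det ≠ 0) : ∃ b > 0, ∀ x, gA A x ≤ ∏ i, Real.exp (-b * x i ^ 2) := by
  obtain ⟨c, hc, h⟩ := quad_lower A hA
  refine ⟨Real.pi * c, by positivity, fun x => ?_⟩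
  rw [← Real.exp_sum, gA]
  apply Real.exp_le_exp.2
  rw [← mul_sum]
  have := h x
  nlinarith [Real.pi_pos]

lemma gA_bound_shift (A : Matrix ι ι ℝ) (hA : A.det ≠ 0) (R : ℝ) : ∃ u : (ι → ℤ) → ℝ, Summable u ∧
    ∀ (m : ι → ℤ) (x : ι → ℝ), (∀ i, |x i| ≤ R) → gA A (fun i => x i + m i) ≤ u m := by
  obtain ⟨b, hb, h⟩ := gA_bound A hA
  refine ⟨fun m => ∏ i, (Real.exp (b * R ^ 2) * Real.exp (-(b / 2) * (m i : ℝ) ^ 2)), ?_, fun m x hx => ?_⟩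
  · exact summable_pi_prod (fun k => Real.exp (b * R ^ 2) * Real.exp (-(b / 2) * (k : ℝ) ^ 2))
      (fun k => by positivity) ((summable_int_gauss (by positivity)).mul_left _)
  · refine (h _).trans (prod_le_prod (fun i _ => (Real.exp_pos _).le) fun i _ => ?_)
    rw [← Real.exp_add]
    apply Real.exp_le_exp.2
    have h1 : x i ^ 2 ≤ R ^ 2 := sq_le_sq' (by have := neg_abs_le (x i); linarith [hx i]) (by have := le_abs_self (x i); linarith [hx i])
    have h2 : (m i : ℝ) ^ 2 ≤ 2 * (x i + m i) ^ 2 + 2 * R ^ 2 := by nlinarith [sq_nonneg (2 * x i + m i)]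
    nlinarith

lemma gA_summable (A : Matrix ι ι ℝ) (hA : A.det ≠ 0) (x : ι → ℝ) :
    Summable fun m : ι → ℤ => gA A (fun i => x i + m i) := by
  obtain ⟨u, hu, h⟩ := gA_bound_shift A hA (∑ i, |x i|)
  exact Summable.of_nonneg_of_le (fun m => (gA_pos _ _).le) (fun m => h m x fun i =>
    single_le_sum (f := fun i => |x i|) (fun i _ => abs_nonneg _) (mem_univ i)) hu

def per (A : Matrix ι ι ℝ) (x : ι → ℝ) : ℝ := ∑' m : ι → ℤ, gA A (fun i => x i + m i)

lemma per_cont (A : Matrix ι ι ℝ) (hA : A.det ≠ 0) : Continuous (per A) := by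
  rw [continuous_iff_continuousAt]
  intro x
  obtain ⟨u, hu, h⟩ := gA_bound_shift A hA (‖x‖ + 1)
  have hc : ContinuousOn (per A) (Metric.ball x 1) := by
    refine continuousOn_tsum (fun m => Continuous.continuousOn ?_) hu fun m y hy => ?_
    · exact (gA_cont A).comp (by fun_prop)
    · rw [Real.norm_of_nonneg (gA_pos _ _).le]
      refine h m y fun i => ?_
      have h1 : ‖y‖ ≤ ‖x‖ + 1 := by
        have := norm_le_norm_add_norm_sub' y x
        rw [mem_ball_iff_norm] at hy
        linarith
      exact (norm_le_pi_norm y i).trans h1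
  exact hc.continuousAt (Metric.ball_mem_nhds x one_pos)

lemma per_periodic (A : Matrix ι ι ℝ) (x : ι → ℝ) (k : ι → ℤ) : per A (fun i => x i + k i) = per A x := by
  unfold per
  rw [← (Equiv.addLeft k).tsum_eq (fun m : ι → ℤ => gA A (fun i => x i + m i))]
  congr 1; funext m; congr 1; funext i
  simp [add_assoc]

lemma gA_integrable (A : Matrix ι ι ℝ) (hA : A.det ≠ 0) : Integrable (gA A) := by
  obtain ⟨b, hb, h⟩ := gA_bound A hA
  refine Integrable.mono' (Integrable.fintype_prod (f := fun (_ : ι) x => Real.exp (-b * x ^ 2)) fun i => integrable_exp_neg_mul_sq hb)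
    (gA_cont A).aestronglyMeasurable (Filter.Eventually.of_forall fun x => ?_)
  rw [Real.norm_of_nonneg (gA_pos _ _).le]; exact h x

lemma gA_fourier (A : Matrix ι ι ℝ) (hA : A.det ≠ 0) (n : ι → ℤ) :
    ∫ x : ι → ℝ, Complex.exp (-2 * Real.pi * Complex.I * ∑ i, n i * x i) * (gA A x : ℂ) =
      (|A.det|⁻¹ * gA (A⁻¹)ᵀ (fun i => n i) : ℝ) := by
  set c : ι → ℝ := (A⁻¹)ᵀ.mulVec (fun i => (n i : ℝ)) with hc
  let F : (ι → ℝ) → ℂ := fun y => ∏ i, (Complex.exp (Complex.I * (-2 * Real.pi * c i : ℂ) * (y i : ℂ)) * Complex.exp (-(Real.pi : ℂ) * (y i : ℂ) ^ 2))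
  have h1 : ∀ x : ι → ℝ, Complex.exp (-2 * Real.pi * Complex.I * ∑ i, n i * x i) * (gA A x : ℂ) = F (toLin' A x) := by
    intro x
    simp only [F, prod_mul_distrib, ← Complex.exp_sum, gA]
    push_cast
    congr 1
    · congr 1
      have : (∑ i, (n i : ℝ) * x i) = ∑ i, c i * (A.mulVec x i) := by
        have e1 : ∑ i, (n i : ℝ) * x i = (fun i => (n i : ℝ)) ⬝ᵥ x := rfl
        have e2 : ∑ i, c i * (A.mulVec x i) = c ⬝ᵥ A.mulVec x := rfl
        rw [e1, e2, hc, mulVec_transpose, ← dotProduct_mulVec, mulVec_mulVec, nonsing_inv_mul _ (isUnit_iff_ne_zero.2 hA), one_mulVec]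
      have h2 : (∑ i, (n i : ℂ) * x i) = ∑ i, (c i : ℂ) * (A.mulVec x i : ℂ) := by exact_mod_cast congrArg (fun t : ℝ => (t : ℂ)) this
      rw [h2, mul_sum]
      refine sum_congr rfl fun i _ => ?_
      rw [toLin'_apply]; ring
    · congr 1
      rw [mul_sum]
      simp [toLin'_apply]
  simp only [h1]
  have hmeas : Measurable (toLin' A) := (toLin' A).continuous_of_finiteDimensional.measurable
  have hFc : Continuous F := by fun_prop
  have h2 := integral_map hmeas.aemeasurable (f := F) hFc.aestronglyMeasurable (μ := volume)
  rw [← h2, Real.map_matrix_volume_pi_eq_smul_volume_pi hA, integral_smul_measure]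
  rw [integral_fintype_prod_volume_eq_prod (fun i (y : ℝ) => Complex.exp (Complex.I * (-2 * Real.pi * c i : ℂ) * (y : ℂ)) * Complex.exp (-(Real.pi : ℂ) * (y : ℂ) ^ 2))]
  have h3 : ∀ i, ∫ y : ℝ, Complex.exp (Complex.I * (-2 * Real.pi * c i : ℂ) * (y : ℂ)) * Complex.exp (-(Real.pi : ℂ) * (y : ℂ) ^ 2) =
      Complex.exp (-Real.pi * (c i : ℂ) ^ 2) := by
    intro i
    rw [fourierIntegral_gaussian (by simpa using Real.pi_pos)]
    have : (Real.pi : ℂ) ≠ 0 := by exact_mod_cast Real.pi_ne_zero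
    rw [div_self this, Complex.one_cpow, one_mul]
    congr 1
    field_simp
    ring
  simp only [h3, ← Complex.exp_sum]
  rw [ENNReal.toReal_ofReal (abs_nonneg _), abs_inv, Complex.real_smul, gA, ← hc]
  push_cast
  rw [mul_sum]

end summ

section poisson
variable {ι : Type*} [Fintype ι] [DecidableEq ι]

lemma exists_lift (A : Matrix ι ι ℝ) (hA : A.det ≠ 0) :
    ∃ F : C(UnitAddTorus ι, ℂ), ∀ x : ι → ℝ, F (fun i => (x i : AddCircle (1 : ℝ))) = per A x := by
  let q : (ι → ℝ) → UnitAddTorus ι := Pi.map fun _ x => (x : AddCircle (1 : ℝ))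
  have hq : IsOpenQuotientMap q := IsOpenQuotientMap.piMap fun i => QuotientAddGroup.isOpenQuotientMap_mk
  let f : UnitAddTorus ι → ℂ := fun t => per A (Function.surjInv hq.surjective t)
  have hf : ∀ x, f (q x) = per A x := by
    intro x
    have h1 : q (Function.surjInv hq.surjective (q x)) = q x := Function.surjInv_eq _ _
    have h2 : ∀ i, ∃ k : ℤ, Function.surjInv hq.surjective (q x) i = x i + k := by
      intro i
      have := congrFun h1 i
      simp only [q, Pi.map] at this
      rw [QuotientAddGroup.eq] at this
      obtain ⟨k, hk⟩ := AddSubgroup.mem_zmultiples_iff.1 this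
      refine ⟨-k, ?_⟩
      simp at hk
      push_cast
      simp only [q, Pi.map]
      linarith
    choose k hk using h2
    have : Function.surjInv hq.surjective (q x) = fun i => x i + k i := funext hk
    simp only [f]
    rw [this, per_periodic]
  refine ⟨⟨f, ?_⟩, hf⟩
  rw [← hq.continuous_comp_iff]
  have : f ∘ q = fun x => (per A x : ℂ) := funext hf
  rw [this]
  exact Complex.continuous_ofReal.comp (per_cont A hA)

def box (m : ι → ℤ) : Set (ι → ℝ) := Set.univ.pi fun i => Set.Ioc (m i : ℝ) (m i + 1)

lemma box_meas (m : ι → ℤ) : MeasurableSet (box m) := MeasurableSet.univ_pi fun i => measurableSet_Ioc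
lemma box_union : (⋃ m : ι → ℤ, box m) = Set.univ := by
  rw [Set.eq_univ_iff_forall]
  intro x
  rw [Set.mem_iUnion]
  refine ⟨fun i => ⌈x i⌉ - 1, fun i _ => ?_⟩
  have h1 := Int.le_ceil (x i)
  have h2 := Int.ceil_lt_add_one (x i)
  constructor <;> push_cast <;> linarith
lemma box_disj : Pairwise (Function.onFun Disjoint (box : (ι → ℤ) → Set (ι → ℝ))) := by
  intro m m' h
  rw [Function.onFun, Set.disjoint_left]
  intro x hx hx'
  apply h
  funext i
  have h1 := hx i trivial
  have h2 := hx' i trivial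
  have h3 : (m i : ℝ) < m' i + 1 := h1.1.trans_le h2.2
  have h4 : (m' i : ℝ) < m i + 1 := h2.1.trans_le h1.2
  have h3' : m i < m' i + 1 := by exact_mod_cast h3
  have h4' : m' i < m i + 1 := by exact_mod_cast h4
  omega

lemma box_shift {E : Type*} [NormedAddCommGroup E] [NormedSpace ℝ E] (g : (ι → ℝ) → E) (m : ι → ℤ) :
    ∫ x in box m, g x = ∫ x in box 0, g (fun i => x i + m i) := by
  have h := (measurePreserving_add_right (volume : Measure (ι → ℝ)) (fun i => (m i : ℝ))).setIntegral_preimage_emb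
    (MeasurableEquiv.addRight (fun i => (m i : ℝ))).measurableEmbedding g (box m)
  rw [← h]
  have : (fun x : ι → ℝ => x + fun i => (m i : ℝ)) ⁻¹' box m = box 0 := by
    ext x; simp only [box, Set.mem_preimage, Set.mem_pi, Set.mem_univ, true_imp_iff, Pi.add_apply, Set.mem_Ioc]
    refine forall_congr' fun i => ?_
    simp only [Pi.zero_apply, Int.cast_zero]
    constructor <;> rintro ⟨a, b⟩ <;> constructor <;> linarith
  rw [this]; rfl

lemma coeff (A : Matrix ι ι ℝ) (hA : A.det ≠ 0) (F : C(UnitAddTorus ι, ℂ))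
    (hF : ∀ x : ι → ℝ, F (fun i => (x i : AddCircle (1 : ℝ))) = per A x) (n : ι → ℤ) :
    UnitAddTorus.mFourierCoeff F n = (|A.det|⁻¹ * gA (A⁻¹)ᵀ (fun i => n i) : ℝ) := by
  rw [UnitAddTorus.mFourierCoeff_eq_integral F n 0, ← gA_fourier A hA]
  set g : (ι → ℝ) → ℂ := fun x => Complex.exp (-2 * Real.pi * Complex.I * ∑ i, n i * x i) * (gA A x : ℂ) with hg
  have hnorm : ∀ x, ‖g x‖ = gA A x := by
    intro x
    rw [hg]; simp only [norm_mul]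
    have : (-2 * Real.pi * Complex.I * ((∑ i, (n i : ℝ) * x i : ℝ) : ℂ) : ℂ) = ((-2 * Real.pi * ∑ i, (n i : ℝ) * x i : ℝ) : ℂ) * Complex.I := by
      push_cast; ring
    rw [this, Complex.norm_exp_ofReal_mul_I, one_mul, Complex.norm_real, Real.norm_of_nonneg (gA_pos _ _).le]
  have hgc : Continuous g := by
    have := gA_cont A
    fun_prop
  have hgi : Integrable g := by
    refine (integrable_norm_iff hgc.aestronglyMeasurable).1 ?_
    simp only [hnorm]; exact gA_integrable A hA
  have hgint : IntegrableOn g (⋃ m : ι → ℤ, box m) := by rw [box_union]; exact hgi.integrableOn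
  have s1 := hasSum_integral_iUnion (f := g) (μ := volume) (s := (box : (ι → ℤ) → _)) box_meas box_disj hgint
  rw [box_union, Measure.restrict_univ] at s1
  have hgint' : IntegrableOn (fun x => ‖g x‖) (⋃ m : ι → ℤ, box m) := by rw [box_union]; exact hgi.norm.integrableOn
  have s2 := (hasSum_integral_iUnion (f := fun x => ‖g x‖) (μ := volume) (s := (box : (ι → ℤ) → _)) box_meas box_disj hgint').summable
  have e1 := fun m : ι → ℤ => box_shift g m
  have e2 := fun m : ι → ℤ => box_shift (fun x => ‖g x‖) m
  rw [funext e1] at s1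
  rw [funext e2] at s2
  have s3 := hasSum_integral_of_summable_integral_norm (μ := volume.restrict (box (0 : ι → ℤ)))
    (F := fun (m : ι → ℤ) (x : ι → ℝ) => g (fun i => x i + m i)) (fun m => ?_) s2
  · rw [s1.unique s3]
    have hb : {x : ι → ℝ | ∀ i, x i ∈ Set.Ioc ((0 : ι → ℝ) i) ((0 : ι → ℝ) i + 1)} = box 0 := by
      ext x; simp [box]
    rw [hb]
    refine integral_congr_ae (Filter.Eventually.of_forall fun x => ?_)
    simp only [hF, smul_eq_mul]
    have h4 : ∀ m : ι → ℤ, g (fun i => x i + m i) = Complex.exp (-2 * Real.pi * Complex.I * ∑ i, n i * x i) * (gA A (fun i => x i + m i) : ℂ) := by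
      intro m
      simp only [hg]
      congr 1
      rw [Complex.exp_eq_exp_iff_exists_int]
      refine ⟨- ∑ i, n i * m i, ?_⟩
      push_cast
      simp only [mul_add, sum_add_distrib]
      ring
    simp only [h4]
    rw [tsum_mul_left, per, Complex.ofReal_tsum]
    congr 1
    simp only [UnitAddTorus.mFourier, ContinuousMap.coe_mk, fourier_coe_apply, ← Complex.exp_sum]
    congr 1
    rw [Complex.ofReal_sum, mul_sum]
    refine sum_congr rfl fun i _ => ?_
    simp; ring
  · have : Integrable (fun x : ι → ℝ => g (fun i => x i + m i)) := hgi.comp_add_right (fun i => (m i : ℝ))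
    exact this.integrableOn

theorem poisson (A : Matrix ι ι ℝ) (hA : A.det ≠ 0) :
    ∑' m : ι → ℤ, gA A (fun i => m i) = |A.det|⁻¹ * ∑' m : ι → ℤ, gA (A⁻¹)ᵀ (fun i => m i) := by
  obtain ⟨F, hF⟩ := exists_lift A hA
  have hA' : ((A⁻¹)ᵀ).det ≠ 0 := by
    rw [det_transpose, det_nonsing_inv, Ring.inverse_eq_inv']; exact inv_ne_zero hA
  have hs : Summable fun n : ι → ℤ => (|A.det|⁻¹ * gA (A⁻¹)ᵀ (fun i => n i) : ℝ) := by
    have := gA_summable _ hA' 0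
    simp only [Pi.zero_apply, zero_add] at this
    exact this.mul_left _
  have hc : UnitAddTorus.mFourierCoeff F = fun n => ((|A.det|⁻¹ * gA (A⁻¹)ᵀ (fun i => n i) : ℝ) : ℂ) :=
    funext fun n => coeff A hA F hF n
  have h := UnitAddTorus.hasSum_mFourier_series_apply_of_summable (f := F) (by rw [hc]; exact_mod_cast hs) 0
  have h0 : F 0 = per A 0 := by rw [← hF 0]; rfl
  rw [h0] at h
  have h1 : ∀ n : ι → ℤ, UnitAddTorus.mFourierCoeff F n • UnitAddTorus.mFourier n 0 = ((|A.det|⁻¹ * gA (A⁻¹)ᵀ (fun i => n i) : ℝ) : ℂ) := by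
    intro n
    rw [hc]; simp [UnitAddTorus.mFourier]
  simp only [h1] at h
  have h2 := Complex.hasSum_ofReal.1 h
  rw [← tsum_mul_left, h2.tsum_eq, per]
  simp

lemma gA_summable0 (A : Matrix ι ι ℝ) (hA : A.det ≠ 0) : Summable fun m : ι → ℤ => gA A (fun i => m i) := by
  simpa using gA_summable A hA 0

end poisson
end PS

namespace DZ
open NumberField NumberField.Units NumberField.InfinitePlace MeasureTheory nonZeroDivisors
open NumberField.Units.dirichletUnitTheorem

variable (K : Type) [Field K] [NumberField K]

lemma countable_K : Countable K := by
  have := Algebra.IsAlgebraic.cardinalMk_le_max ℚ K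
  simpa [← Cardinal.mk_le_aleph0_iff] using this

lemma countable_units : Countable (𝓞 K)ˣ := by
  have := countable_K K
  have h : Function.Injective (fun u : (𝓞 K)ˣ => ((u : 𝓞 K) : K)) := by
    intro a b h
    exact Units.ext (NumberField.RingOfIntegers.ext h)
  exact h.countable

abbrev FI := (FractionalIdeal (𝓞 K)⁰ K)ˣ
abbrev Cl := ClassGroup (𝓞 K)
abbrev NZ := {I : Ideal (𝓞 K) // I ≠ ⊥}

variable {K}
abbrev Q (J : Cl K → FI K) := {q : Cl K × K // q.2 ≠ 0 ∧ q.2 ∈ (J q.1 : FractionalIdeal (𝓞 K)⁰ K)}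

def Rep (J : Cl K → FI K) : Prop := Function.Bijective fun c => ClassGroup.mk K (J c)

lemma nz_unit (I : NZ K) : ∃ x : FI K, (x : FractionalIdeal (𝓞 K)⁰ K) = I.1 :=
  ⟨Units.mk0 (I.1 : FractionalIdeal (𝓞 K)⁰ K) (FractionalIdeal.coeIdeal_ne_zero.2 I.2), rfl⟩

lemma span_eq_iff {a b : K} (ha : a ≠ 0) (h : FractionalIdeal.spanSingleton (𝓞 K)⁰ a =
    FractionalIdeal.spanSingleton (𝓞 K)⁰ b) : ∃ u : (𝓞 K)ˣ, ((u : 𝓞 K) : K) * b = a := by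
  have h1 : a ∈ FractionalIdeal.spanSingleton (𝓞 K)⁰ b := by
    rw [← h]; exact FractionalIdeal.mem_spanSingleton_self _ _
  have h2 : b ∈ FractionalIdeal.spanSingleton (𝓞 K)⁰ a := by
    rw [h]; exact FractionalIdeal.mem_spanSingleton_self _ _
  rw [FractionalIdeal.mem_spanSingleton] at h1 h2
  obtain ⟨x, hx⟩ := h1
  obtain ⟨y, hy⟩ := h2
  rw [Algebra.smul_def] at hx hy
  have hxy : x * y = 1 := by
    apply NumberField.RingOfIntegers.ext
    have : (x * y : K) * a = 1 * a := by
      conv_rhs => rw [one_mul, ← hx, ← hy]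
      ring
    have := mul_right_cancel₀ ha this
    simpa using this
  exact ⟨⟨x, y, hxy, by rw [mul_comm, hxy]⟩, hx⟩

lemma span_unit_mul (u : (𝓞 K)ˣ) (a : K) : FractionalIdeal.spanSingleton (𝓞 K)⁰ (((u : 𝓞 K) : K) * a)
    = FractionalIdeal.spanSingleton (𝓞 K)⁰ a := by
  apply le_antisymm
  · rw [FractionalIdeal.spanSingleton_le_iff_mem, FractionalIdeal.mem_spanSingleton]
    exact ⟨u, by rw [Algebra.smul_def]⟩
  · rw [FractionalIdeal.spanSingleton_le_iff_mem, FractionalIdeal.mem_spanSingleton]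
    refine ⟨((u⁻¹ : (𝓞 K)ˣ) : 𝓞 K), ?_⟩
    rw [Algebra.smul_def, ← mul_assoc, ← map_mul]; simp

lemma exists_rep (J : Cl K → FI K) (hJ : Rep J) : ∃ (c : NZ K → Cl K) (β : NZ K → K)
    (e : NZ K × (𝓞 K)ˣ ≃ Q J), (∀ I, β I ≠ 0 ∧ FractionalIdeal.spanSingleton (𝓞 K)⁰ (β I) =
      (I.1 : FractionalIdeal (𝓞 K)⁰ K) * (J (c I) : FractionalIdeal (𝓞 K)⁰ K)) ∧
      ∀ I u, (e (I, u)).1 = (c I, ((u : 𝓞 K) : K) * β I) := by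
  have h1 : ∀ I : NZ K, ∃ (c : Cl K) (β : K), β ≠ 0 ∧ FractionalIdeal.spanSingleton (𝓞 K)⁰ β =
      (I.1 : FractionalIdeal (𝓞 K)⁰ K) * (J c : FractionalIdeal (𝓞 K)⁰ K) := by
    intro I
    obtain ⟨x, hx⟩ := nz_unit I
    obtain ⟨c, hc⟩ := hJ.2 (ClassGroup.mk K x)⁻¹
    have h : ClassGroup.mk K (x * J c) = 1 := by
      rw [map_mul]; simp only at hc; rw [hc]; simp
    rw [ClassGroup.mk_eq_one_iff, FractionalIdeal.isPrincipal_iff] at h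
    obtain ⟨β, hβ⟩ := h
    rw [Units.val_mul, hx] at hβ
    refine ⟨c, β, ?_, hβ.symm⟩
    rintro rfl
    rw [FractionalIdeal.spanSingleton_zero, ← hx, ← Units.val_mul] at hβ
    exact Units.ne_zero _ hβ
  choose c β h0 hb using h1
  have hmem : ∀ I (u : (𝓞 K)ˣ), ((u : 𝓞 K) : K) * β I ∈ (J (c I) : FractionalIdeal (𝓞 K)⁰ K) := by
    intro I u
    rw [← FractionalIdeal.spanSingleton_le_iff_mem, span_unit_mul, hb]
    calc (I.1 : FractionalIdeal (𝓞 K)⁰ K) * (J (c I) : FractionalIdeal (𝓞 K)⁰ K)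
        ≤ 1 * (J (c I) : FractionalIdeal (𝓞 K)⁰ K) := by
          gcongr; exact FractionalIdeal.coeIdeal_le_one
      _ = _ := one_mul _
  let f : NZ K × (𝓞 K)ˣ → Q J := fun q => ⟨(c q.1, ((q.2 : 𝓞 K) : K) * β q.1),
    mul_ne_zero (by simp) (h0 _), hmem _ _⟩
  have hf : Function.Bijective f := by
    constructor
    · rintro ⟨I, u⟩ ⟨I', u'⟩ h
      simp only [f, Subtype.mk.injEq, Prod.mk.injEq] at h
      obtain ⟨hc, hu⟩ := h
      have h2 := congrArg (FractionalIdeal.spanSingleton (𝓞 K)⁰) hu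
      rw [span_unit_mul, span_unit_mul, hb, hb, hc] at h2
      have h3 := mul_right_cancel₀ (Units.ne_zero _) h2
      have h4 : I = I' := Subtype.ext (FractionalIdeal.coeIdeal_injective h3)
      subst h4
      have := mul_right_cancel₀ (h0 I) hu
      congr 1
      exact Units.ext (NumberField.RingOfIntegers.ext this)
    · rintro ⟨⟨d, a⟩, ha, had⟩
      simp only at ha had
      have hle : FractionalIdeal.spanSingleton (𝓞 K)⁰ a * ((J d)⁻¹ : FI K) ≤ 1 := by
        calc _ ≤ (J d : FractionalIdeal (𝓞 K)⁰ K) * ((J d)⁻¹ : FI K) := by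
              gcongr; exact FractionalIdeal.spanSingleton_le_iff_mem.2 had
          _ = 1 := by simp
      obtain ⟨I, hI⟩ := FractionalIdeal.le_one_iff_exists_coeIdeal.1 hle
      have hIJ : (I : FractionalIdeal (𝓞 K)⁰ K) * (J d : FractionalIdeal (𝓞 K)⁰ K) =
          FractionalIdeal.spanSingleton (𝓞 K)⁰ a := by rw [hI, mul_assoc]; simp
      have hI0 : I ≠ ⊥ := by
        rintro rfl
        rw [FractionalIdeal.coeIdeal_bot, zero_mul] at hIJ
        exact ha (FractionalIdeal.spanSingleton_eq_zero_iff.1 hIJ.symm)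
      have hcd : c ⟨I, hI0⟩ = d := by
        apply hJ.1
        obtain ⟨x, hx⟩ := nz_unit ⟨I, hI0⟩
        have e1 : ∀ (e : Cl K) (b : K), FractionalIdeal.spanSingleton (𝓞 K)⁰ b =
          (I : FractionalIdeal (𝓞 K)⁰ K) * (J e : FractionalIdeal (𝓞 K)⁰ K) →
            ClassGroup.mk K (J e) = (ClassGroup.mk K x)⁻¹ := by
          intro e b hb
          rw [eq_inv_iff_mul_eq_one, mul_comm, ← map_mul, ClassGroup.mk_eq_one_iff,
            FractionalIdeal.isPrincipal_iff]
          exact ⟨b, by rw [hb, Units.val_mul, hx]⟩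
        exact (e1 _ _ (hb ⟨I, hI0⟩)).trans (e1 _ _ hIJ.symm).symm
      have h5 := hb ⟨I, hI0⟩
      rw [hcd] at h5
      obtain ⟨u, hu⟩ := span_eq_iff ha (hIJ.symm.trans h5.symm)
      refine ⟨(⟨I, hI0⟩, u), ?_⟩
      simp only [f, Subtype.mk.injEq, Prod.mk.injEq]
      exact ⟨hcd, hu⟩
  exact ⟨c, β, Equiv.ofBijective f hf, fun I => ⟨h0 I, hb I⟩, fun I u => rfl⟩

end DZ

namespace DZ
open NumberField NumberField.Units NumberField.InfinitePlace MeasureTheory nonZeroDivisors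
open NumberField.Units.dirichletUnitTheorem

variable (K : Type) [Field K] [NumberField K]

def Log : Additive (𝓞 K)ˣ →+ (InfinitePlace K → ℝ) where
  toFun u := fun w => Real.log (w (((Additive.toMul u : (𝓞 K)ˣ) : 𝓞 K) : K))
  map_zero' := by ext w; simp
  map_add' a b := by
    ext w
    simp only [toMul_add, Units.val_mul, map_mul, Pi.add_apply]
    rw [Real.log_mul (by simp) (by simp)]

def U : AddSubgroup (InfinitePlace K → ℝ) := (Log K).range
def WW : ENNReal := (Nat.card (Log K).ker : ENNReal)

instance : Countable (U K) := by
  have := countable_units K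
  have : Countable (Additive (𝓞 K)ˣ) := this
  exact (AddMonoidHom.rangeRestrict_surjective (Log K)).countable

variable [IsTotallyReal K]

lemma log_emb (u : (𝓞 K)ˣ) (w : {w : InfinitePlace K // w ≠ w₀}) :
    logEmbedding K (Additive.ofMul u) w = Log K (Additive.ofMul u) w := by
  rw [logEmbedding_component]; simp [Log, IsTotallyReal.mult_eq]

lemma sum_Log (u : Additive (𝓞 K)ˣ) : ∑ w, Log K u w = 0 := by
  classical
  have h := sum_logEmbedding_component (K := K) (Additive.toMul u)
  rw [Fintype.sum_eq_add_sum_subtype_ne _ w₀]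
  have h2 : ∑ w : {w : InfinitePlace K // w ≠ w₀}, Log K u w =
      ∑ w, logEmbedding K (Additive.ofMul (Additive.toMul u)) w := by
    refine Finset.sum_congr rfl fun w _ => ?_
    rw [log_emb]; rfl
  rw [h2, h]
  simp [Log, IsTotallyReal.mult_eq]

lemma sum_U (ℓ : U K) : ∑ w, (ℓ : InfinitePlace K → ℝ) w = 0 := by
  obtain ⟨_, u, rfl⟩ := ℓ
  exact sum_Log K u

lemma Log_eq_zero (u : (𝓞 K)ˣ) : Log K (Additive.ofMul u) = 0 ↔ u ∈ torsion K := by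
  classical
  rw [← logEmbedding_eq_zero_iff]
  constructor
  · intro h; ext w; rw [log_emb, h]; rfl
  · intro h
    have h1 : ∀ w : {w : InfinitePlace K // w ≠ w₀}, Log K (Additive.ofMul u) w = 0 := by
      intro w; rw [← log_emb, h]; rfl
    have h2 := sum_Log K (Additive.ofMul u)
    rw [Fintype.sum_eq_add_sum_subtype_ne _ w₀, Finset.sum_eq_zero (fun w _ => h1 w), add_zero] at h2
    ext w
    by_cases hw : w = w₀
    · rw [hw, h2]; rfl
    · exact h1 ⟨w, hw⟩

instance finker : Finite (Log K).ker := by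
  refine Finite.of_injective (β := torsion K)
    (fun x => ⟨Additive.toMul x.1, (Log_eq_zero K _).1 x.2⟩) ?_
  intro a b h
  simpa using h

lemma WW_ne : WW K ≠ 0 := Nat.cast_ne_zero.2 Nat.card_pos.ne'
lemma WW_top : WW K ≠ ⊤ := by
  unfold WW; simp

lemma tsum_units (f : (InfinitePlace K → ℝ) → ENNReal) :
    ∑' u : (𝓞 K)ˣ, f (Log K (Additive.ofMul u)) = WW K * ∑' ℓ : U K, f ℓ := by
  rw [← Equiv.tsum_eq (Additive.toMul (α := (𝓞 K)ˣ)),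
    ← Equiv.tsum_eq (Equiv.sigmaFiberEquiv (Log K).rangeRestrict), ENNReal.tsum_sigma',
    ← ENNReal.tsum_mul_left]
  refine tsum_congr fun ℓ => ?_
  have h1 : ∀ b : {x // (Log K).rangeRestrict x = ℓ},
      f (Log K (Additive.ofMul (Additive.toMul ((Equiv.sigmaFiberEquiv (Log K).rangeRestrict) ⟨ℓ, b⟩)))) = f ℓ := by
    rintro ⟨b, rfl⟩
    rfl
  rw [tsum_congr h1, ENNReal.tsum_const]
  congr 1
  obtain ⟨_, a, rfl⟩ := ℓ
  have e : {x // (Log K).rangeRestrict x = ⟨Log K a, a, rfl⟩} ≃ (Log K).ker := by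
    refine Equiv.trans (Equiv.subtypeEquivRight fun x => ?_) ((Log K).fiberEquivKer a)
    simp [Subtype.ext_iff]
  rw [ENat.card_congr e, WW, ENat.card_eq_coe_natCard]
  rfl


lemma exists_fd : ∃ F : Set (InfinitePlace K → ℝ), MeasurableSet F ∧
    IsAddFundamentalDomain (U K) F volume ∧
    (∀ x (τ : ℝ), (fun w => x w + τ) ∈ F ↔ x ∈ F) ∧
    ∀ R, Bornology.IsBounded (F ∩ {x | |∑ w, x w| ≤ R}) := by
  classical
  let n : ℝ := Fintype.card (InfinitePlace K)
  have hn : n ≠ 0 := by simp [n]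
  let pr : (InfinitePlace K → ℝ) → logSpace K := fun x w => x w - (∑ v, x v) / n
  let b := (basisUnitLattice K).ofZLatticeBasis ℝ (unitLattice K)
  have hpr : ∀ x y, pr (x + y) = pr x + pr y := by
    intro x y; ext w; simp [pr, Finset.sum_add_distrib]; ring
  have hprL : ∀ u, pr (Log K u) = logEmbedding K u := by
    intro u; ext w
    simp only [pr, sum_Log]
    rw [zero_div, sub_zero]
    exact (log_emb K (Additive.toMul u) w).symm
  have hm : Measurable pr := by
    refine measurable_pi_lambda _ fun w => ?_
    fun_prop
  have hmeas : MeasurableSet (pr ⁻¹' ZSpan.fundamentalDomain b) :=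
    hm (ZSpan.fundamentalDomain_measurableSet b)
  refine ⟨pr ⁻¹' ZSpan.fundamentalDomain b, hmeas, IsAddFundamentalDomain.mk' hmeas.nullMeasurableSet
    ?_, ?_, ?_⟩
  · intro x
    obtain ⟨v, hv, huniq⟩ := ZSpan.exist_unique_vadd_mem_fundamentalDomain b (pr x)
    have hvl : (v : logSpace K) ∈ unitLattice K := by
      rw [← (basisUnitLattice K).ofZLatticeBasis_span ℝ (unitLattice K)]; exact v.2
    obtain ⟨u, -, hu⟩ := hvl
    have hu' : logEmbedding K u = v := hu
    refine ⟨⟨Log K u, u, rfl⟩, ?_, ?_⟩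
    · simp only [Set.mem_preimage]
      have : pr ((⟨Log K u, u, rfl⟩ : U K) +ᵥ x) = v +ᵥ pr x := by
        change pr (Log K u + x) = (v : logSpace K) + pr x
        rw [hpr, hprL, hu']
      rw [this]; exact hv
    · rintro ⟨_, u1, rfl⟩ h1
      simp only [Set.mem_preimage] at h1
      have hmem : logEmbedding K u1 ∈ Submodule.span ℤ (Set.range b) := by
        rw [(basisUnitLattice K).ofZLatticeBasis_span ℝ (unitLattice K)]
        exact ⟨u1, trivial, rfl⟩
      have := huniq ⟨logEmbedding K u1, hmem⟩ (by
        change (logEmbedding K u1 : logSpace K) + pr x ∈ _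
        rw [← hprL, ← hpr]; exact h1)
      have h2 : logEmbedding K u1 = logEmbedding K u := by
        rw [hu', ← this]
      have h3 : logEmbedding K (u1 - u) = 0 := by rw [map_sub, h2, sub_self]
      have h4 := (Log_eq_zero K (Additive.toMul (u1 - u))).2 (logEmbedding_eq_zero_iff.1 h3)
      have h5 : Log K (u1 - u) = 0 := h4
      rw [map_sub, sub_eq_zero] at h5
      exact Subtype.ext h5
  · intro x τ
    have : pr (fun w => x w + τ) = pr x := by
      ext w
      simp only [pr, Finset.sum_add_distrib, Finset.sum_const, Finset.card_univ, nsmul_eq_mul]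
      change _ - (_ + n * τ) / n = _
      field_simp; ring
    simp only [Set.mem_preimage, this]
  · intro R
    obtain ⟨C, hC⟩ := (ZSpan.fundamentalDomain_isBounded b).exists_norm_le
    have hn0 : 0 < n := lt_of_le_of_ne (by positivity) hn.symm
    rw [isBounded_iff_forall_norm_le]
    have key : ∀ x ∈ (pr ⁻¹' ZSpan.fundamentalDomain b) ∩ {x | |∑ w, x w| ≤ R},
        ∀ w : {w : InfinitePlace K // w ≠ w₀}, |x w| ≤ C + R / n := by
      rintro x ⟨hx1, hx2⟩ w
      have h1 : |pr x w| ≤ C := (norm_le_pi_norm (pr x) w).trans (hC _ hx1)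
      have h2 : x w = pr x w + (∑ v, x v) / n := by simp [pr]
      rw [h2]
      refine (abs_add_le _ _).trans (add_le_add h1 ?_)
      rw [abs_div, abs_of_pos hn0]
      gcongr
      exact hx2
    have hall : ∀ x ∈ (pr ⁻¹' ZSpan.fundamentalDomain b) ∩ {x | |∑ w, x w| ≤ R},
        |x w₀| ≤ R + ∑ w : {w : InfinitePlace K // w ≠ w₀}, (C + R / n) := by
      intro x hx
      have h1 := Fintype.sum_eq_add_sum_subtype_ne x w₀
      have h2 : x w₀ = ∑ w, x w - ∑ w : {w : InfinitePlace K // w ≠ w₀}, x w := by rw [h1]; ring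
      rw [h2]
      refine (abs_sub _ _).trans (add_le_add hx.2 ?_)
      exact (Finset.abs_sum_le_sum_abs _ _).trans (Finset.sum_le_sum fun w _ => key x hx w)
    refine ⟨max 0 (max (C + R / n) (R + ∑ w : {w : InfinitePlace K // w ≠ w₀}, (C + R / n))), ?_⟩
    intro x hx
    rw [pi_norm_le_iff_of_nonneg (le_max_left _ _)]
    intro w
    by_cases hw : w = w₀
    · rw [hw]; exact (hall x hx).trans ((le_max_right _ _).trans (le_max_right _ _))
    · exact (key x hx ⟨w, hw⟩).trans ((le_max_left _ _).trans (le_max_right _ _))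

end DZ

namespace DZ
open NumberField NumberField.Units NumberField.InfinitePlace MeasureTheory nonZeroDivisors
open NumberField.Units.dirichletUnitTheorem

variable {K : Type} [Field K] [NumberField K]

def g (x : InfinitePlace K → ℝ) : ENNReal :=
  ENNReal.ofReal (Real.exp (-Real.pi * ∑ w, Real.exp (2 * x w)))

lemma g_meas : Measurable (g (K := K)) := by
  unfold g; fun_prop

variable (K) in
def sD : ℝ := Real.sqrt |(discr K : ℝ)|
lemma sD_pos : 0 < sD K := Real.sqrt_pos.2 (abs_pos.2 (by exact_mod_cast discr_ne_zero K))
variable (K) in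
def dg : ℝ := Fintype.card (InfinitePlace K)
lemma dg_pos : 0 < dg K := by unfold dg; exact_mod_cast Fintype.card_pos

def nm (J : FI K) : ℝ := ((FractionalIdeal.absNorm (J : FractionalIdeal (𝓞 K)⁰ K) : ℚ) : ℝ)
lemma nm_pos (J : FI K) : 0 < nm J := by
  have h1 : FractionalIdeal.absNorm (J : FractionalIdeal (𝓞 K)⁰ K) ≠ 0 :=
    (map_ne_zero _).2 (Units.ne_zero J)
  have h2 := FractionalIdeal.absNorm_nonneg (J : FractionalIdeal (𝓞 K)⁰ K)
  unfold nm
  exact_mod_cast lt_of_le_of_ne h2 h1.symm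

def rr (J : Cl K → FI K) (q : Cl K × K) : InfinitePlace K → ℝ := fun w =>
  Real.log (w q.2) - Real.log (nm (J q.1) * sD K) / dg K

def TT (J : Cl K → FI K) (x : InfinitePlace K → ℝ) : ENNReal := ∑' q : Q J, g (x + rr J q.1)

lemma countable_Q (J : Cl K → FI K) : Countable (Q J) := by
  have := countable_K K
  infer_instance

lemma TT_meas (J : Cl K → FI K) : Measurable (TT J) := by
  have := countable_Q J
  unfold TT
  refine Measurable.tsum fun q => g_meas.comp (by fun_prop)

def ex (s : ℝ) (x : InfinitePlace K → ℝ) : ENNReal := ENNReal.ofReal (Real.exp (s * ∑ w, x w))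
lemma ex_meas (s : ℝ) : Measurable (ex (K := K) s) := by unfold ex; fun_prop
lemma ex_add (s : ℝ) (x y : InfinitePlace K → ℝ) : ex s (x + y) = ex s x * ex s y := by
  unfold ex
  rw [← ENNReal.ofReal_mul (by positivity), ← Real.exp_add]
  congr 2; simp [Finset.sum_add_distrib]; ring

def gam (K : Type) [Field K] [NumberField K] (s : ℝ) : ENNReal := ∫⁻ x : InfinitePlace K → ℝ, g x * ex s x

variable (K) in
def zet (s : ℝ) : ENNReal := ∑' I : NZ K, ENNReal.ofReal ((Ideal.absNorm I.1 : ℝ) ^ (-s))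

variable [IsTotallyReal K]

lemma rr_sum (J : Cl K → FI K) (c : Cl K) (β : K) (I : NZ K) (h0 : β ≠ 0)
    (h : FractionalIdeal.spanSingleton (𝓞 K)⁰ β =
      (I.1 : FractionalIdeal (𝓞 K)⁰ K) * (J c : FractionalIdeal (𝓞 K)⁰ K)) :
    ∑ w, rr J (c, β) w = Real.log ((Ideal.absNorm I.1 : ℝ) / sD K) := by
  have h1 := congrArg FractionalIdeal.absNorm h
  rw [FractionalIdeal.absNorm_span_singleton, map_mul, FractionalIdeal.coeIdeal_absNorm] at h1
  have h2 := prod_eq_abs_norm β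
  simp only [IsTotallyReal.mult_eq, pow_one, h1, Rat.cast_mul, Rat.cast_natCast] at h2
  have hI : (Ideal.absNorm I.1 : ℝ) ≠ 0 := by
    exact_mod_cast (fun h => I.2 (Ideal.absNorm_eq_zero_iff.1 h))
  have hn := (nm_pos (J c)).ne'
  have hs := (sD_pos (K := K)).ne'
  simp only [rr, Finset.sum_sub_distrib, Finset.sum_const, Finset.card_univ, nsmul_eq_mul]
  rw [← Real.log_prod (fun w _ => by simpa using h0), h2]
  change Real.log (_ * nm (J c)) - dg K * _ = _
  rw [mul_div_cancel₀ _ dg_pos.ne', Real.log_mul hI hn, Real.log_mul hn hs, Real.log_div hI hs]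
  ring

lemma rr_unit (J : Cl K → FI K) (c : Cl K) (β : K) (h0 : β ≠ 0) (u : (𝓞 K)ˣ) :
    rr J (c, ((u : 𝓞 K) : K) * β) = Log K (Additive.ofMul u) + rr J (c, β) := by
  ext w
  simp only [rr, map_mul, Pi.add_apply, Log, AddMonoidHom.coe_mk, ZeroHom.coe_mk, toMul_ofMul]
  rw [Real.log_mul (by simp) (by simpa using h0)]
  ring

theorem unfolding (J : Cl K → FI K) (hJ : Rep J) (F : Set (InfinitePlace K → ℝ))
    (hF : IsAddFundamentalDomain (U K) F volume) (s : ℝ) :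
    ∫⁻ x in F, TT J x * ex s x =
      WW K * (ENNReal.ofReal (sD K ^ s) * (zet K s * gam K s)) := by
  obtain ⟨c, β, e, h, he⟩ := exists_rep J hJ
  have := countable_Q J
  have h1 : ∫⁻ x in F, TT J x * ex s x = ∑' q : Q J, ∫⁻ x in F, g (x + rr J q.1) * ex s x := by
    rw [← lintegral_tsum]
    · refine lintegral_congr fun x => ?_
      rw [TT, ENNReal.tsum_mul_right]
    · intro q
      exact ((g_meas.comp (by fun_prop)).mul (ex_meas s)).aemeasurable
  rw [h1, ← e.tsum_eq, ENNReal.tsum_prod', zet, ← ENNReal.tsum_mul_right, ← ENNReal.tsum_mul_left,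
    ← ENNReal.tsum_mul_left]
  refine tsum_congr fun I => ?_
  have h2 : ∀ u, rr J (e (I, u)).1 = Log K (Additive.ofMul u) + rr J (c I, β I) := by
    intro u; rw [he, rr_unit _ _ _ (h I).1]
  simp_rw [h2]
  rw [tsum_units K (fun ℓ => ∫⁻ x in F, g (x + (ℓ + rr J (c I, β I))) * ex s x)]
  congr 1
  have h3 : ∑' ℓ : U K, ∫⁻ x in F, g (x + ((ℓ : InfinitePlace K → ℝ) + rr J (c I, β I))) * ex s x =
      ∫⁻ x, g (x + rr J (c I, β I)) * ex s x := by
    rw [hF.lintegral_eq_tsum'']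
    refine tsum_congr fun ℓ => lintegral_congr fun x => ?_
    change _ = g ((ℓ : InfinitePlace K → ℝ) + x + _) * ex s ((ℓ : InfinitePlace K → ℝ) + x)
    rw [ex_add]
    have : ex s (ℓ : InfinitePlace K → ℝ) = 1 := by simp [ex, sum_U]
    rw [this, one_mul]
    congr 2; abel
  rw [h3]
  have h4 : ∫⁻ x, g (x + rr J (c I, β I)) * ex s x =
      ex s (-rr J (c I, β I)) * gam K s := by
    rw [gam, ← lintegral_add_right_eq_self (fun x => g x * ex s x) (rr J (c I, β I)),
      ← lintegral_const_mul' _ _ (by simp [ex])]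
    refine lintegral_congr fun x => ?_
    rw [mul_left_comm, ← ex_add]
    congr 2; abel
  rw [h4, ← mul_assoc]
  congr 1
  rw [ex, ← ENNReal.ofReal_mul (by have := sD_pos (K := K); positivity)]
  congr 1
  have hI : 0 < (Ideal.absNorm I.1 : ℝ) := by
    exact_mod_cast Nat.pos_of_ne_zero (fun h => I.2 (Ideal.absNorm_eq_zero_iff.1 h))
  have hs := sD_pos (K := K)
  simp only [Pi.neg_apply, Finset.sum_neg_distrib]
  rw [rr_sum J _ _ I (h I).1 (h I).2, Real.rpow_def_of_pos hs, Real.rpow_def_of_pos hI, ← Real.exp_add,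
    Real.log_div hI.ne' hs.ne']
  congr 1; ring

end DZ

namespace DZ
open NumberField NumberField.Units NumberField.InfinitePlace MeasureTheory nonZeroDivisors
open NumberField.Units.dirichletUnitTheorem

variable {K : Type} [Field K] [NumberField K] [IsTotallyReal K]

def sg (w : InfinitePlace K) : K →+* ℝ := embedding_of_isReal (IsTotallyReal.isReal w)

lemma abs_sg (w : InfinitePlace K) (x : K) : |sg w x| = w x :=
  norm_embedding_of_isReal (IsTotallyReal.isReal w) x

lemma trace_sg (x : K) : ((Algebra.trace ℚ K x : ℚ) : ℝ) = ∑ w, sg w x := by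
  have h := trace_eq_sum_embeddings ℂ (K := ℚ) (L := K) (x := x)
  have h2 : ((Algebra.trace ℚ K x : ℚ) : ℂ) = ∑ w : InfinitePlace K, ((sg w x : ℝ) : ℂ) := by
    rw [show ((Algebra.trace ℚ K x : ℚ) : ℂ) = algebraMap ℚ ℂ (Algebra.trace ℚ K x) from rfl, h]
    symm
    refine Fintype.sum_bijective (fun w : InfinitePlace K => w.embedding.toRatAlgHom) ?_ _ _ ?_
    · constructor
      · intro a b hab
        have := congrArg (fun f : K →ₐ[ℚ] ℂ => InfinitePlace.mk (f : K →+* ℂ)) hab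
        simpa using this
      · intro f
        refine ⟨InfinitePlace.mk (f : K →+* ℂ), ?_⟩
        have hr : ComplexEmbedding.IsReal (f : K →+* ℂ) := by
          rw [← isReal_mk_iff]; exact IsTotallyReal.isReal _
        ext y
        simp [embedding_mk_eq_of_isReal hr]
    · intro w
      exact embedding_of_isReal_apply (IsTotallyReal.isReal w) x
  exact_mod_cast h2

lemma card_places : Fintype.card (InfinitePlace K) = Module.finrank ℚ K := by
  rw [IsTotallyReal.finrank, card_eq_nrRealPlaces_add_nrComplexPlaces, IsTotallyReal.nrComplexPlaces_eq_zero, add_zero]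

open Classical in
lemma exists_basis (I : FI K) : ∃ b : Module.Basis (InfinitePlace K) ℚ K,
    (∀ x, x ∈ Submodule.span ℤ (Set.range b) ↔ x ∈ (I : FractionalIdeal (𝓞 K)⁰ K)) ∧
    |(Matrix.of fun w j => sg w (b j)).det| = nm I * sD K := by
  let e : (Module.Free.ChooseBasisIndex ℤ (𝓞 K)) ≃ (Module.Free.ChooseBasisIndex ℤ I) := by
    refine Fintype.equivOfCardEq ?_
    rw [← Module.finrank_eq_card_chooseBasisIndex, ← Module.finrank_eq_card_chooseBasisIndex,
      fractionalIdeal_rank]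
  have hdet := det_basisOfFractionalIdeal_eq_absNorm K I e
  set b' := (basisOfFractionalIdeal K I).reindex e.symm with hb'
  let e2 : (Module.Free.ChooseBasisIndex ℤ (𝓞 K)) ≃ InfinitePlace K := by
    refine Fintype.equivOfCardEq ?_
    rw [card_places, Module.finrank_eq_card_basis b']
  have hdisc : Algebra.discr ℚ (b'.reindex e2) = (integralBasis K).det b' ^ 2 * discr K := by
    have h1 : Algebra.discr ℚ (b'.reindex e2) = Algebra.discr ℚ b' := by
      rw [Module.Basis.coe_reindex, Algebra.discr_reindex]
    rw [h1, coe_discr, Module.Basis.det_apply, ← Algebra.discr_of_matrix_vecMul]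
    congr 1
    exact (Module.Basis.toMatrix_map_vecMul _ _).symm
  refine ⟨b'.reindex e2, fun x => ?_, ?_⟩
  · rw [Module.Basis.range_reindex, hb', Module.Basis.range_reindex, mem_span_basisOfFractionalIdeal]; rfl
  · set B : Matrix (InfinitePlace K) (InfinitePlace K) ℝ := Matrix.of fun w j => sg w ((b'.reindex e2) j)
    have hBB : B.transpose * B = (Algebra.traceMatrix ℚ (b'.reindex e2)).map (algebraMap ℚ ℝ) := by
      ext i j
      simp only [Matrix.mul_apply, Matrix.transpose_apply, Matrix.map_apply, Algebra.traceMatrix_apply,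
        Algebra.traceForm_apply]
      change _ = ((Algebra.trace ℚ K _ : ℚ) : ℝ)
      rw [trace_sg]
      simp [B]
    have h2 : B.det ^ 2 = ((Algebra.discr ℚ (b'.reindex e2) : ℚ) : ℝ) := by
      have := congrArg Matrix.det hBB
      rw [Matrix.det_mul, Matrix.det_transpose] at this
      rw [sq, this, Algebra.discr_def]
      exact (RingHom.map_det (algebraMap ℚ ℝ) _).symm
    rw [hdisc, ← sq_abs ((integralBasis K).det b'), hdet] at h2
    push_cast at h2
    have h3 : (discr K : ℝ) = |(discr K : ℝ)| := by
      rw [eq_comm, abs_eq_self]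
      by_contra hneg
      push Not at hneg
      have h4 : 0 < nm I ^ 2 := pow_pos (nm_pos I) 2
      change B.det ^ 2 = nm I ^ 2 * _ at h2
      nlinarith [sq_nonneg B.det]
    change B.det ^ 2 = nm I ^ 2 * _ at h2
    rw [← Real.sqrt_sq_eq_abs, h2, Real.sqrt_mul (by positivity), Real.sqrt_sq (nm_pos I).le, h3, sD]

def lam (I : FI K) : ℝ := Real.exp (-(Real.log (nm I * sD K) / dg K))
lemma lam_pow (I : FI K) : lam I ^ (Fintype.card (InfinitePlace K)) = (nm I * sD K)⁻¹ := by
  rw [lam, ← Real.exp_nat_mul]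
  change Real.exp (dg K * _) = _
  rw [mul_neg, mul_div_cancel₀ _ dg_pos.ne', Real.exp_neg, Real.exp_log (mul_pos (nm_pos I) sD_pos)]

def Th (I : FI K) (x : InfinitePlace K → ℝ) : ENNReal :=
  ∑' a : {a : K // a ∈ (I : FractionalIdeal (𝓞 K)⁰ K)},
    ENNReal.ofReal (Real.exp (-Real.pi * ∑ w, (Real.exp (x w) * (lam I * sg w a.1)) ^ 2))

def dualU (I : FI K) : FI K := Units.mk0 (FractionalIdeal.dual ℤ ℚ (I : FractionalIdeal (𝓞 K)⁰ K))
  (FractionalIdeal.dual_ne_zero ℤ ℚ (Units.ne_zero I))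

lemma dualU_eq (I : FI K) : dualU I = dualU 1 * I⁻¹ := by
  apply Units.ext
  rw [Units.val_mul]
  simp only [dualU, Units.val_mk0]
  rw [FractionalIdeal.dual_eq_mul_inv]; simp

lemma nm_dual (I : FI K) : (nm (dualU I) * sD K) * (nm I * sD K) = 1 := by
  have h1 : (dualU (1 : FI K) : FractionalIdeal (𝓞 K)⁰ K) = (differentIdeal ℤ (𝓞 K) : FractionalIdeal (𝓞 K)⁰ K)⁻¹ := by
    rw [coeIdeal_differentIdeal ℤ ℚ, inv_inv]; rfl
  have h2 : FractionalIdeal.absNorm (dualU (1 : FI K) : FractionalIdeal (𝓞 K)⁰ K) = ((discr K).natAbs : ℚ)⁻¹ := by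
    rw [h1, map_inv₀, FractionalIdeal.coeIdeal_absNorm, absNorm_differentIdeal K (𝓞 K)]
  have h3 : nm (dualU I) = |(discr K : ℝ)|⁻¹ * (nm I)⁻¹ := by
    rw [nm, dualU_eq, Units.val_mul, map_mul, h2, Units.val_inv_eq_inv_val, map_inv₀, nm]
    push_cast
    rw [Nat.cast_natAbs, Int.cast_abs]
  have h4 : sD K * sD K = |(discr K : ℝ)| := Real.mul_self_sqrt (abs_nonneg _)
  have h5 : |(discr K : ℝ)| ≠ 0 := abs_ne_zero.2 (by exact_mod_cast discr_ne_zero K)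
  have h6 := (nm_pos I).ne'
  rw [h3]
  calc _ = |(discr K : ℝ)|⁻¹ * (nm I)⁻¹ * nm I * (sD K * sD K) := by ring
    _ = 1 := by rw [h4]; field_simp

lemma lam_dual (I : FI K) : lam (dualU I) = (lam I)⁻¹ := by
  rw [lam, lam, ← Real.exp_neg, neg_neg]
  congr 1
  have := nm_dual I
  rw [eq_inv_of_mul_eq_one_left this, Real.log_inv]; ring

open Classical in
lemma Th_basis (I : FI K) (b : Module.Basis (InfinitePlace K) ℚ K)
    (hb : ∀ x, x ∈ Submodule.span ℤ (Set.range b) ↔ x ∈ (I : FractionalIdeal (𝓞 K)⁰ K))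
    (x : InfinitePlace K → ℝ) (A : Matrix (InfinitePlace K) (InfinitePlace K) ℝ)
    (hA : A = Matrix.of fun w j => Real.exp (x w) * (lam I * sg w (b j))) (hA0 : A.det ≠ 0) :
    Th I x = ENNReal.ofReal (∑' m : InfinitePlace K → ℤ, PS.gA A (fun i => m i)) := by
  rw [ENNReal.ofReal_tsum_of_nonneg (fun m => (PS.gA_pos _ _).le) (PS.gA_summable0 A hA0)]
  let f : (InfinitePlace K → ℤ) → {a : K // a ∈ (I : FractionalIdeal (𝓞 K)⁰ K)} :=
    fun m => ⟨∑ j, m j • b j, (hb _).1 (Submodule.sum_mem _ fun j _ =>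
      Submodule.smul_mem _ _ (Submodule.subset_span ⟨j, rfl⟩))⟩
  have hf : Function.Bijective f := by
    constructor
    · intro m m' h
      have h1 : ∑ j, m j • b j = ∑ j, m' j • b j := congrArg Subtype.val h
      have h2 : ∑ j, ((m j - m' j : ℤ) : ℚ) • b j = 0 := by
        simp only [Int.cast_smul_eq_zsmul, sub_smul, Finset.sum_sub_distrib, h1, sub_self]
      have h3 := Fintype.linearIndependent_iff.1 b.linearIndependent _ h2
      ext j
      have := h3 j
      exact sub_eq_zero.1 (by exact_mod_cast this)
    · rintro ⟨a, ha⟩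
      obtain ⟨m, hm⟩ := (Submodule.mem_span_range_iff_exists_fun ℤ).1 ((hb a).2 ha)
      exact ⟨m, Subtype.ext hm⟩
  rw [Th, ← (Equiv.ofBijective f hf).tsum_eq]
  refine tsum_congr fun m => ?_
  rw [PS.gA]
  congr 4
  ext w
  congr 1
  simp only [Equiv.ofBijective_apply, f, map_sum, map_mul, map_intCast, Matrix.mulVec, dotProduct, hA, Matrix.of_apply,
    Finset.mul_sum, zsmul_eq_mul]
  refine Finset.sum_congr rfl fun j _ => by ring

theorem Th_fe (I : FI K) (x : InfinitePlace K → ℝ) : Th I x = ex (-1) x * Th (dualU I) (-x) := by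
  classical
  obtain ⟨b, hb, hdet⟩ := exists_basis I
  have hl : lam I ≠ 0 := (Real.exp_pos _).ne'
  set B : Matrix (InfinitePlace K) (InfinitePlace K) ℝ := Matrix.of fun w j => sg w (b j) with hB
  set A : Matrix (InfinitePlace K) (InfinitePlace K) ℝ :=
    Matrix.of fun w j => Real.exp (x w) * (lam I * sg w (b j)) with hA
  have hAB : A = Matrix.diagonal (fun w => Real.exp (x w)) * (lam I • B) := by
    ext w j; simp [hA, hB, Matrix.diagonal_mul]
  have hAdet : |A.det| = Real.exp (∑ w, x w) := by
    rw [hAB, Matrix.det_mul, Matrix.det_diagonal, Matrix.det_smul, abs_mul, abs_mul, hdet, lam_pow, ← Real.exp_sum,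
      abs_of_pos (Real.exp_pos _), abs_of_pos (inv_pos.2 (mul_pos (nm_pos I) sD_pos)),
      inv_mul_cancel₀ (mul_pos (nm_pos I) sD_pos).ne', mul_one]
  have hA0 : A.det ≠ 0 := by
    intro h; rw [h, abs_zero] at hAdet; exact (Real.exp_pos _).ne hAdet
  set A' : Matrix (InfinitePlace K) (InfinitePlace K) ℝ :=
    Matrix.of fun w j => Real.exp ((-x) w) * (lam (dualU I) * sg w (b.traceDual j)) with hA'
  have hinv : (A⁻¹).transpose = A' := by
    rw [Matrix.transpose_nonsing_inv]
    apply Matrix.inv_eq_right_inv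
    ext i j
    simp only [Matrix.mul_apply, Matrix.transpose_apply, hA, hA', Matrix.of_apply, lam_dual, Pi.neg_apply]
    have h1 : ∀ w, Real.exp (x w) * (lam I * sg w (b i)) * (Real.exp (-x w) * ((lam I)⁻¹ * sg w (b.traceDual j)))
        = sg w (b i * b.traceDual j) := by
      intro w
      rw [Real.exp_neg, map_mul]
      have := (Real.exp_pos (x w)).ne'
      field_simp
    rw [Finset.sum_congr rfl (fun w _ => h1 w), ← trace_sg, Module.Basis.trace_mul_traceDual, Matrix.one_apply]
    split_ifs <;> simp
  have hb' : ∀ y, y ∈ Submodule.span ℤ (Set.range b.traceDual) ↔ y ∈ (dualU I : FractionalIdeal (𝓞 K)⁰ K) := by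
    intro y
    have h1 := Submodule.traceDual_span_of_basis (A := ℤ) (K := ℚ)
      ((I : FractionalIdeal (𝓞 K)⁰ K) : Submodule (𝓞 K) K) b (by
        ext z; rw [hb]; rfl)
    rw [← h1, Submodule.restrictScalars_mem]
    rw [← FractionalIdeal.coe_dual ℤ ℚ (Units.ne_zero I)]
    rfl
  have hA'0 : A'.det ≠ 0 := by
    rw [← hinv, Matrix.det_transpose, Matrix.det_nonsing_inv]
    simpa using hA0
  rw [Th_basis I b hb x A hA hA0, Th_basis (dualU I) b.traceDual hb' (-x) A' hA' hA'0, PS.poisson A hA0, hinv,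
    hAdet, ENNReal.ofReal_mul (by positivity), ex, ← Real.exp_neg]
  congr 3
  ring

end DZ

namespace DZ
open NumberField NumberField.Units NumberField.InfinitePlace MeasureTheory nonZeroDivisors
open NumberField.Units.dirichletUnitTheorem

variable {K : Type} [Field K] [NumberField K] [IsTotallyReal K]

variable (K) in
def hh : ENNReal := (Fintype.card (Cl K) : ENNReal)

lemma g_rr (J : Cl K → FI K) (x : InfinitePlace K → ℝ) (c : Cl K) (a : K) (ha : a ≠ 0) :
    g (x + rr J (c, a)) = ENNReal.ofReal (Real.exp (-Real.pi *
      ∑ w, (Real.exp (x w) * (lam (J c) * sg w a)) ^ 2)) := by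
  unfold g
  congr 4
  ext w
  have h0 : 0 < w a := (InfinitePlace.pos_iff).2 ha
  have h : (sg w a) ^ 2 = (w a) ^ 2 := by rw [← abs_sg, sq_abs]
  rw [mul_pow, mul_pow, h, ← mul_pow, ← mul_pow, two_mul, Real.exp_add, ← sq]
  congr 1
  simp only [Pi.add_apply, rr, lam]
  rw [Real.exp_add, sub_eq_add_neg, Real.exp_add, Real.exp_log h0]; ring

lemma TT_add (J : Cl K → FI K) (x : InfinitePlace K → ℝ) : TT J x + hh K = ∑ c, Th (J c) x := by
  classical
  let f : Cl K → K → ENNReal := fun c a => ENNReal.ofReal (Real.exp (-Real.pi *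
      ∑ w, (Real.exp (x w) * (lam (J c) * sg w a)) ^ 2))
  have h1 : TT J x = ∑ c, ∑' a : K, if a ≠ 0 ∧ a ∈ (J c : FractionalIdeal (𝓞 K)⁰ K) then f c a else 0 := by
    have e1 : TT J x = ∑' q : Q J, (fun q : Cl K × K => f q.1 q.2) q := by
      refine tsum_congr fun q => ?_
      obtain ⟨⟨c, a⟩, ha, hm⟩ := q
      exact g_rr J x c a ha
    rw [e1]
    have e2 := tsum_subtype {q : Cl K × K | q.2 ≠ 0 ∧ q.2 ∈ (J q.1 : FractionalIdeal (𝓞 K)⁰ K)}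
      (fun q : Cl K × K => f q.1 q.2)
    refine e2.trans ?_
    rw [ENNReal.tsum_prod', tsum_fintype]
    refine Finset.sum_congr rfl fun c _ => tsum_congr fun a => ?_
    simp [Set.indicator_apply]
  have h2 : ∀ c, Th (J c) x = (∑' a : K, if a ≠ 0 ∧ a ∈ (J c : FractionalIdeal (𝓞 K)⁰ K) then f c a else 0) + 1 := by
    intro c
    have e2 := tsum_subtype {a : K | a ∈ (J c : FractionalIdeal (𝓞 K)⁰ K)} (f c)
    refine e2.trans ?_
    rw [ENNReal.tsum_eq_add_tsum_ite (0 : K), add_comm]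
    congr 1
    · refine tsum_congr fun a => ?_
      by_cases ha : a = 0
      · simp [ha]
      · simp [ha, Set.indicator_apply]
    · simp [f, FractionalIdeal.zero_mem]
  rw [h1, Finset.sum_congr rfl (fun c _ => h2 c), Finset.sum_add_distrib]
  simp [hh]

def dualF (J : Cl K → FI K) : Cl K → FI K := fun c => dualU (J c)

lemma rep_dual (J : Cl K → FI K) (hJ : Rep J) : Rep (dualF J) := by
  have : (fun c => ClassGroup.mk K (dualF J c)) =
      (fun y => ClassGroup.mk K (dualU (1 : FI K)) * y) ∘ (fun y => y⁻¹) ∘ fun c => ClassGroup.mk K (J c) := by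
    ext c; simp only [dualF, Function.comp]; rw [dualU_eq, map_mul, map_inv]
  unfold Rep
  rw [this]
  exact (Group.mulLeft_bijective _).comp ((inv_involutive).bijective.comp hJ)

lemma TT_fe (J : Cl K → FI K) (x : InfinitePlace K → ℝ) :
    TT J x + hh K = ex (-1) x * (TT (dualF J) (-x) + hh K) := by
  rw [TT_add, TT_add, Finset.mul_sum]
  exact Finset.sum_congr rfl fun c _ => Th_fe _ _

lemma exists_rep_family : ∃ J : Cl K → FI K, Rep J := by
  have h : ∀ c : Cl K, ∃ x : FI K, ClassGroup.mk K x = c := fun c =>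
    ClassGroup.induction K (P := fun c => ∃ x : FI K, ClassGroup.mk K x = c) (fun I => ⟨I, rfl⟩) c
  choose J hJ using h
  refine ⟨J, ?_⟩
  have : (fun c => ClassGroup.mk K (J c)) = id := funext hJ
  unfold Rep; rw [this]; exact Function.bijective_id

end DZ

namespace DZ
open NumberField NumberField.Units NumberField.InfinitePlace MeasureTheory nonZeroDivisors
open NumberField.Units.dirichletUnitTheorem

variable {K : Type} [Field K] [NumberField K] [IsTotallyReal K]

def SS (x : InfinitePlace K → ℝ) : ℝ := ∑ w, x w
lemma SS_meas : Measurable (SS (K := K)) := by unfold SS; fun_prop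

lemma exists_kappa (F : Set (InfinitePlace K → ℝ)) (hF0 : MeasurableSet F)
    (hF : IsAddFundamentalDomain (U K) F volume)
    (hinv : ∀ x (τ : ℝ), (fun w => x w + τ) ∈ F ↔ x ∈ F)
    (hbd : ∀ R, Bornology.IsBounded (F ∩ {x | |∑ w, x w| ≤ R})) :
    ∃ κ : NNReal, 0 < κ ∧ ∀ φ : ℝ → ENNReal, Measurable φ →
      ∫⁻ x in F, φ (SS x) = κ * ∫⁻ t, φ t := by
  set ν : Measure ℝ := Measure.map SS ((volume : Measure (InfinitePlace K → ℝ)).restrict F) with hν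
  have hfin : IsFiniteMeasureOnCompacts ν := by
    constructor
    intro C hC
    obtain ⟨R, hR⟩ := hC.isBounded.exists_norm_le
    rw [hν, Measure.map_apply SS_meas hC.measurableSet, Measure.restrict_apply (SS_meas hC.measurableSet)]
    refine lt_of_le_of_lt (measure_mono ?_) (hbd R).measure_lt_top
    rintro x ⟨h1, h2⟩
    exact ⟨h2, hR _ h1⟩
  have hli : ν.IsAddLeftInvariant := by
    constructor
    intro a
    set τ := a / dg K
    have hmp := measurePreserving_add_right (volume : Measure (InfinitePlace K → ℝ)) (fun _ => τ)
    have hpre : (fun x : InfinitePlace K → ℝ => x + fun _ => τ) ⁻¹' F = F := by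
      ext x; exact hinv x τ
    have h1 := hmp.restrict_preimage hF0
    rw [hpre] at h1
    rw [hν, Measure.map_map (by fun_prop) SS_meas]
    have h2 : (fun x => a + x) ∘ SS = SS ∘ (fun x : InfinitePlace K → ℝ => x + fun _ => τ) := by
      ext x
      simp only [Function.comp, SS, Pi.add_apply, Finset.sum_add_distrib, Finset.sum_const, nsmul_eq_mul,
        Finset.card_univ]
      change _ = _ + dg K * (a / dg K)
      rw [mul_div_cancel₀ _ dg_pos.ne', add_comm]
    rw [h2, ← Measure.map_map SS_meas (by fun_prop), h1.map_eq]
  have h1 := Measure.isAddLeftInvariant_eq_smul ν volume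
  refine ⟨ν.addHaarScalarFactor volume, ?_, ?_⟩
  · rw [pos_iff_ne_zero]
    intro h0
    rw [h0, zero_smul] at h1
    have h2 : ν Set.univ = 0 := by rw [h1]; simp
    rw [hν, Measure.map_apply SS_meas MeasurableSet.univ] at h2
    simp at h2
    exact hF.measure_ne_zero (NeZero.ne _) (by simpa using h2)
  · intro φ hφ
    rw [← lintegral_map hφ SS_meas, ← hν]
    conv_lhs => rw [h1]
    rw [lintegral_smul_measure]; rfl

lemma lint_exp {s : ℝ} (hs : 0 < s) :
    ∫⁻ t : ℝ, (Set.Iic 0).indicator (fun t => ENNReal.ofReal (Real.exp (s * t))) t = ENNReal.ofReal (1 / s) := by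
  rw [lintegral_indicator measurableSet_Iic, ← ofReal_integral_eq_lintegral_ofReal
    (integrableOn_exp_mul_Iic hs 0) (Filter.Eventually.of_forall fun _ => (Real.exp_pos _).le),
    integral_exp_mul_Iic hs]
  simp

variable (K) in
def Lam (s : ℝ) : ENNReal := WW K * (ENNReal.ofReal (sD K ^ s) * (zet K s * gam K s))

def el (s t : ℝ) : ENNReal := ENNReal.ofReal (Real.exp (s * t))
lemma el_meas (s : ℝ) : Measurable (el s) := by unfold el; fun_prop

variable (K) in
theorem split : ∃ (μ₁ μ₂ : Measure ℝ) (κ : ℝ), 0 < κ ∧ μ₁ (Set.Iio 0) = 0 ∧ μ₂ (Set.Iio 0) = 0 ∧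
    (∀ s, (∫⁻ t, el s t ∂μ₁) ≤ Lam K s) ∧ (∀ s, (∫⁻ t, el s t ∂μ₂) ≤ Lam K s) ∧
    ∀ s : ℝ, 1 < s → Lam K s + ENNReal.ofReal (κ / s) =
      (∫⁻ t, el s t ∂μ₁) + (∫⁻ t, el (1 - s) t ∂μ₂) + ENNReal.ofReal (κ / (s - 1)) := by
  obtain ⟨J, hJ⟩ := exists_rep_family (K := K)
  obtain ⟨F, hF0, hF, hinv, hbd⟩ := exists_fd K
  obtain ⟨κ, hκ, hk⟩ := exists_kappa F hF0 hF hinv hbd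
  have hP : MeasurableSet {x : InfinitePlace K → ℝ | 0 < SS x} := measurableSet_lt measurable_const SS_meas
  have hN : MeasurableSet {x : InfinitePlace K → ℝ | SS x ≤ 0} := measurableSet_le SS_meas measurable_const
  have hT := TT_meas J
  have hT' : Measurable fun x => TT (dualF J) (-x) := (TT_meas (dualF J)).comp measurable_neg
  have hSn : Measurable fun x : InfinitePlace K → ℝ => - SS x := SS_meas.neg
  have hex : ∀ s (x : InfinitePlace K → ℝ), ex s x = el s (SS x) := fun s x => rfl
  set μ₁ := Measure.map SS ((volume.restrict (F ∩ {x | 0 < SS x})).withDensity (TT J)) with h1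
  set μ₂ := Measure.map (fun x => - SS x)
    ((volume.restrict (F ∩ {x | SS x ≤ 0})).withDensity (fun x => TT (dualF J) (-x))) with h2
  have hM : ∀ s, ∫⁻ t, el s t ∂μ₁ = ∫⁻ x in F ∩ {x | 0 < SS x}, TT J x * ex s x := by
    intro s
    rw [h1, lintegral_map (el_meas s) SS_meas]
    exact lintegral_withDensity_eq_lintegral_mul _ hT ((el_meas s).comp SS_meas)
  have hM' : ∀ s, ∫⁻ t, el s t ∂μ₂ = ∫⁻ x in F ∩ {x | SS x ≤ 0}, TT (dualF J) (-x) * ex (-s) x := by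
    intro s
    rw [h2, lintegral_map (el_meas s) hSn]
    refine (lintegral_withDensity_eq_lintegral_mul _ hT' ((el_meas s).comp hSn)).trans ?_
    refine lintegral_congr fun x => ?_
    simp [hex, el]
  have hint : ∀ s, 0 < s → ∫⁻ x in F ∩ {x | SS x ≤ 0}, hh K * ex s x =
      ENNReal.ofReal ((Fintype.card (Cl K) * κ : ℝ) / s) := by
    intro s hs
    have e0 : ∫⁻ x in F ∩ {x | SS x ≤ 0}, ex s x =
        ∫⁻ x in F, ((Set.Iic 0).indicator (fun t => ENNReal.ofReal (Real.exp (s * t))) (SS x)) := by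
      rw [Set.inter_comm, ← Measure.restrict_restrict hN, ← lintegral_indicator hN]
      rfl
    rw [lintegral_const_mul _ (ex_meas s), e0, hk _ ((by fun_prop : Measurable fun t : ℝ =>
      ENNReal.ofReal (Real.exp (s * t))).indicator measurableSet_Iic), lint_exp hs, hh, ← mul_assoc]
    rw [show (Fintype.card (Cl K) * κ : ℝ) / s = Fintype.card (Cl K) * κ * (1 / s) by ring, ENNReal.ofReal_mul (by positivity), ENNReal.ofReal_mul (by positivity)]
    simp
  have hLs : ∀ s, Lam K s = (∫⁻ x in F ∩ {x | 0 < SS x}, TT J x * ex s x) +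
      (∫⁻ x in F ∩ {x | SS x ≤ 0}, TT J x * ex s x) := by
    intro s
    have : F ∩ {x | SS x ≤ 0} = F \ {x | 0 < SS x} := by ext x; simp
    rw [Lam, ← unfolding J hJ F hF s, this, lintegral_inter_add_sdiff _ F hP]
  refine ⟨μ₁, μ₂, Fintype.card (Cl K) * κ, ?_, ?_, ?_, ?_, ?_, ?_⟩
  · have : 0 < Fintype.card (Cl K) := Fintype.card_pos
    positivity
  · rw [h1, Measure.map_apply SS_meas measurableSet_Iio]
    refine withDensity_absolutelyContinuous _ _ ?_
    rw [Measure.restrict_apply (SS_meas measurableSet_Iio)]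
    convert measure_empty (μ := (volume : Measure (InfinitePlace K → ℝ)))
    ext x
    simp only [Set.mem_inter_iff, Set.mem_preimage, Set.mem_Iio, Set.mem_ofPred_eq, Set.mem_empty_iff_false,
      iff_false]
    rintro ⟨h, -, h'⟩; linarith
  · rw [h2, Measure.map_apply hSn measurableSet_Iio]
    refine withDensity_absolutelyContinuous _ _ ?_
    rw [Measure.restrict_apply (hSn measurableSet_Iio)]
    convert measure_empty (μ := (volume : Measure (InfinitePlace K → ℝ)))
    ext x
    simp only [Set.mem_inter_iff, Set.mem_preimage, Set.mem_Iio, Set.mem_ofPred_eq, Set.mem_empty_iff_false,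
      iff_false]
    rintro ⟨h, -, h'⟩; linarith
  · intro s; rw [hM, hLs]; exact le_self_add
  · intro s
    have hneg := Measure.measurePreserving_neg (volume : Measure (InfinitePlace K → ℝ))
    have hF2 : IsAddFundamentalDomain (U K) (Neg.neg ⁻¹' F) volume := by
      refine hF.preimage_of_equiv hneg.quasiMeasurePreserving (e := fun ℓ : U K => -ℓ)
        (neg_involutive.bijective) ?_
      intro ℓ x
      change -(((-ℓ : U K) : InfinitePlace K → ℝ) + x) = (ℓ : InfinitePlace K → ℝ) + -x
      simp only [AddSubgroup.coe_neg]; abel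
    have h4 := unfolding (dualF J) (rep_dual J hJ) _ hF2 s
    have h5 := hneg.setLIntegral_comp_preimage (s := Neg.neg ⁻¹' F) (measurable_neg hF0)
      ((TT_meas (dualF J)).mul (ex_meas s))
    have h6 : (Neg.neg ⁻¹' (Neg.neg ⁻¹' F) : Set (InfinitePlace K → ℝ)) = F := by ext x; simp
    rw [h6] at h5
    rw [Lam, ← h4]
    refine le_trans ?_ h5.le
    rw [hM']
    refine (lintegral_mono_set Set.inter_subset_left).trans (lintegral_mono fun x => ?_)
    simp [hex, el, SS]
  · intro s hs
    have h7 : (∫⁻ x in F ∩ {x | SS x ≤ 0}, TT J x * ex s x) + ENNReal.ofReal ((Fintype.card (Cl K) * κ : ℝ) / s) =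
        (∫⁻ x in F ∩ {x | SS x ≤ 0}, TT (dualF J) (-x) * ex (-(1 - s)) x) +
          ENNReal.ofReal ((Fintype.card (Cl K) * κ : ℝ) / (s - 1)) := by
      rw [← hint s (by linarith), ← hint (s - 1) (by linarith), 
        ← lintegral_add_left (f := fun x => TT J x * ex s x) (hT.mul (ex_meas s)),
        ← lintegral_add_left (f := fun x => TT (dualF J) (-x) * ex (-(1 - s)) x) (hT'.mul (ex_meas _))]
      refine lintegral_congr fun x => ?_
      rw [← add_mul, TT_fe, neg_sub, ← add_mul, mul_comm (ex (-1) x), mul_assoc]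
      congr 1
      simp only [ex]
      rw [← ENNReal.ofReal_mul (by positivity), ← Real.exp_add]
      congr 2; ring
    rw [hLs, add_assoc, h7, hM, hM', add_assoc]

end DZ

namespace DZ
open NumberField NumberField.Units NumberField.InfinitePlace MeasureTheory nonZeroDivisors

lemma exp_sub_lint (f : ℝ → ENNReal) : ∫⁻ x in Set.Ioi 0, f x = ∫⁻ t, ENNReal.ofReal (Real.exp t) * f (Real.exp t) := by
  have := lintegral_image_eq_lintegral_abs_deriv_mul (s := Set.univ) MeasurableSet.univ
    (fun x _ => (Real.hasDerivAt_exp x).hasDerivWithinAt) (Real.exp_injective.injOn) f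
  rw [Set.image_univ, Real.range_exp, Measure.restrict_univ] at this
  simpa using this

def gR (s t : ℝ) : ℝ := Real.exp (-Real.pi * Real.exp (2 * t)) * Real.exp (s * t)

def gaR (s : ℝ) : ℝ := 1 / 2 * Real.pi ^ (-s / 2) * Real.Gamma (s / 2)
lemma gaR_pos {s : ℝ} (hs : 0 < s) : 0 < gaR s := by
  have := Real.Gamma_pos_of_pos (half_pos hs); unfold gaR; positivity

lemma lint_gR {s : ℝ} (hs : 0 < s) : ∫⁻ t, ENNReal.ofReal (gR s t) = ENNReal.ofReal (gaR s) := by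
  have h1 := integral_rpow_mul_exp_neg_mul_rpow (p := 2) (q := s - 1) (b := Real.pi) (by norm_num)
    (by linarith) Real.pi_pos
  have h2 := integrableOn_rpow_mul_exp_neg_mul_rpow (p := 2) (s := s - 1) (b := Real.pi)
    (by linarith) (by norm_num) Real.pi_pos
  have h3 : gaR s = ∫ (x : ℝ) in Set.Ioi 0, x ^ (s - 1) * Real.exp (-Real.pi * x ^ (2:ℝ)) := by
    rw [h1, sub_add_cancel]; unfold gaR; ring
  rw [h3, ofReal_integral_eq_lintegral_ofReal h2, exp_sub_lint]
  · refine lintegral_congr fun t => ?_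
    rw [← ENNReal.ofReal_mul (by positivity)]
    congr 1
    rw [← mul_assoc, ← Real.exp_mul, ← Real.exp_mul, ← Real.exp_add, gR, mul_comm]
    congr 2
    · ring_nf
    · ring_nf
  · filter_upwards [ae_restrict_mem measurableSet_Ioi] with x hx
    have : 0 < x := hx
    positivity

variable {K : Type} [Field K] [NumberField K]

lemma gam_eq {s : ℝ} (hs : 0 < s) : gam K s = ENNReal.ofReal (gaR s ^ (Fintype.card (InfinitePlace K))) := by
  have hm : Measurable (gR s) := by unfold gR; fun_prop
  have h0 : ∀ t, 0 ≤ gR s t := fun t => by unfold gR; positivity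
  have hi : Integrable (gR s) := by
    refine ⟨hm.aestronglyMeasurable, ?_⟩
    rw [hasFiniteIntegral_iff_ofReal (Filter.Eventually.of_forall h0), lint_gR hs]
    exact ENNReal.ofReal_lt_top
  have h1 : ∫ t, gR s t = gaR s := by
    rw [integral_eq_lintegral_of_nonneg_ae (Filter.Eventually.of_forall h0) hm.aestronglyMeasurable, lint_gR hs,
      ENNReal.toReal_ofReal (gaR_pos hs).le]
  have h2 : ∀ x : InfinitePlace K → ℝ, g x * ex s x = ENNReal.ofReal (∏ w, gR s (x w)) := by
    intro x
    unfold g ex gR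
    rw [← ENNReal.ofReal_mul (by positivity), Finset.prod_mul_distrib, ← Real.exp_sum, ← Real.exp_sum,
      Finset.mul_sum, Finset.mul_sum]
  have h3 : Integrable fun x : InfinitePlace K → ℝ => ∏ w, gR s (x w) :=
    Integrable.fintype_prod (f := fun _ => gR s) fun _ => hi
  unfold gam
  simp_rw [h2]
  rw [← ofReal_integral_eq_lintegral_ofReal h3 (Filter.Eventually.of_forall fun x => Finset.prod_nonneg fun w _ => h0 _),
    integral_fintype_prod_volume_eq_pow (fun t => gR s t), h1]

end DZ

namespace DZ
open NumberField

variable {K : Type} [Field K] [NumberField K]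

variable (K) in
abbrev PP := {P : Ideal (𝓞 K) // Prime P}

lemma PP.max (P : PP K) : P.1.IsMaximal :=
  (Ideal.isPrime_of_prime P.2).isMaximal P.2.ne_zero

def N (I : Ideal (𝓞 K)) : ℕ := Ideal.absNorm I
lemma N_mul (I J : Ideal (𝓞 K)) : N (I * J) = N I * N J := map_mul _ _ _
lemma N_pos {I : Ideal (𝓞 K)} (h : I ≠ ⊥) : 0 < N I := Nat.pos_of_ne_zero fun h' => h (Ideal.absNorm_eq_zero_iff.1 h')
lemma N_prime (P : PP K) : 2 ≤ N P.1 := by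
  have h1 : N P.1 ≠ 0 := (N_pos P.2.ne_zero).ne'
  have h2 : N P.1 ≠ 1 := fun h => P.max.ne_top (Ideal.absNorm_eq_one_iff.1 h)
  omega

lemma fib_card {p : ℕ} (hp : p.Prime) (T : Finset (PP K)) (hT : ∀ P ∈ T, (p : 𝓞 K) ∈ P.1) :
    #T ≤ Module.finrank ℚ K := by
  have h1 : ∏ P ∈ T, P.1 ∣ Ideal.span {(p : 𝓞 K)} := by
    have := Finset.prod_primes_dvd (s := T.map ⟨Subtype.val, Subtype.val_injective⟩) (Ideal.span {(p : 𝓞 K)})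
      (by intro a ha; simp only [mem_map, Function.Embedding.coeFn_mk] at ha; obtain ⟨P, -, rfl⟩ := ha; exact P.2)
      (by intro a ha; simp only [mem_map, Function.Embedding.coeFn_mk] at ha; obtain ⟨P, h, rfl⟩ := ha
          rw [Ideal.dvd_span_singleton]; exact hT P h)
    simpa using this
  have h2 : ∏ P ∈ T, N P.1 ∣ p ^ Module.finrank ℤ (𝓞 K) := by
    rw [← Ideal.absNorm_span_natCast]
    unfold N
    rw [← map_prod]
    exact map_dvd _ h1
  have h3 : p ^ #T ≤ ∏ P ∈ T, N P.1 := by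
    rw [← Finset.prod_const]
    refine Finset.prod_le_prod' fun P hP => ?_
    have h4 : N P.1 ∣ p ^ Module.finrank ℤ (𝓞 K) := (Finset.dvd_prod_of_mem _ hP).trans h2
    obtain ⟨k, -, hk⟩ := (Nat.dvd_prime_pow hp).1 h4
    have h5 := N_prime P
    rw [hk] at h5 ⊢
    refine Nat.le_self_pow ?_ p
    rintro rfl; simp at h5
  have h4 := h3.trans (Nat.le_of_dvd (pow_pos hp.pos _) h2)
  rw [RingOfIntegers.rank] at h4
  exact (Nat.pow_le_pow_iff_right hp.one_lt).1 h4

lemma exists_under (P : PP K) : ∃ p : ℕ, p.Prime ∧ (p : 𝓞 K) ∈ P.1 ∧ ∃ f, f ≠ 0 ∧ N P.1 = p ^ f := by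
  have := P.max
  obtain ⟨p, k, hk, hm, hp, he⟩ := Ideal.exists_prime_and_absNorm_eq_pow P.1
  exact ⟨p, hp, hm, k, hk.ne', he⟩

def pu (P : PP K) : ℕ := (exists_under P).choose
lemma pu_prime (P : PP K) : (pu P).Prime := (exists_under P).choose_spec.1
lemma pu_mem (P : PP K) : (pu P : 𝓞 K) ∈ P.1 := (exists_under P).choose_spec.2.1
lemma pu_pow (P : PP K) : ∃ f, f ≠ 0 ∧ N P.1 = pu P ^ f := (exists_under P).choose_spec.2.2
lemma pu_le (P : PP K) : pu P ≤ N P.1 := by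
  obtain ⟨f, hf, h⟩ := pu_pow P
  rw [h]; exact Nat.le_self_pow hf _

lemma sum_PP (f : PP K → ℕ) (hle : ∀ P, pu (K := K) P ≤ f P) (a : ℕ → ENNReal) (ha : Antitone a) :
    ∑' P : PP K, a (f P) ≤ Module.finrank ℚ K * ∑' m, a (m + 2) := by
  obtain ⟨p, hpu⟩ : ∃ p, p = pu (K := K) := ⟨_, rfl⟩
  have hp := pu_prime (K := K)
  have hm := pu_mem (K := K)
  rw [← hpu] at hp hm hle
  rw [← ENNReal.tsum_fiberwise _ (fun P => p P - 2), ← ENNReal.tsum_mul_left]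
  refine ENNReal.tsum_le_tsum fun m => ?_
  rw [ENNReal.tsum_eq_iSup_sum]
  refine iSup_le fun T => ?_
  have h1 : ∀ P ∈ T, p P.1 = m + 2 := fun P _ => by
    have h2 : p P.1 - 2 = m := P.2
    have := (hp P.1).two_le
    omega
  calc ∑ P ∈ T, a (f P.1) ≤ ∑ P ∈ T, a (m + 2) := Finset.sum_le_sum fun P hP => ha (h1 P hP ▸ hle P.1)
    _ = #T * a (m + 2) := by simp
    _ ≤ _ := by
      gcongr
      rcases T.eq_empty_or_nonempty with rfl | ⟨P0, h0⟩
      · simp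
      · rw [← Finset.card_map ⟨Subtype.val, Subtype.val_injective⟩]
        refine fib_card (h1 P0 h0 ▸ hp P0.1) _ ?_
        intro P hP
        simp only [mem_map, Function.Embedding.coeFn_mk] at hP
        obtain ⟨Q, hQ, rfl⟩ := hP
        rw [← h1 Q hQ]; exact hm _

def Sm (T : Finset (PP K)) : Set (Ideal (𝓞 K)) := {I | I ≠ ⊥ ∧ ∀ P : PP K, P.1 ∣ I → P ∈ T}

lemma Sm_tsum (f : Ideal (𝓞 K) →* ENNReal) (T : Finset (PP K)) :
    ∑' I : Sm T, f I.1 = ∏ P ∈ T, (1 - f P.1)⁻¹ := by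
  classical
  induction T using Finset.induction_on with
  | empty =>
    rw [tsum_eq_single ⟨1, by
      refine ⟨one_ne_zero, fun P hP => (P.2.not_isUnit (isUnit_of_dvd_one hP)).elim⟩⟩]
    · simp [-Ideal.one_eq_top]
    · rintro ⟨I, h1, h2⟩ hne
      exfalso
      apply hne
      ext1
      by_contra hI
      obtain ⟨P, hP, hd⟩ := WfDvdMonoid.exists_irreducible_factor (a := I)
        (fun h => hI ((Ideal.isUnit_iff.1 h).trans Ideal.one_eq_top.symm)) h1
      simpa using h2 ⟨P, hP.prime⟩ hd
  | insert P T hPT ih =>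
    rw [Finset.prod_insert hPT, ← ih, ← ENNReal.tsum_geometric, ← ENNReal.tsum_mul_right]
    simp_rw [← ENNReal.tsum_mul_left]
    rw [← ENNReal.tsum_prod]
    symm
    have hnd : ∀ I : Sm T, ¬ P.1 ∣ I.1 := fun I h => hPT (I.2.2 P h)
    have hmem : ∀ x : ℕ × Sm T, P.1 ^ x.1 * x.2.1 ∈ Sm (insert P T) := by
      rintro ⟨j, I, h1, h2⟩
      refine ⟨mul_ne_zero (pow_ne_zero _ P.2.ne_zero) h1, fun Q hQ => ?_⟩
      rcases Q.2.dvd_or_dvd hQ with h | h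
      · have := (prime_dvd_prime_iff_eq Q.2 P.2).1 (Q.2.dvd_of_dvd_pow h)
        rw [Finset.mem_insert]; left; exact Subtype.ext this
      · exact Finset.mem_insert_of_mem (h2 Q h)
    rw [← (Equiv.ofBijective (fun x : ℕ × Sm T => (⟨_, hmem x⟩ : Sm (insert P T))) ⟨?_, ?_⟩).tsum_eq]
    · refine tsum_congr fun x => ?_
      change _ = f (P.1 ^ x.1 * x.2.1)
      rw [map_mul, map_pow]
    · rintro ⟨j, I⟩ ⟨j', I'⟩ h
      have h : P.1 ^ j * I.1 = P.1 ^ j' * I'.1 := congrArg Subtype.val h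
      have key : ∀ (j j' : ℕ) (I I' : Sm T), P.1 ^ j * I.1 = P.1 ^ j' * I'.1 → ¬ j < j' := by
        intro j j' I I' h hlt
        obtain ⟨d, rfl⟩ := Nat.exists_eq_add_of_lt hlt
        rw [add_assoc, pow_add, mul_assoc] at h
        have := mul_left_cancel₀ (pow_ne_zero _ P.2.ne_zero) h
        refine hnd I ?_
        rw [this, pow_succ']
        exact (dvd_mul_right _ _).mul_right _ |>.trans (by rw [mul_assoc])
      have e : j = j' := le_antisymm (not_lt.1 (key _ _ _ _ h.symm)) (not_lt.1 (key _ _ _ _ h))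
      subst e
      have := mul_left_cancel₀ (pow_ne_zero _ P.2.ne_zero) h
      rw [Subtype.ext this]
    · rintro ⟨I, h1, h2⟩
      obtain ⟨j, J, hJ, he⟩ := WfDvdMonoid.max_power_factor h1 P.2.irreducible
      refine ⟨⟨j, J, ?_, ?_⟩, ?_⟩
      · rintro rfl; simp at he; exact h1 he
      · intro Q hQ
        have := h2 Q (he ▸ hQ.mul_left _)
        rcases Finset.mem_insert.1 this with rfl | h
        · exact (hJ hQ).elim
        · exact h
      · exact Subtype.ext he.symm

lemma euler (f : Ideal (𝓞 K) →* ENNReal) :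
    ∑' I : NZ K, f I.1 = ⨆ T : Finset (PP K), ∏ P ∈ T, (1 - f P.1)⁻¹ := by
  classical
  apply le_antisymm
  · rw [ENNReal.tsum_eq_iSup_sum]
    refine iSup_le fun A => ?_
    have hfin : ∀ I : NZ K, {P : PP K | P.1 ∣ I.1}.Finite := fun I => by
      have := (UniqueFactorizationMonoid.fintypeSubtypeDvd I.1 I.2)
      have h : {J : Ideal (𝓞 K) | J ∣ I.1}.Finite := Set.finite_coe_iff.1 (Finite.of_fintype {J // J ∣ I.1})
      exact h.preimage (f := fun P : PP K => P.1) Subtype.val_injective.injOn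
    set T := A.biUnion fun I => (hfin I).toFinset
    refine le_trans ?_ (le_iSup _ T)
    rw [← Sm_tsum f T]
    have hA : ∀ I ∈ A, I.1 ∈ Sm T := fun I hI => ⟨I.2, fun P hP =>
      Finset.mem_biUnion.2 ⟨I, hI, by simpa using hP⟩⟩
    rw [← Finset.sum_attach]
    refine le_trans (le_of_eq ?_) (ENNReal.sum_le_tsum (A.attach.map
      ⟨fun I => (⟨I.1.1, hA I.1 I.2⟩ : Sm T), fun I J h => Subtype.ext (Subtype.ext (Subtype.mk.inj h))⟩))
    rw [Finset.sum_map]; rfl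
  · refine iSup_le fun T => ?_
    rw [← Sm_tsum f T]
    exact ENNReal.tsum_comp_le_tsum_of_injective (f := fun I : Sm T => (⟨I.1, I.2.1⟩ : NZ K))
      (fun I J h => Subtype.ext (Subtype.mk.inj h)) (fun I => f I.1)

end DZ

namespace DZ
open NumberField

variable {K : Type} [Field K] [NumberField K]

def XX (i : PP K × ℕ) : ℝ := -((i.2 + 1) * Real.log (N i.1.1))
def cc (i : PP K × ℕ) : ℝ := 1 / (i.2 + 1)
lemma cc_pos (i : PP K × ℕ) : 0 < cc i := by unfold cc; positivity
lemma XX_nonpos (i : PP K × ℕ) : XX i ≤ 0 := by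
  have h : 0 ≤ Real.log (N i.1.1) := Real.log_natCast_nonneg _
  have : 0 ≤ ((i.2 : ℝ) + 1) * Real.log (N i.1.1) := by positivity
  unfold XX; linarith

def nf (K : Type) [Field K] [NumberField K] (s : ℝ) : Ideal (𝓞 K) →* ENNReal where
  toFun I := ENNReal.ofReal ((N I : ℝ) ^ (-s))
  map_one' := by simp [N]
  map_mul' I J := by
    rw [N_mul, Nat.cast_mul, Real.mul_rpow (by positivity) (by positivity), ENNReal.ofReal_mul (by positivity)]

def bP (s : ℝ) (P : PP K) : ℝ := -Real.log (1 - (N P.1 : ℝ) ^ (-s))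

lemma aP_lt {s : ℝ} (hs : 1 < s) (P : PP K) : (N P.1 : ℝ) ^ (-s) ≤ 1 / 2 := by
  have h2 : (2 : ℝ) ≤ N P.1 := by exact_mod_cast N_prime P
  calc (N P.1 : ℝ) ^ (-s) ≤ (N P.1 : ℝ) ^ (-1 : ℝ) :=
        Real.rpow_le_rpow_of_exponent_le (by linarith) (by linarith)
    _ = (N P.1 : ℝ)⁻¹ := Real.rpow_neg_one _
    _ ≤ 1 / 2 := by rw [one_div]; gcongr

lemma bP_le {s : ℝ} (hs : 1 < s) (P : PP K) : 0 ≤ bP s P ∧ bP s P ≤ 2 * (N P.1 : ℝ) ^ (-s) := by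
  have h1 := aP_lt hs P
  have h0 : 0 ≤ (N P.1 : ℝ) ^ (-s) := by positivity
  unfold bP
  constructor
  · have := Real.log_nonpos (x := 1 - (N P.1 : ℝ) ^ (-s)) (by linarith) (by linarith)
    linarith
  · have h2 := Real.one_sub_inv_le_log_of_pos (x := 1 - (N P.1 : ℝ) ^ (-s)) (by linarith)
    have h3 : (1 - (N P.1 : ℝ) ^ (-s))⁻¹ ≤ 1 + 2 * (N P.1 : ℝ) ^ (-s) := by
      rw [inv_le_iff_one_le_mul₀ (by linarith)]; nlinarith
    linarith

variable (K) in
lemma sum_aP' (f : PP K → ℕ) (hf : ∀ P, pu P ≤ f P) {s : ℝ} (hs : 1 < s) : Summable (fun P : PP K => (f P : ℝ) ^ (-s)) ∧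
    ∑' P : PP K, (f P : ℝ) ^ (-s) ≤ Module.finrank ℚ K * ∑' m : ℕ, ((m : ℝ) + 2) ^ (-s) := by
  have hsum : Summable fun m : ℕ => ((m : ℝ) + 2) ^ (-s) := by
    have := (summable_nat_add_iff 2).2 (Real.summable_nat_rpow.2 (by linarith : -s < -1))
    simpa using this
  have h1 := sum_PP f hf (fun m => ENNReal.ofReal (((max m 1 : ℕ) : ℝ) ^ (-s))) (by
    intro m m' h
    apply ENNReal.ofReal_le_ofReal
    rw [Real.rpow_neg (by positivity), Real.rpow_neg (by positivity)]
    gcongr)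
  have e1 : ∀ P : PP K, max (f P) 1 = f P := fun P => by have := (pu_prime P).two_le; have := hf P; omega
  have e2 : ∀ m : ℕ, max (m + 2) 1 = m + 2 := fun m => by omega
  simp only [e1, e2] at h1
  push_cast at h1
  rw [← ENNReal.ofReal_tsum_of_nonneg (fun _ => by positivity) hsum, ← ENNReal.ofReal_natCast,
    ← ENNReal.ofReal_mul (by positivity)] at h1
  have h2 : Summable (fun P : PP K => (f P : ℝ) ^ (-s)) := by
    have h3 := ENNReal.summable_toReal (ne_top_of_le_ne_top ENNReal.ofReal_ne_top h1)
    refine h3.congr fun P => ENNReal.toReal_ofReal (by positivity)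
  refine ⟨h2, ?_⟩
  rw [← ENNReal.ofReal_tsum_of_nonneg (fun _ => by positivity) h2] at h1
  exact (ENNReal.ofReal_le_ofReal_iff (by positivity)).1 h1

variable (K) in
lemma sum_aP {s : ℝ} (hs : 1 < s) : Summable (fun P : PP K => (N P.1 : ℝ) ^ (-s)) ∧
    ∑' P : PP K, (N P.1 : ℝ) ^ (-s) ≤ Module.finrank ℚ K * ∑' m : ℕ, ((m : ℝ) + 2) ^ (-s) := sum_aP' K _ pu_le hs

variable (K) in
lemma sum_bP {s : ℝ} (hs : 1 < s) : Summable (bP (K := K) s) :=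
  Summable.of_nonneg_of_le (fun P => (bP_le hs P).1) (fun P => (bP_le hs P).2) ((sum_aP K hs).1.mul_left 2)

lemma inner_sum {s : ℝ} (hs : 1 < s) (P : PP K) :
    HasSum (fun j : ℕ => cc (P, j) * Real.exp (s * XX (P, j))) (bP s P) := by
  have h0 : 0 ≤ (N P.1 : ℝ) ^ (-s) := by positivity
  have h2 : (0 : ℝ) < N P.1 := by exact_mod_cast (zero_lt_two.trans_le (N_prime P))
  have := Real.hasSum_pow_div_log_of_abs_lt_one (x := (N P.1 : ℝ) ^ (-s))
    (by rw [abs_of_nonneg h0]; linarith [aP_lt hs P])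
  refine HasSum.congr_fun this ?_
  intro j
  unfold cc XX
  rw [Real.rpow_def_of_pos h2, ← Real.exp_nat_mul, one_div, mul_comm, ← div_eq_mul_inv]
  congr 2
  push_cast; ring

variable (K) in
lemma sum_pairs {s : ℝ} (hs : 1 < s) : Summable (fun i : PP K × ℕ => cc i * Real.exp (s * XX i)) ∧
    ∑' i : PP K × ℕ, cc i * Real.exp (s * XX i) = ∑' P : PP K, bP s P := by
  have h1 : Summable (fun i : PP K × ℕ => cc i * Real.exp (s * XX i)) := by
    rw [summable_prod_of_nonneg (fun i => by have := cc_pos i; positivity)]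
    refine ⟨fun P => (inner_sum hs P).summable, ?_⟩
    simpa only [(inner_sum hs _).tsum_eq] using sum_bP K hs
  refine ⟨h1, ?_⟩
  rw [h1.tsum_prod]
  exact tsum_congr fun P => (inner_sum hs P).tsum_eq

variable (K) in
lemma zet_eq {s : ℝ} (hs : 1 < s) :
    zet K s = ENNReal.ofReal (Real.exp (∑' i : PP K × ℕ, cc i * Real.exp (s * XX i))) := by
  rw [(sum_pairs K hs).2]
  have h1 : zet K s = ∑' I : NZ K, nf K s I.1 := rfl
  rw [h1, euler]
  have h2 : ∀ T : Finset (PP K), ∏ P ∈ T, (1 - nf K s P.1)⁻¹ = ENNReal.ofReal (Real.exp (∑ P ∈ T, bP s P)) := by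
    intro T
    rw [Real.exp_sum, ENNReal.ofReal_prod_of_nonneg (fun _ _ => by positivity)]
    refine Finset.prod_congr rfl fun P _ => ?_
    have h0 : 0 ≤ (N P.1 : ℝ) ^ (-s) := by positivity
    have h3 : 0 < 1 - (N P.1 : ℝ) ^ (-s) := by linarith [aP_lt hs P]
    change (1 - ENNReal.ofReal ((N P.1 : ℝ) ^ (-s)))⁻¹ = _
    rw [← ENNReal.ofReal_one, ← ENNReal.ofReal_sub _ h0, ← ENNReal.ofReal_inv_of_pos h3, bP, Real.exp_neg,
      Real.exp_log h3]
  simp_rw [h2]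
  refine tendsto_nhds_unique (tendsto_atTop_iSup ?_) ?_
  · intro T T' h
    apply ENNReal.ofReal_le_ofReal
    apply Real.exp_le_exp.2
    exact Finset.sum_le_sum_of_subset_of_nonneg h fun P _ _ => (bP_le hs P).1
  · exact ENNReal.tendsto_ofReal ((Real.continuous_exp.tendsto _).comp (sum_bP K hs).hasSum)

lemma zet_four : ∃ C : ℝ, 0 < C ∧ ∀ (K : Type) [Field K] [NumberField K],
    zet K 4 ≤ ENNReal.ofReal (Real.exp (C * Module.finrank ℚ K)) := by
  refine ⟨2 * ∑' m : ℕ, ((m : ℝ) + 2) ^ (-4 : ℝ) + 1, ?_, ?_⟩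
  · have : 0 ≤ ∑' m : ℕ, ((m : ℝ) + 2) ^ (-4 : ℝ) := tsum_nonneg fun _ => by positivity
    positivity
  · intro K _ _
    have h4 : (1 : ℝ) < 4 := by norm_num
    rw [zet_eq K h4, (sum_pairs K h4).2]
    apply ENNReal.ofReal_le_ofReal
    apply Real.exp_le_exp.2
    have h1 : ∑' P : PP K, bP 4 P ≤ ∑' P : PP K, 2 * (N P.1 : ℝ) ^ (-4 : ℝ) :=
      (sum_bP K h4).tsum_le_tsum (fun P => (bP_le h4 P).2) ((sum_aP K h4).1.mul_left 2)
    rw [tsum_mul_left] at h1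
    have h2 := (sum_aP K h4).2
    have h3 : (0 : ℝ) ≤ Module.finrank ℚ K := by positivity
    nlinarith

end DZ

namespace DZ
open MeasureTheory ProbabilityTheory

section ds
variable {ι : Type} [Countable ι] (X c : ι → ℝ)

def dm : @Measure ι ⊤ := let _ : MeasurableSpace ι := ⊤; Measure.sum fun i => ENNReal.ofReal (c i) • Measure.dirac i

def dF (z : ℂ) : ℂ := ∑' i, (c i : ℂ) * Complex.exp (z * X i)

variable (hc : ∀ i, 0 ≤ c i)
lemma dm_real {ι : Type} [Countable ι] (c : ι → ℝ) (hc : ∀ i, 0 ≤ c i) (i : ι) : (let _ : MeasurableSpace ι := ⊤; (dm c).real {i}) = c i := by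
  let _ : MeasurableSpace ι := ⊤
  classical
  have : dm c {i} = ENNReal.ofReal (c i) := by
    unfold dm
    rw [Measure.sum_apply _ (MeasurableSpace.measurableSet_top), tsum_eq_single i]
    · simp
    · intro j hj; simp [hj]
  change (dm c {i}).toReal = _
  rw [this, ENNReal.toReal_ofReal (hc i)]

lemma dm_int {ι : Type} [Countable ι] (c : ι → ℝ) (hc : ∀ i, 0 ≤ c i) (f : ι → ℝ) :
    let _ : MeasurableSpace ι := ⊤; Integrable f (dm c) ↔ Summable fun i => c i * |f i| := by
  let _ : MeasurableSpace ι := ⊤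
  have hm : Measurable f := measurable_from_top
  intro _
  refine (and_iff_right hm.aestronglyMeasurable).trans ?_
  rw [hasFiniteIntegral_iff_norm]
  unfold dm
  rw [lintegral_sum_measure]
  simp only [lintegral_smul_measure, lintegral_dirac, smul_eq_mul, Real.norm_eq_abs]
  simp_rw [← ENNReal.ofReal_mul (hc _)]
  refine ⟨fun h => ?_, fun h => h.tsum_ofReal_lt_top⟩
  refine (ENNReal.summable_toReal h.ne).congr fun i => ?_
  rw [ENNReal.toReal_ofReal (mul_nonneg (hc i) (abs_nonneg _))]

theorem dF_diff (hs : ∀ s : ℝ, 1 < s → Summable fun i => c i * Real.exp (s * X i)) (hc : ∀ i, 0 ≤ c i) :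
    DifferentiableOn ℂ (dF X c) {z | 1 < z.re} ∧ ∀ s : ℝ, 1 < s → ∀ k : ℕ,
      (Summable fun i => c i * X i ^ k * Real.exp (s * X i)) ∧
      iteratedDeriv k (dF X c) s = ((∑' i, c i * X i ^ k * Real.exp (s * X i) : ℝ) : ℂ) := by
  let _ : MeasurableSpace ι := ⊤
  have hint : ∀ s : ℝ, 1 < s → Integrable (fun i => Real.exp (s * X i)) (dm c) := fun s h =>
    (dm_int c hc _).2 (by simpa only [Real.abs_exp] using hs s h)
  have hset : ∀ s : ℝ, 1 < s → s ∈ interior (integrableExpSet X (dm c)) := by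
    intro s h
    rw [mem_interior]
    exact ⟨Set.Ioi 1, fun t ht => hint t ht, isOpen_Ioi, h⟩
  have heq : Set.EqOn (complexMGF X (dm c)) (dF X c) {z | 1 < z.re} := by
    intro z hz
    unfold complexMGF dF
    rw [integral_countable]
    · refine tsum_congr fun i => ?_
      rw [dm_real c hc]; simp
    · have := hint z.re hz
      refine this.mono' (measurable_from_top.aestronglyMeasurable) (Filter.Eventually.of_forall fun i => ?_)
      rw [Complex.norm_exp]; simp
  have hopen : IsOpen {z : ℂ | 1 < z.re} := isOpen_lt continuous_const Complex.continuous_re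
  constructor
  · refine (differentiableOn_complexMGF (X := X) (μ := dm c)).mono ?_ |>.congr fun z hz => (heq hz).symm
    intro z hz; exact hset _ hz
  · intro s h k
    have hs' : ((s : ℂ)).re ∈ interior (integrableExpSet X (dm c)) := by simpa using hset s h
    have hi : Integrable (fun i => X i ^ k * Real.exp (s * X i)) (dm c) :=
      integrable_pow_mul_exp_of_mem_interior_integrableExpSet (hset s h) k
    have e1 : iteratedDeriv k (dF X c) s = iteratedDeriv k (complexMGF X (dm c)) s := by
      refine Filter.EventuallyEq.iteratedDeriv_eq _ ?_
      filter_upwards [hopen.mem_nhds (show (s : ℂ) ∈ {z : ℂ | 1 < z.re} by simpa using h)] with z hz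
      exact (heq hz).symm
    have hsum : Summable fun i => c i * X i ^ k * Real.exp (s * X i) := by
      refine ((dm_int c hc _).1 hi).of_norm_bounded fun i => le_of_eq ?_
      rw [mul_assoc, norm_mul, Real.norm_of_nonneg (hc i), Real.norm_eq_abs]
    refine ⟨hsum, ?_⟩
    rw [e1, iteratedDeriv_complexMGF hs']
    have e2 : ∀ i, (X i : ℂ) ^ k * Complex.exp (s * X i) = ((X i ^ k * Real.exp (s * X i) : ℝ) : ℂ) := by
      intro i; push_cast; rfl
    simp_rw [e2]
    rw [integral_complex_ofReal, integral_countable hi]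
    congr 1
    refine tsum_congr fun i => ?_
    rw [dm_real c hc, smul_eq_mul, mul_assoc]
end ds
end DZ

namespace DZ
open NumberField NumberField.InfinitePlace MeasureTheory ProbabilityTheory

lemma half_int (μ : Measure ℝ) (h : ∀ s : ℝ, 1 < s → ∫⁻ t, el s t ∂μ < ⊤) (h0 : μ (Set.Iio 0) = 0) :
    (∀ s : ℝ, Integrable (fun t => Real.exp (s * t)) μ) ∧ Differentiable ℂ (complexMGF id μ) ∧
    (∀ s s' : ℝ, s ≤ s' → mgf id μ s ≤ mgf id μ s') ∧ ∀ s : ℝ, ∫⁻ t, el s t ∂μ = ENNReal.ofReal (mgf id μ s) := by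
  have h0' : ∀ᵐ t ∂μ, 0 ≤ t := by
    rw [ae_iff]; convert h0 using 2; ext t; simp
  have hm : ∀ s : ℝ, AEStronglyMeasurable (fun t => Real.exp (s * t)) μ := fun s =>
    (by fun_prop : Measurable fun t : ℝ => Real.exp (s * t)).aestronglyMeasurable
  have h1 : ∀ s : ℝ, 1 < s → Integrable (fun t => Real.exp (s * t)) μ := fun s hs => by
    refine ⟨hm s, ?_⟩
    rw [hasFiniteIntegral_iff_ofReal (Filter.Eventually.of_forall fun t => (Real.exp_pos _).le)]
    exact h s hs
  have h2 : ∀ s : ℝ, Integrable (fun t => Real.exp (s * t)) μ := fun s => by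
    refine (h1 (max s 2) (by simp)).mono' (hm s) ?_
    filter_upwards [h0'] with t ht
    rw [Real.norm_eq_abs, Real.abs_exp]
    apply Real.exp_le_exp.2
    gcongr; simp
  have h3 : integrableExpSet id μ = Set.univ := by ext s; simpa [integrableExpSet] using h2 s
  refine ⟨h2, ?_, ?_, ?_⟩
  · have := differentiableOn_complexMGF (X := id) (μ := μ)
    rw [h3] at this
    simpa [differentiableOn_univ] using this
  · intro s s' hs
    refine integral_mono_ae (h2 s) (h2 s') ?_
    filter_upwards [h0'] with t ht
    apply Real.exp_le_exp.2
    simp only [id]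
    gcongr
  · intro s
    exact (ofReal_integral_eq_lintegral_ofReal (h2 s) (Filter.Eventually.of_forall fun t => (Real.exp_pos _).le)).symm

def qq (z : ℂ) : ℂ := (Real.pi : ℂ) ^ (z / 2) * (Complex.Gamma (z / 2 + 1))⁻¹
lemma qq_diff : Differentiable ℂ qq := by
  have h1 : Differentiable ℂ fun z : ℂ => (Complex.Gamma (z / 2 + 1))⁻¹ :=
    Complex.differentiable_one_div_Gamma.comp (by fun_prop : Differentiable ℂ fun z : ℂ => z / 2 + 1)
  have h2 : Differentiable ℂ fun z : ℂ => (Real.pi : ℂ) ^ (z / 2) := by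
    intro z
    exact DifferentiableAt.const_cpow (by fun_prop) (Or.inl (by exact_mod_cast Real.pi_ne_zero))
  exact h2.mul h1

lemma qq_real {s : ℝ} (hs : 0 < s) : (s : ℂ) * qq s * (gaR s : ℂ) = 1 := by
  have h1 := Real.Gamma_add_one (s := s / 2) (by positivity)
  have h2 : (Complex.Gamma ((s : ℂ) / 2 + 1)) = ((Real.Gamma (s / 2 + 1) : ℝ) : ℂ) := by
    rw [← Complex.Gamma_ofReal]; push_cast; rfl
  have h3 : (Real.pi : ℂ) ^ ((s : ℂ) / 2) = ((Real.pi ^ (s / 2) : ℝ) : ℂ) := by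
    rw [Complex.ofReal_cpow Real.pi_pos.le]; push_cast; rfl
  have h4 : Real.Gamma (s / 2) ≠ 0 := (Real.Gamma_pos_of_pos (half_pos hs)).ne'
  have h5 : Real.pi ^ (s / 2) ≠ 0 := (Real.rpow_pos_of_pos Real.pi_pos _).ne'
  unfold qq
  rw [h2, h3, h1]
  norm_cast
  unfold gaR
  rw [neg_div, Real.rpow_neg Real.pi_pos.le]
  field_simp

variable (K : Type) [Field K] [NumberField K]

theorem cont : ∃ C0 : ℝ, 0 < C0 ∧ ∀ (K : Type) [Field K] [NumberField K] [IsTotallyReal K],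
    ∃ H : ℂ → ℂ, Differentiable ℂ H ∧ H 1 ≠ 0 ∧
      (∀ s : ℝ, 1 < s → H s = ((s - 1) * Real.exp (∑' i : PP K × ℕ, cc i * Real.exp (s * XX i)) : ℝ)) ∧
      ∀ z ∈ Metric.closedBall (2 : ℂ) (3 / 2), ‖H z‖ ≤
        Real.exp (C0 * (Module.finrank ℚ K + Real.log |(discr K : ℝ)|)) := by
  obtain ⟨C, hC, hz4⟩ := zet_four
  set A := gaR 4
  have hA : 0 < A := gaR_pos (by norm_num)
  obtain ⟨E, hE⟩ := (isCompact_closedBall (2 : ℂ) (3 / 2)).exists_bound_of_continuousOn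
    (f := fun z => qq z) (by have := qq_diff.continuous; fun_prop)
  set E' := max E 1
  have hE1 : 1 ≤ E' := le_max_right _ _
  refine ⟨max 2 (C + 4 + 4 * E' * A), by positivity, ?_⟩
  intro K _ _ _
  obtain ⟨μ₁, μ₂, κ, hκ, h10, h20, hb1, hb2, hfe⟩ := split K
  set n := Module.finrank ℚ K
  have hn : 0 < n := Module.finrank_pos
  have hcard : Fintype.card (InfinitePlace K) = n := card_places
  set ℓ : ℝ → ℝ := fun s => ∑' i : PP K × ℕ, cc i * Real.exp (s * XX i)
  set W := (WW K).toReal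
  have hW : 0 < W := ENNReal.toReal_pos (WW_ne K) (WW_top K)
  have hsD := sD_pos (K := K)
  have hLam : ∀ s : ℝ, 1 < s → Lam K s = ENNReal.ofReal (W * (sD K ^ s * (Real.exp (ℓ s) * gaR s ^ n))) := by
    intro s hs
    have := gaR_pos (zero_lt_one.trans hs)
    rw [Lam, gam_eq (by linarith), zet_eq K hs, hcard, ← ENNReal.ofReal_toReal (WW_top K),
      ← ENNReal.ofReal_mul (by positivity), ← ENNReal.ofReal_mul (by positivity),
      ← ENNReal.ofReal_mul (by positivity)]
  obtain ⟨i1, d1, m1, l1⟩ := half_int μ₁ (fun s hs => (hb1 s).trans_lt (by rw [hLam s hs]; exact ENNReal.ofReal_lt_top)) h10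
  obtain ⟨i2, d2, m2, l2⟩ := half_int μ₂ (fun s hs => (hb2 s).trans_lt (by rw [hLam s hs]; exact ENNReal.ofReal_lt_top)) h20
  have hfe' : ∀ s : ℝ, 1 < s → W * (sD K ^ s * (Real.exp (ℓ s) * gaR s ^ n)) + κ / s =
      mgf id μ₁ s + mgf id μ₂ (1 - s) + κ / (s - 1) := by
    intro s hs
    have h := hfe s hs
    have g0 := gaR_pos (zero_lt_one.trans hs)
    have hs1 : 0 < s - 1 := by linarith
    have n1 : 0 ≤ mgf id μ₁ s := mgf_nonneg
    have n2 : 0 ≤ mgf id μ₂ (1 - s) := mgf_nonneg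
    rw [hLam s hs, l1, l2, ← ENNReal.ofReal_add (by positivity) (by positivity),
      ← ENNReal.ofReal_add n1 n2, ← ENNReal.ofReal_add (by positivity) (by positivity),
      ENNReal.ofReal_eq_ofReal_iff (by positivity) (by positivity)] at h
    exact h
  set H : ℂ → ℂ := fun z => (W : ℂ)⁻¹ * (sD K : ℂ) ^ (-z) * qq z ^ n * z ^ (n - 1) *
    (z * (z - 1) * (complexMGF id μ₁ z + complexMGF id μ₂ (1 - z)) + κ) with hH
  have hsDc : (sD K : ℂ) ≠ 0 := by exact_mod_cast hsD.ne'
  refine ⟨H, ?_, ?_, ?_, ?_⟩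
  · have h1 : Differentiable ℂ fun z : ℂ => (sD K : ℂ) ^ (-z) := fun z =>
      DifferentiableAt.const_cpow (by fun_prop) (Or.inl hsDc)
    have h2 := qq_diff
    have h3 : Differentiable ℂ fun z : ℂ => complexMGF id μ₂ (1 - z) := d2.comp (by fun_prop)
    rw [hH]
    fun_prop
  · have h1 := qq_real (s := 1) one_pos
    have h2 : qq 1 ≠ 0 := by rintro h; simp [h] at h1
    simp [hH, hW.ne', hsDc, h2, hκ.ne', Complex.cpow_neg]
  · intro s hs
    have h1 := qq_real (s := s) (by linarith)
    have h2 := hfe' s hs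
    have hs1 : s - 1 ≠ 0 := by linarith
    have hs0 : s ≠ 0 := by linarith
    have h3 : s * (s - 1) * (mgf id μ₁ s + mgf id μ₂ (1 - s)) + κ =
        s * (s - 1) * (W * (sD K ^ s * (Real.exp (ℓ s) * gaR s ^ n))) := by
      have : mgf id μ₁ s + mgf id μ₂ (1 - s) = W * (sD K ^ s * (Real.exp (ℓ s) * gaR s ^ n)) + κ / s - κ / (s - 1) := by
        linarith
      rw [this]; field_simp; ring
    have h4 : complexMGF id μ₂ (1 - (s : ℂ)) = mgf id μ₂ (1 - s) := by
      rw [← complexMGF_ofReal]; push_cast; rfl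
    have h5 : (sD K : ℂ) ^ (-(s : ℂ)) = ((sD K ^ s : ℝ) : ℂ)⁻¹ := by
      rw [Complex.cpow_neg, Complex.ofReal_cpow hsD.le]
    have h6 : (sD K ^ s : ℝ) ≠ 0 := (Real.rpow_pos_of_pos hsD _).ne'
    have h7 : (s : ℂ) ^ (n - 1) * s = s ^ n := by rw [← pow_succ, Nat.sub_add_cancel hn]
    have h3' : (s : ℂ) * (s - 1) * (mgf id μ₁ s + mgf id μ₂ (1 - s)) + κ =
        s * (s - 1) * (W * ((sD K ^ s : ℝ) * (Real.exp (ℓ s) * gaR s ^ n))) := by exact_mod_cast h3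
    simp only [hH]
    rw [complexMGF_ofReal, h4, h5, h3']
    have hWc : (W : ℂ) ≠ 0 := by exact_mod_cast hW.ne'
    have h6c : ((sD K ^ s : ℝ) : ℂ) ≠ 0 := by exact_mod_cast h6
    have h8 : qq s ^ n * s ^ n * (gaR s : ℂ) ^ n = 1 := by
      rw [← mul_pow, ← mul_pow, mul_comm (qq s), h1, one_pow]
    change _ = (((s - 1) * Real.exp (ℓ s) : ℝ) : ℂ)
    calc _ = (W : ℂ)⁻¹ * W * (((sD K ^ s : ℝ) : ℂ)⁻¹ * ((sD K ^ s : ℝ) : ℂ)) *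
          (qq s ^ n * (s ^ (n - 1) * s) * (gaR s : ℂ) ^ n) * ((s - 1) * Real.exp (ℓ s)) := by ring
      _ = _ := by
        rw [h7, h8, inv_mul_cancel₀ hWc, inv_mul_cancel₀ h6c]; push_cast; ring
  · intro z hz
    have hzq : ‖qq z‖ ≤ E' := (hE z hz).trans (le_max_left _ _)
    rw [Metric.mem_closedBall, dist_eq_norm] at hz
    have hre := (Complex.abs_re_le_norm (z - 2)).trans hz
    simp only [Complex.sub_re, Complex.re_ofNat, abs_le] at hre
    have hz4' : ‖z‖ ≤ 4 := by
      have := norm_add_le (z - 2) 2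
      rw [sub_add_cancel] at this
      norm_num at this; linarith
    have hz3 : ‖z - 1‖ ≤ 3 := by
      have := norm_add_le (z - 2) 1
      rw [show z - 2 + 1 = z - 1 by ring] at this
      norm_num at this; linarith
    set Λ := W * (sD K ^ (4 : ℝ) * (Real.exp (ℓ 4) * A ^ n)) with hΛ
    have hΛ0 : 0 < Λ := by positivity
    have h4 : (1 : ℝ) < 4 := by norm_num
    have M4 : mgf id μ₁ 4 ≤ Λ := by
      have := hb1 4
      rw [l1, hLam 4 h4] at this
      exact (ENNReal.ofReal_le_ofReal_iff hΛ0.le).1 this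
    have N4 : mgf id μ₂ 4 ≤ Λ := by
      have := hb2 4
      rw [l2, hLam 4 h4] at this
      exact (ENNReal.ofReal_le_ofReal_iff hΛ0.le).1 this
    have hκ4 : κ ≤ 12 * Λ := by
      have h := hfe' 4 h4
      have n1 : 0 ≤ mgf id μ₁ 4 := mgf_nonneg
      have n2 : 0 ≤ mgf id μ₂ (1 - 4) := mgf_nonneg
      rw [← hΛ] at h
      norm_num at h n2
      linarith
    have a1 : ‖complexMGF id μ₁ z‖ ≤ Λ := norm_complexMGF_le_mgf.trans ((m1 _ 4 (by linarith)).trans M4)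
    have a2 : ‖complexMGF id μ₂ (1 - z)‖ ≤ Λ := norm_complexMGF_le_mgf.trans ((m2 _ 4 (by simp; linarith)).trans N4)
    have hbr : ‖z * (z - 1) * (complexMGF id μ₁ z + complexMGF id μ₂ (1 - z)) + κ‖ ≤ 36 * Λ := by
      have b1 := norm_add_le (z * (z - 1) * (complexMGF id μ₁ z + complexMGF id μ₂ (1 - z))) (κ : ℂ)
      have b2 := norm_add_le (complexMGF id μ₁ z) (complexMGF id μ₂ (1 - z))
      have b3 : ‖z‖ * ‖z - 1‖ * ‖complexMGF id μ₁ z + complexMGF id μ₂ (1 - z)‖ ≤ 4 * 3 * (Λ + Λ) := by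
        gcongr; linarith
      rw [norm_mul, norm_mul, Complex.norm_real, Real.norm_of_nonneg hκ.le] at b1
      linarith
    have hD1 : (1 : ℝ) ≤ |(discr K : ℝ)| := by
      have := Int.one_le_abs (discr_ne_zero K)
      exact_mod_cast this
    have hsD1 : 1 ≤ sD K := by unfold sD; exact Real.one_le_sqrt.2 hD1
    have hsD4 : sD K ^ (4 : ℝ) = Real.exp (2 * Real.log |(discr K : ℝ)|) := by
      have : sD K ^ (4 : ℝ) = (sD K ^ 2) ^ 2 := by rw [← pow_mul]; exact_mod_cast Real.rpow_natCast (sD K) 4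
      rw [this, sD, Real.sq_sqrt (abs_nonneg _), show (2 : ℝ) * Real.log |(discr K : ℝ)| = Real.log (|(discr K : ℝ)| ^ 2) by
        rw [Real.log_pow]; norm_num, Real.exp_log (by nlinarith)]
    have hsDz : ‖(sD K : ℂ) ^ (-z)‖ ≤ 1 := by
      rw [Complex.norm_cpow_eq_rpow_re_of_pos hsD]
      exact Real.rpow_le_one_of_one_le_of_nonpos hsD1 (by simp; linarith)
    have hzn : ‖z‖ ^ (n - 1) ≤ 4 ^ n := (pow_le_pow_left₀ (norm_nonneg _) hz4' _).trans
      (pow_le_pow_right₀ (by norm_num) (Nat.sub_le _ _))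
    have hexp4 : Real.exp (ℓ 4) ≤ Real.exp (C * n) := by
      have := hz4 K
      rw [zet_eq K h4] at this
      exact (ENNReal.ofReal_le_ofReal_iff (by positivity)).1 this
    have h36 : (36 : ℝ) ≤ Real.exp (4 * n) := by
      have e1 : (2.7 : ℝ) ≤ Real.exp 1 := by linarith [Real.exp_one_gt_d9]
      have e2 : Real.exp 4 = Real.exp 1 ^ 4 := by rw [← Real.exp_nat_mul]; norm_num
      have e3 : (2.7 : ℝ) ^ 4 ≤ Real.exp 1 ^ 4 := by gcongr
      have e4 : Real.exp 4 ≤ Real.exp (4 * n) := Real.exp_le_exp.2 (by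
        have : (1 : ℝ) ≤ n := by exact_mod_cast hn
        linarith)
      norm_num at e3; linarith
    have hEA : (4 * E' * A) ^ n ≤ Real.exp (4 * E' * A * n) := by
      rw [mul_comm _ (n : ℝ), Real.exp_nat_mul]
      gcongr
      linarith [Real.add_one_le_exp (4 * E' * A)]
    have hlog : 0 ≤ Real.log |(discr K : ℝ)| := Real.log_nonneg hD1
    calc ‖H z‖ = W⁻¹ * ‖(sD K : ℂ) ^ (-z)‖ * ‖qq z‖ ^ n * ‖z‖ ^ (n - 1) *
          ‖z * (z - 1) * (complexMGF id μ₁ z + complexMGF id μ₂ (1 - z)) + κ‖ := by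
          rw [hH, norm_mul, norm_mul, norm_mul, norm_mul, norm_pow, norm_pow, norm_inv, Complex.norm_real,
            Real.norm_of_nonneg hW.le]
      _ ≤ W⁻¹ * 1 * E' ^ n * 4 ^ n * (36 * Λ) := by gcongr
      _ = 36 * Real.exp (ℓ 4) * (4 * E' * A) ^ n * sD K ^ (4 : ℝ) := by
          rw [hΛ, mul_pow, mul_pow]; field_simp
      _ ≤ Real.exp (4 * n) * Real.exp (C * n) * Real.exp (4 * E' * A * n) * Real.exp (2 * Real.log |(discr K : ℝ)|) := by
          rw [hsD4]; gcongr
      _ ≤ _ := by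
          rw [← Real.exp_add, ← Real.exp_add, ← Real.exp_add]
          apply Real.exp_le_exp.2
          have f1 := le_max_left 2 (C + 4 + 4 * E' * A)
          have f2 := le_max_right 2 (C + 4 + 4 * E' * A)
          have f3 : (0 : ℝ) ≤ n := by positivity
          nlinarith [mul_le_mul_of_nonneg_right f1 hlog, mul_le_mul_of_nonneg_right f2 f3]

end DZ

namespace DZ
open NumberField Filter Topology

lemma ident {F G : ℂ → ℂ} (hF : DifferentiableOn ℂ F {z | 1 < z.re}) (hG : DifferentiableOn ℂ G {z | 1 < z.re})
    (h : ∀ s : ℝ, 1 < s → F s = G s) : ∀ z : ℂ, 1 < z.re → F z = G z := by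
  have ho : IsOpen {z : ℂ | 1 < z.re} := isOpen_lt continuous_const Complex.continuous_re
  have hc : IsPreconnected {z : ℂ | 1 < z.re} := (convex_halfSpace_re_gt 1).isPreconnected
  refine (hF.analyticOnNhd ho).eqOn_of_preconnected_of_frequently_eq (hG.analyticOnNhd ho) hc
    (z₀ := ((2 : ℝ) : ℂ)) (by simp) ?_
  have ht : Tendsto (fun t : ℝ => (t : ℂ)) (𝓝[≠] 2) (𝓝[≠] ((2 : ℝ) : ℂ)) :=
    tendsto_nhdsWithin_of_tendsto_nhds_of_eventually_within _
      (Complex.continuous_ofReal.continuousAt.tendsto.mono_left nhdsWithin_le_nhds)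
      (eventually_nhdsWithin_of_forall fun t ht h => ht (Complex.ofReal_injective h))
  refine ht.frequently (Eventually.frequently ?_)
  filter_upwards [nhdsWithin_le_nhds (lt_mem_nhds (show (1 : ℝ) < 2 by norm_num))] with t ht
  exact h t ht

lemma re_dF {ι : Type} {X c : ι → ℝ} (hs : ∀ s : ℝ, 1 < s → Summable fun i => c i * Real.exp (s * X i)) (hc : ∀ i, 0 ≤ c i)
    {σ : ℝ} (h : 1 < σ) (t : ℝ) : Summable (fun i => c i * Real.exp (σ * X i) * Real.cos (t * X i)) ∧
    (dF X c (σ + t * Complex.I)).re = ∑' i, c i * Real.exp (σ * X i) * Real.cos (t * X i) := by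
  have e : ∀ i, ((c i : ℂ) * Complex.exp ((σ + t * Complex.I) * X i)).re = c i * Real.exp (σ * X i) * Real.cos (t * X i) := by
    intro i
    rw [Complex.re_ofReal_mul, Complex.exp_re]; simp [mul_assoc]
  have hsum : Summable fun i => (c i : ℂ) * Complex.exp ((σ + t * Complex.I) * X i) := by
    refine Summable.of_norm ((hs σ h).congr fun i => ?_)
    rw [norm_mul, Complex.norm_exp, Complex.norm_real, Real.norm_of_nonneg (hc i)]; simp
  refine ⟨((Complex.hasSum_re hsum.hasSum).summable).congr e, ?_⟩
  rw [dF, Complex.re_tsum hsum]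
  exact tsum_congr e

lemma comb {ι : Type} {X c : ι → ℝ} (hs : ∀ s : ℝ, 1 < s → Summable fun i => c i * Real.exp (s * X i)) (hc : ∀ i, 0 ≤ c i)
    {σ : ℝ} (h : 1 < σ) (t : ℝ) :
    0 ≤ 3 * (dF X c (σ + (0 : ℝ) * Complex.I)).re + 4 * (dF X c (σ + t * Complex.I)).re + (dF X c (σ + (2 * t : ℝ) * Complex.I)).re := by
  obtain ⟨a1, b1⟩ := re_dF hs hc h 0
  obtain ⟨a2, b2⟩ := re_dF hs hc h t
  obtain ⟨a3, b3⟩ := re_dF hs hc h (2 * t)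
  rw [b1, b2, b3, ← tsum_mul_left, ← tsum_mul_left, ← (a1.mul_left 3).tsum_add (a2.mul_left 4),
    ← ((a1.mul_left 3).add (a2.mul_left 4)).tsum_add a3]
  refine tsum_nonneg fun i => ?_
  have : 0 ≤ c i * Real.exp (σ * X i) * (2 * (1 + Real.cos (t * X i)) ^ 2) := by
    have := hc i; positivity
  rw [mul_assoc 2 t, Real.cos_two_mul, zero_mul, Real.cos_zero]
  linarith

lemma nv {ι : Type} {X c : ι → ℝ} (hs : ∀ s : ℝ, 1 < s → Summable fun i => c i * Real.exp (s * X i)) (hc : ∀ i, 0 ≤ c i)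
    {H : ℂ → ℂ} (hH : Differentiable ℂ H) (hF : ∀ z : ℂ, 1 < z.re → H z = (z - 1) * Complex.exp (dF X c z)) {t : ℝ} (ht : t ≠ 0) :
    H (1 + t * Complex.I) ≠ 0 := by
  intro h0
  set z0 : ℂ := 1 + t * Complex.I with hz0
  set q := dslope H z0
  have hq : Continuous q := by
    have := (Complex.differentiableOn_dslope (f := H) (c := z0) Filter.univ_mem).2 hH.differentiableOn
    exact (differentiableOn_univ.1 this).continuous
  set Φ : ℝ → ℝ := fun δ => δ * (‖H ((1 + δ : ℝ) + (0 : ℝ) * Complex.I)‖ ^ 3 * ‖q ((1 + δ : ℝ) + t * Complex.I)‖ ^ 4 *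
    ‖H ((1 + δ : ℝ) + (2 * t : ℝ) * Complex.I)‖)
  have hΦ : Continuous Φ := by
    have := hH.continuous
    fun_prop
  have key : ∀ δ : ℝ, 0 < δ → |t| ^ 5 ≤ Φ δ := by
    intro δ hδ
    have h1 : 1 < 1 + δ := by linarith
    have hc := comb hs hc h1 t
    have hn : ∀ u : ℝ, ‖H ((1 + δ : ℝ) + u * Complex.I)‖ = ‖(δ : ℂ) + u * Complex.I‖ *
        Real.exp (dF X c ((1 + δ : ℝ) + u * Complex.I)).re := by
      intro u
      rw [hF _ (by simp; linarith), norm_mul, Complex.norm_exp]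
      congr 2; push_cast; ring
    have hqe : ‖H ((1 + δ : ℝ) + t * Complex.I)‖ = δ * ‖q ((1 + δ : ℝ) + t * Complex.I)‖ := by
      have := sub_smul_dslope H z0 ((1 + δ : ℝ) + t * Complex.I)
      rw [h0, sub_zero] at this
      rw [← this, norm_smul, show ((1 + δ : ℝ) + t * Complex.I : ℂ) - z0 = (δ : ℝ) by rw [hz0]; push_cast; ring,
        Complex.norm_real, Real.norm_of_nonneg hδ.le]
    have him : ∀ u : ℝ, |u| ≤ ‖(δ : ℂ) + u * Complex.I‖ := fun u => by
      simpa using Complex.abs_im_le_norm ((δ : ℂ) + u * Complex.I)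
    have hre : δ ≤ ‖(δ : ℂ) + (0 : ℝ) * Complex.I‖ := by simp [abs_of_pos hδ]
    have hexp : 1 ≤ Real.exp (dF X c ((1 + δ : ℝ) + (0 : ℝ) * Complex.I)).re ^ 3 *
        Real.exp (dF X c ((1 + δ : ℝ) + t * Complex.I)).re ^ 4 * Real.exp (dF X c ((1 + δ : ℝ) + (2 * t : ℝ) * Complex.I)).re := by
      rw [← Real.exp_nat_mul, ← Real.exp_nat_mul, ← Real.exp_add, ← Real.exp_add]
      exact Real.one_le_exp (by push_cast at hc ⊢; linarith)
    have hprod : δ ^ 3 * |t| ^ 5 ≤ ‖H ((1 + δ : ℝ) + (0 : ℝ) * Complex.I)‖ ^ 3 * ‖H ((1 + δ : ℝ) + t * Complex.I)‖ ^ 4 *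
        ‖H ((1 + δ : ℝ) + (2 * t : ℝ) * Complex.I)‖ := by
      rw [hn, hn, hn]
      have h2t : |t| ≤ ‖(δ : ℂ) + (2 * t : ℝ) * Complex.I‖ := by
        refine le_trans ?_ (him (2 * t)); rw [abs_mul]; norm_num; linarith [abs_nonneg t]
      calc δ ^ 3 * |t| ^ 5 = (δ ^ 3 * |t| ^ 4 * |t|) * 1 := by ring
        _ ≤ (‖(δ : ℂ) + (0 : ℝ) * Complex.I‖ ^ 3 * ‖(δ : ℂ) + t * Complex.I‖ ^ 4 * ‖(δ : ℂ) + (2 * t : ℝ) * Complex.I‖) * _ :=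
            mul_le_mul (by gcongr; exact him t) hexp zero_le_one (by positivity)
        _ = _ := by ring
    rw [hqe] at hprod
    have : δ ^ 3 * |t| ^ 5 ≤ δ ^ 3 * Φ δ := by
      refine hprod.trans (le_of_eq ?_); simp only [Φ]; ring
    exact le_of_mul_le_mul_left this (by positivity)
  have hlim : Tendsto Φ (𝓝[>] 0) (𝓝 (Φ 0)) := hΦ.continuousAt.tendsto.mono_left nhdsWithin_le_nhds
  have := ge_of_tendsto hlim (eventually_nhdsWithin_of_forall key)
  simp only [Φ, zero_mul] at this
  have : 0 < |t| ^ 5 := by positivity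
  linarith

end DZ

namespace DZ
open NumberField Filter Topology

variable (K : Type) [Field K] [NumberField K]

instance : Countable (Ideal (𝓞 K)) := by
  have : Countable (𝓞 K) := (RingOfIntegers.basis K).equivFun.injective.countable
  exact Function.Surjective.countable (f := fun s : Finset (𝓞 K) => Ideal.span (s : Set (𝓞 K)))
    fun I => (IsNoetherian.noetherian I)
instance : Countable (NZ K) := Subtype.countable
instance : Countable (PP K) := Subtype.countable
lemma H_facts (hRH : DedekindZetaRH K) {H : ℂ → ℂ} (hH : Differentiable ℂ H) (h1 : H 1 ≠ 0)
    (hs : ∀ s : ℝ, 1 < s → H s = ((s - 1) * Real.exp (∑' i : PP K × ℕ, cc i * Real.exp (s * XX i)) : ℝ)) :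
    (∀ z : ℂ, 1 < z.re → H z = (z - 1) * Complex.exp (dF (XX (K := K)) cc z)) ∧ ∀ z : ℂ, 1 / 2 < z.re → H z ≠ 0 := by
  have hS := fun s hs => (sum_pairs K (s := s) hs).1
  have hC : ∀ i : PP K × ℕ, 0 ≤ cc i := fun i => (cc_pos i).le
  have hD := (dF_diff _ _ hS hC).1
  have hr : ∀ s : ℝ, 1 < s → dF (XX (K := K)) cc s = (∑' i : PP K × ℕ, cc i * Real.exp (s * XX i) : ℝ) := by
    intro s _; rw [dF]; push_cast; rfl
  have hF : ∀ z : ℂ, 1 < z.re → H z = (z - 1) * Complex.exp (dF (XX (K := K)) cc z) := by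
    refine ident hH.differentiableOn (by fun_prop) fun s h => ?_
    rw [hs s h, hr s h]; push_cast; rfl
  set XI : NZ K → ℝ := fun I => -Real.log (Ideal.absNorm I.1) with hXI
  have hpos : ∀ I : NZ K, (0 : ℝ) < Ideal.absNorm I.1 := fun I => by
    exact_mod_cast Nat.pos_of_ne_zero (fun h => I.2 (Ideal.absNorm_eq_zero_iff.1 h))
  have hSI : ∀ s : ℝ, 1 < s → (Summable fun I : NZ K => (1 : ℝ) * Real.exp (s * XI I)) ∧
      ∑' I : NZ K, (1 : ℝ) * Real.exp (s * XI I) = Real.exp (∑' i : PP K × ℕ, cc i * Real.exp (s * XX i)) := by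
    intro s h
    have hz := zet_eq K h
    have e : ∀ I : NZ K, (1 : ℝ) * Real.exp (s * XI I) = (Ideal.absNorm I.1 : ℝ) ^ (-s) := fun I => by
      rw [Real.rpow_def_of_pos (hpos I), hXI]; ring_nf
    simp_rw [e]
    have e2 : ∀ I : NZ K, (Ideal.absNorm I.1 : ℝ) ^ (-s) = (ENNReal.ofReal ((Ideal.absNorm I.1 : ℝ) ^ (-s))).toReal := fun I => by
      rw [ENNReal.toReal_ofReal (Real.rpow_nonneg (hpos I).le _)]
    rw [zet] at hz
    rw [funext e2]
    constructor
    · exact ENNReal.summable_toReal (by rw [hz]; exact ENNReal.ofReal_ne_top)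
    · rw [← ENNReal.tsum_toReal_eq (fun _ => ENNReal.ofReal_ne_top), hz, ENNReal.toReal_ofReal (Real.exp_pos _).le]
  have hDI := (dF_diff XI (fun _ => 1) (fun s h => (hSI s h).1) (fun _ => zero_le_one)).1
  have hG : ∀ z : ℂ, 1 < z.re → dF XI (fun _ => 1) z = Complex.exp (dF (XX (K := K)) cc z) := by
    refine ident hDI (by fun_prop) fun s h => ?_
    rw [hr s h, ← Complex.ofReal_exp, ← (hSI s h).2, dF]; push_cast; rfl
  refine ⟨hF, fun z hz h0 => ?_⟩
  rcases lt_trichotomy z.re 1 with h | h | h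
  · have := hRH (fun z => H z / (z - 1)) (hH.differentiableOn.div (by fun_prop) fun z hz => sub_ne_zero.2 hz) (fun s h => by
      have hne : s - 1 ≠ 0 := fun h' => by rw [sub_eq_zero.1 h'] at h; simp at h
      rw [hF s h, mul_div_cancel_left₀ _ hne, ← hG s h, dF]
      refine tsum_congr fun I => ?_
      have : (Ideal.absNorm I.1 : ℂ) ≠ 0 := by have := hpos I; exact_mod_cast this.ne'
      rw [Complex.cpow_def_of_ne_zero this, hXI, Complex.ofReal_one, one_mul]
      congr 1
      push_cast [Complex.natCast_log]
      ring) z (by simp [h0]) (by linarith) h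
    linarith
  · by_cases him : z.im = 0
    · exact h1 (by rw [← show z = 1 from Complex.ext h (by simpa using him)]; exact h0)
    · refine nv hS hC hH hF him ?_
      rw [← h0, ← Complex.re_add_im z, h]; simp
  · rw [hF z h] at h0
    rcases mul_eq_zero.1 h0 with h' | h'
    · rw [sub_eq_zero.1 h'] at h; simp at h
    · exact Complex.exp_ne_zero _ h'

lemma log_bound {H : ℂ → ℂ} (hH : Differentiable ℂ H) (hne : ∀ z : ℂ, 1 / 2 < z.re → H z ≠ 0) {B : ℝ} (hB : 0 < B)
    (hb : ∀ z ∈ Metric.closedBall (2 : ℂ) (3 / 2), ‖H z‖ ≤ Real.exp B) (h2 : 1 ≤ ‖H 2‖) (k : ℕ) :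
    ‖iteratedDeriv k (fun z => deriv H z / H z) 2‖ ≤ (k + 1).factorial * (10 * B) / (5 / 4) ^ (k + 1) := by
  have hbre : ∀ z ∈ Metric.ball (2 : ℂ) (3 / 2), 1 / 2 < z.re := fun z hz => by
    rw [Metric.mem_ball, dist_eq_norm] at hz
    have := (Complex.abs_re_le_norm (z - 2)).trans_lt hz
    simp only [Complex.sub_re, Complex.re_ofNat, abs_lt] at this
    linarith
  have hdH : Differentiable ℂ (deriv H) := fun z => (hH.analyticAt z).deriv.differentiableAt
  obtain ⟨g, hg2, hg⟩ := (DifferentiableOn.isExactOn_ball (f := fun z => deriv H z / H z) (c := 2) (r := 3 / 2)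
    (hdH.differentiableOn.div hH.differentiableOn fun z hz => hne z (hbre z hz))).with_val_at 2 0
  have hgd : DifferentiableOn ℂ g (Metric.ball 2 (3 / 2)) := fun z hz => (hg z hz).differentiableAt.differentiableWithinAt
  have h2m : (2 : ℂ) ∈ Metric.ball (2 : ℂ) (3 / 2) := by simp
  have hexp : ∀ z ∈ Metric.ball (2 : ℂ) (3 / 2), H z * Complex.exp (-g z) = H 2 := by
    intro z hz
    have := (convex_ball (2 : ℂ) (3 / 2)).is_const_of_fderivWithin_eq_zero (𝕜 := ℂ) (f := fun z => H z * Complex.exp (-g z))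
      (by fun_prop) (fun w hw => by
        have d : HasDerivAt (fun z => H z * Complex.exp (-g z)) 0 w := by
          convert! (hH w).hasDerivAt.mul ((hg w hw).neg.cexp) using 1
          have := hne w (hbre w hw)
          field_simp; ring
        rw [fderivWithin_eq_fderiv (Metric.isOpen_ball.uniqueDiffWithinAt hw) d.differentiableAt]
        ext; simp [d.deriv]) hz h2m
    simpa [hg2] using this
  have hre : ∀ z ∈ Metric.ball (2 : ℂ) (3 / 2), (g z).re ≤ B := by
    intro z hz
    have e := congrArg norm (hexp z hz)
    rw [norm_mul, Complex.norm_exp, Complex.neg_re] at e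
    have := hb z (Metric.ball_subset_closedBall hz)
    rw [← e] at h2
    have h3 : 1 ≤ Real.exp B * Real.exp (-(g z).re) := h2.trans (by gcongr)
    rw [← Real.exp_add, Real.one_le_exp_iff] at h3
    linarith
  have hsph : ∀ z ∈ Metric.sphere (2 : ℂ) (5 / 4), ‖g z‖ ≤ 10 * B := by
    intro z hz
    have hz' : ‖z - 2‖ = 5 / 4 := by rw [← dist_eq_norm]; exact hz
    have hm : ∀ w ∈ Metric.ball (0 : ℂ) (3 / 2), w + 2 ∈ Metric.ball (2 : ℂ) (3 / 2) := fun w hw => by simpa [dist_eq_norm] using hw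
    have := Complex.borelCaratheodory_zero (f := fun w => g (w + 2)) (z := z - 2) (R := 3 / 2) hB
      (hgd.comp (by fun_prop) hm) (fun w hw => hre _ (hm w hw)) (by norm_num) (by simp [hz']; norm_num) (by simp [hg2])
    rw [hz', sub_add_cancel] at this
    norm_num at this
    linarith
  have := Complex.norm_iteratedDeriv_le_of_forall_mem_sphere_norm_le (k + 1) (by norm_num)
    ((hgd.mono (Metric.closedBall_subset_ball (by norm_num))).diffContOnCl_ball (U := Metric.closedBall 2 (5/4)) subset_rfl) hsph
  rw [iteratedDeriv_succ'] at this
  refine (le_of_eq ?_).trans this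
  congr 1
  refine Filter.EventuallyEq.iteratedDeriv_eq k ?_
  filter_upwards [Metric.isOpen_ball.mem_nhds h2m] with z hz
  exact ((hg z hz).deriv).symm

theorem explicit (hRH : ∀ (K : Type) [Field K] [NumberField K], DedekindZetaRH K) :
    ∃ C1 : ℝ, 0 < C1 ∧ ∀ (K : Type) [Field K] [NumberField K] [IsTotallyReal K] (k : ℕ),
    (Summable fun i : PP K × ℕ => cc i * (-XX i) ^ (k + 1) * Real.exp (2 * XX i)) ∧
    |1 - (∑' i : PP K × ℕ, cc i * (-XX i) ^ (k + 1) * Real.exp (2 * XX i)) / k.factorial| ≤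
      C1 * (k + 1) * (Module.finrank ℚ K + Real.log |(discr K : ℝ)|) * (4 / 5) ^ k := by
  obtain ⟨C0, hC0, hcont⟩ := cont
  refine ⟨10 * C0, by positivity, fun K _ _ _ k => ?_⟩
  obtain ⟨H, hH, h1, hs, hb⟩ := hcont K
  obtain ⟨hF, hne⟩ := H_facts K (hRH K) hH h1 hs
  have hS := fun s hs => (sum_pairs K (s := s) hs).1
  have hC : ∀ i : PP K × ℕ, 0 ≤ cc i := fun i => (cc_pos i).le
  obtain ⟨hD, hk⟩ := dF_diff _ _ hS hC
  obtain ⟨hsum, hit⟩ := hk 2 (by norm_num) (k + 1)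
  have hsg : ∀ i : PP K × ℕ, cc i * (-XX i) ^ (k + 1) * Real.exp (2 * XX i) =
      (-1) ^ (k + 1) * (cc i * (XX i) ^ (k + 1) * Real.exp (2 * XX i)) := fun i => by rw [neg_pow]; ring
  refine ⟨(hsum.mul_left ((-1) ^ (k + 1))).congr fun i => (hsg i).symm, ?_⟩
  simp_rw [hsg]
  rw [tsum_mul_left]
  set S := ∑' i : PP K × ℕ, cc i * (XX i) ^ (k + 1) * Real.exp (2 * XX i)
  set B := C0 * (Module.finrank ℚ K + Real.log |(discr K : ℝ)|)
  have hBp : 0 < B := by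
    have hD1 : (1 : ℝ) ≤ |(discr K : ℝ)| := by
      have := Int.one_le_abs (discr_ne_zero K)
      exact_mod_cast this
    have : (0 : ℝ) < Module.finrank ℚ K := by exact_mod_cast Module.finrank_pos
    have := Real.log_nonneg hD1
    positivity
  have h2 : 1 ≤ ‖H 2‖ := by
    have := hs 2 (by norm_num)
    rw [show ((2 : ℝ) : ℂ) = 2 by norm_num] at this
    rw [this, Complex.norm_real, Real.norm_of_nonneg (by norm_num; positivity)]
    norm_num
    exact tsum_nonneg fun i => mul_nonneg (hC i) (Real.exp_pos _).le
  have hlb := log_bound hH hne hBp hb h2 k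
  have ho : IsOpen {z : ℂ | 1 < z.re} := isOpen_lt continuous_const Complex.continuous_re
  have hev : (fun z => deriv H z / H z) =ᶠ[𝓝 2] fun z => (z - 1)⁻¹ + deriv (dF (XX (K := K)) cc) z := by
    filter_upwards [ho.mem_nhds (show (2 : ℂ) ∈ {z : ℂ | 1 < z.re} by simp)] with z hz
    have hd : HasDerivAt H (1 * Complex.exp (dF (XX (K := K)) cc z) + (z - 1) * (Complex.exp (dF (XX (K := K)) cc z) *
        deriv (dF (XX (K := K)) cc) z)) z := by
      refine (((hasDerivAt_id z).sub_const 1).mul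
        ((hD.differentiableAt (ho.mem_nhds hz)).hasDerivAt.cexp)).congr_of_eventuallyEq ?_
      filter_upwards [ho.mem_nhds hz] with w hw
      exact hF w hw
    have hz1 : z - 1 ≠ 0 := fun h' => by rw [sub_eq_zero.1 h'] at hz; simp at hz
    rw [hd.deriv, hF z hz]
    have := Complex.exp_ne_zero (dF (XX (K := K)) cc z)
    field_simp
  have hA1 : ContDiffAt ℂ k (fun z : ℂ => (z - 1)⁻¹) 2 := by
    refine ContDiffAt.inv (by fun_prop) (by norm_num)
  have hA2 : ContDiffAt ℂ k (deriv (dF (XX (K := K)) cc)) 2 :=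
    ((hD.analyticAt (ho.mem_nhds (by simp))).deriv).contDiffAt
  have hinv : iteratedDeriv k (fun z : ℂ => (z - 1)⁻¹) 2 = (-1) ^ k * k.factorial := by
    rw [iteratedDeriv_comp_sub_const k (fun z : ℂ => z⁻¹) 1]
    have := iter_deriv_inv (𝕜 := ℂ) k 1
    rw [← iteratedDeriv_eq_iterate] at this
    norm_num at this ⊢
    exact this
  rw [hev.iteratedDeriv_eq k, iteratedDeriv_fun_add hA1 hA2, hinv, ← iteratedDeriv_succ',
    show (2 : ℂ) = ((2 : ℝ) : ℂ) by norm_num, hit] at hlb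
  rw [show ((-1) ^ k * k.factorial + (S : ℂ) : ℂ) = (((-1) ^ k * k.factorial + S : ℝ) : ℂ) by push_cast; rfl,
    Complex.norm_real, Real.norm_eq_abs] at hlb
  have hkf : (0 : ℝ) < k.factorial := by positivity
  have e1 : 1 - (-1) ^ (k + 1) * S / k.factorial = (-1) ^ k * ((-1) ^ k * k.factorial + S) / k.factorial := by
    have : ((-1 : ℝ) ^ k) * (-1) ^ k = 1 := by rw [← mul_pow]; norm_num
    field_simp
    linear_combination (- (k.factorial : ℝ)) * this
  rw [e1, abs_div, abs_mul, abs_pow, abs_neg, abs_one, one_pow, one_mul, abs_of_pos hkf, div_le_iff₀ hkf]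
  refine hlb.trans ?_
  rw [Nat.factorial_succ, div_eq_mul_inv, ← inv_pow, show ((5 : ℝ) / 4)⁻¹ = 4 / 5 by norm_num, pow_succ]
  push_cast
  have : (0 : ℝ) ≤ (k + 1) * k.factorial * (10 * B) * (4 / 5) ^ k := by positivity
  have e : 10 * C0 * (k + 1) * (Module.finrank ℚ K + Real.log |(discr K : ℝ)|) * (4 / 5) ^ k * k.factorial =
    (k + 1) * k.factorial * (10 * B) * (4 / 5) ^ k := by simp only [B]; ring
  rw [e]
  linarith

end DZ

namespace DZ
open NumberField Filter Topology

def vv (k : ℕ) (x : ℝ) : ℝ := x ^ (k + 1) * Real.exp (-(2 * x)) / k.factorial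
def wt (k p : ℕ) : ℝ := vv k (Real.log p)
def RR (k : ℕ) : Finset ℕ := {p ∈ Finset.range (⌊Real.exp (8 * k)⌋₊ + 1) | p.Prime ∧ (k : ℝ) / 10 < Real.log p}

lemma mem_RR {k p : ℕ} : p ∈ RR k ↔ p.Prime ∧ (k : ℝ) / 10 < Real.log p ∧ Real.log p ≤ 8 * k := by
  simp only [RR, mem_filter, mem_range, Nat.lt_succ_iff]
  constructor
  · rintro ⟨h, hp, h2⟩
    refine ⟨hp, h2, ?_⟩
    rw [Nat.le_floor_iff (Real.exp_pos _).le] at h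
    rwa [Real.log_le_iff_le_exp (by exact_mod_cast hp.pos)]
  · rintro ⟨hp, h2, h⟩
    refine ⟨?_, hp, h2⟩
    rw [Nat.le_floor_iff (Real.exp_pos _).le]
    rwa [Real.log_le_iff_le_exp (by exact_mod_cast hp.pos)] at h

lemma vv_nonneg (k : ℕ) {x : ℝ} (h : 0 ≤ x) : 0 ≤ vv k x := by unfold vv; positivity
lemma wt_nonneg (k p : ℕ) : 0 ≤ wt k p := vv_nonneg k (Real.log_natCast_nonneg p)

lemma vv_le (k : ℕ) {x a : ℝ} (h : 0 ≤ x) (ha : 0 < a) : vv k x ≤ (k + 1) * a⁻¹ ^ (k + 1) * Real.exp ((a - 2) * x) := by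
  have := Real.pow_div_factorial_le_exp _ (mul_nonneg ha.le h) (k + 1)
  rw [div_le_iff₀ (by positivity), Nat.factorial_succ, mul_pow] at this
  have e : Real.exp ((a - 2) * x) = Real.exp (a * x) * Real.exp (-(2 * x)) := by rw [← Real.exp_add]; ring_nf
  rw [vv, div_le_iff₀ (by positivity), e]
  calc x ^ (k + 1) * Real.exp (-(2 * x)) = a⁻¹ ^ (k + 1) * (a ^ (k + 1) * x ^ (k + 1)) * Real.exp (-(2 * x)) := by
        rw [inv_pow]; field_simp
    _ ≤ a⁻¹ ^ (k + 1) * (Real.exp (a * x) * ((k + 1) * k.factorial : ℝ)) * Real.exp (-(2 * x)) := by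
        push_cast at this; gcongr a⁻¹ ^ (k + 1) * ?_ * Real.exp _
    _ = _ := by ring

lemma exp_le_pow {r c y : ℝ} {k : ℕ} (h : Real.exp c ≤ r) (hy : y ≤ k * c) : Real.exp y ≤ r ^ k := by
  refine (Real.exp_le_exp.2 hy).trans ?_
  rw [Real.exp_nat_mul]; gcongr

lemma bad_term (k f j : ℕ) {L : ℝ} (hL : 0.69 ≤ L) (hf : f ≠ 0)
    (h : f * (j + 1) = 1 → ¬((k : ℝ) / 10 < L ∧ L ≤ 8 * k)) :
    vv k ((j + 1) * (f * L)) ≤ 8 * (k + 1) * (9 / 10) ^ k * (Real.exp (-(5 / 4) * L) * (3 / 4) ^ j) := by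
  set x : ℝ := (j + 1) * (f * L) with hx
  have hf1 : (1 : ℝ) ≤ f := by exact_mod_cast Nat.one_le_iff_ne_zero.2 hf
  have hj0 : (0 : ℝ) ≤ j := by positivity
  have hxj : (j + 1) * L ≤ x := by rw [hx]; nlinarith [mul_nonneg (sub_nonneg.2 hf1) (by linarith : (0:ℝ) ≤ L)]
  have hx0 : 0 ≤ x := le_trans (by positivity) hxj
  have e1 : Real.exp (-(1 / 2) * 0.69) ≤ 3 / 4 := by
    rw [neg_mul, Real.exp_neg, inv_le_comm₀ (Real.exp_pos _) (by norm_num)]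
    refine le_trans ?_ (Real.quadratic_le_exp_of_nonneg (by norm_num))
    norm_num
  have hexpj : ∀ y, y ≤ -(5 / 4) * L - j / 2 * L → Real.exp y ≤ Real.exp (-(5 / 4) * L) * (3 / 4) ^ j := fun y hy => by
    have : Real.exp (y + 5 / 4 * L) ≤ (3 / 4) ^ j := exp_le_pow e1 (by nlinarith)
    calc Real.exp y = Real.exp (-(5 / 4) * L) * Real.exp (y + 5 / 4 * L) := by rw [← Real.exp_add]; ring_nf
      _ ≤ _ := by gcongr
  have h5 := hexpj (-(5 / 4) * x) (by nlinarith)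
  have h0 : (0 : ℝ) ≤ Real.exp (-(5 / 4) * L) * (3 / 4) ^ j := by positivity
  by_cases ha : 8 * k < x
  · refine (vv_le k hx0 (a := 1 / 2) (by norm_num)).trans ?_
    have e2 : Real.exp (-2) ≤ 9 / 20 := by
      rw [Real.exp_neg, inv_le_comm₀ (Real.exp_pos _) (by norm_num)]
      linarith [Real.add_one_le_exp (2 : ℝ)]
    have e3 : Real.exp (-(1 / 4) * x) ≤ (9 / 20) ^ k := exp_le_pow e2 (by linarith)
    have e4 : Real.exp ((1 / 2 - 2) * x) = Real.exp (-(1 / 4) * x) * Real.exp (-(5 / 4) * x) := by rw [← Real.exp_add]; ring_nf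
    rw [e4]
    calc (k + 1) * (1 / 2 : ℝ)⁻¹ ^ (k + 1) * (Real.exp (-(1 / 4) * x) * Real.exp (-(5 / 4) * x))
        ≤ (k + 1) * (1 / 2 : ℝ)⁻¹ ^ (k + 1) * ((9 / 20) ^ k * (Real.exp (-(5 / 4) * L) * (3 / 4) ^ j)) := by gcongr
      _ = 2 * (k + 1) * ((2 * (9 / 20)) ^ k) * (Real.exp (-(5 / 4) * L) * (3 / 4) ^ j) := by
          rw [mul_pow, one_div, inv_inv, pow_succ]; ring
      _ ≤ _ := by norm_num; gcongr; norm_num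
  by_cases hb : x ≤ k / 10
  · refine (vv_le k hx0 (a := 4) (by norm_num)).trans ?_
    have e2 : Real.exp (13 / 40) ≤ 3 := by
      refine (Real.exp_le_exp.2 (by norm_num : (13 / 40 : ℝ) ≤ 1)).trans ?_
      linarith [Real.exp_one_lt_d9]
    have e3 : Real.exp (13 / 4 * x) ≤ 3 ^ k := exp_le_pow e2 (by linarith)
    have e4 : Real.exp ((4 - 2) * x) = Real.exp (13 / 4 * x) * Real.exp (-(5 / 4) * x) := by rw [← Real.exp_add]; ring_nf
    rw [e4]
    calc (k + 1) * (4 : ℝ)⁻¹ ^ (k + 1) * (Real.exp (13 / 4 * x) * Real.exp (-(5 / 4) * x))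
        ≤ (k + 1) * (4 : ℝ)⁻¹ ^ (k + 1) * (3 ^ k * (Real.exp (-(5 / 4) * L) * (3 / 4) ^ j)) := by gcongr
      _ = 1 / 4 * (k + 1) * ((3 / 4) ^ k) * (Real.exp (-(5 / 4) * L) * (3 / 4) ^ j) := by
          have : (3 / 4 : ℝ) ^ k = 3 ^ k / 4 ^ k := div_pow _ _ _
          rw [this, inv_pow, pow_succ]; field_simp
      _ ≤ _ := by
          have : (3 / 4 : ℝ) ^ k ≤ (9 / 10) ^ k := pow_le_pow_left₀ (by norm_num) (by norm_num) k
          gcongr; norm_num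
  have hfj : 2 ≤ f * (j + 1) := by
    have : 0 < f * (j + 1) := by positivity
    by_contra hh
    have h1 : f * (j + 1) = 1 := by omega
    have h2 := h h1
    have : x = L := by
      rw [hx]; have : (f : ℝ) * (j + 1) = 1 := by exact_mod_cast h1
      linear_combination L * this
    rw [this] at ha hb
    exact h2 ⟨not_le.1 hb, not_lt.1 ha⟩
  have hx2 : 2 * L ≤ x := by
    have : (2 : ℝ) ≤ f * (j + 1) := by exact_mod_cast hfj
    rw [hx]; nlinarith
  have e6 := hexpj ((9 / 8 - 2) * x) (by
    rcases Nat.eq_zero_or_pos j with rfl | hj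
    · norm_num; linarith
    · have : (1 : ℝ) ≤ j := by exact_mod_cast hj
      nlinarith)
  refine (vv_le k hx0 (a := 9 / 8) (by norm_num)).trans ?_
  calc (k + 1) * (9 / 8 : ℝ)⁻¹ ^ (k + 1) * Real.exp ((9 / 8 - 2) * x)
      ≤ (k + 1) * (8 * (9 / 10) ^ k) * (Real.exp (-(5 / 4) * L) * (3 / 4) ^ j) := by
        gcongr
        rw [pow_succ, mul_comm]
        gcongr <;> norm_num
    _ = _ := by ring

variable (K : Type) [Field K] [NumberField K]

lemma TK_fin (p : ℕ) : {P : PP K | N P.1 = p}.Finite :=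
  Set.Finite.preimage (f := fun P : PP K => P.1) (Subtype.val_injective.injOn) (Ideal.finite_setOfPred_absNorm_eq (S := 𝓞 K) p)

def TK (p : ℕ) : Finset (PP K) := (TK_fin K p).toFinset
lemma mem_TK {p : ℕ} {P : PP K} : P ∈ TK K p ↔ N P.1 = p := by simp [TK]
lemma TK_mem {p : ℕ} {P : PP K} (h : P ∈ TK K p) : (p : 𝓞 K) ∈ P.1 := by
  rw [← (mem_TK K).1 h]; exact Ideal.absNorm_mem P.1

lemma card_TK {p : ℕ} (hp : p.Prime) : #(TK K p) ≤ Module.finrank ℚ K := fib_card hp _ fun _ h => TK_mem K h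

lemma term_eq (k : ℕ) (P : PP K) (j : ℕ) : cc (P, j) * (-XX (P, j)) ^ (k + 1) * Real.exp (2 * XX (P, j)) / k.factorial =
    cc (P, j) * vv k ((j + 1) * Real.log (N P.1)) := by
  unfold vv XX; simp only [neg_neg, mul_neg]; ring

lemma log_ge {p : ℕ} (h : p.Prime) : 0.69 ≤ Real.log p := by
  have : Real.log 2 ≤ Real.log p := Real.log_le_log (by norm_num) (by exact_mod_cast h.two_le)
  linarith [Real.log_two_gt_d9]

lemma low1 (k : ℕ) (hs : Summable fun i : PP K × ℕ => cc i * (-XX i) ^ (k + 1) * Real.exp (2 * XX i)) :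
    (∑' i : PP K × ℕ, cc i * (-XX i) ^ (k + 1) * Real.exp (2 * XX i)) / k.factorial ≤
      ∑ p ∈ RR k, wt k p * #(TK K p) +
      32 * (k + 1) * (9 / 10) ^ k * (Module.finrank ℚ K * ∑' m : ℕ, ((m : ℝ) + 2) ^ (-(5 / 4) : ℝ)) := by
  classical
  obtain ⟨s1, s2⟩ := sum_aP' K pu (fun P => le_rfl) (s := 5 / 4) (by norm_num)
  have g : HasSum (fun j : ℕ => (3 / 4 : ℝ) ^ j) 4 := by
    have := hasSum_geometric_of_lt_one (r := 3 / 4) (by norm_num) (by norm_num)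
    norm_num at this ⊢; exact this
  have hu : Summable (fun i : PP K × ℕ => (pu i.1 : ℝ) ^ (-(5 / 4) : ℝ) * (3 / 4 : ℝ) ^ i.2) :=
    s1.mul_of_nonneg g.summable (fun _ => by positivity) (fun _ => by positivity)
  have hut : ∑' i : PP K × ℕ, (pu i.1 : ℝ) ^ (-(5 / 4) : ℝ) * (3 / 4 : ℝ) ^ i.2 =
      (∑' P : PP K, (pu P : ℝ) ^ (-(5 / 4) : ℝ)) * 4 := by
    have := s1.tsum_mul_tsum g.summable hu
    rw [g.tsum_eq] at this; exact this.symm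
  set G : Finset (PP K × ℕ) := (RR k).biUnion (TK K) ×ˢ {0} with hG
  have hpt : ∀ i : PP K × ℕ, cc i * (-XX i) ^ (k + 1) * Real.exp (2 * XX i) / k.factorial ≤
      8 * (k + 1) * (9 / 10) ^ k * ((pu i.1 : ℝ) ^ (-(5 / 4) : ℝ) * (3 / 4 : ℝ) ^ i.2) +
      (if i ∈ G then wt k (N i.1.1) else 0) := by
    rintro ⟨P, j⟩
    rw [term_eq]
    have hp := pu_prime P
    have hc : cc (P, j) ≤ 1 := by
      unfold cc; rw [div_le_one (by positivity)]; simp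
    have hv := vv_nonneg k (x := (j + 1) * Real.log (N P.1)) (mul_nonneg (by positivity) (Real.log_natCast_nonneg _))
    refine (mul_le_of_le_one_left hv hc).trans ?_
    obtain ⟨f, hf, hN⟩ := pu_pow P
    split_ifs with h
    · simp only [hG, mem_product, mem_singleton] at h
      have : vv k ((j + 1) * Real.log (N P.1)) = wt k (N P.1) := by rw [wt, h.2]; norm_num
      rw [this]
      have : (0 : ℝ) ≤ 8 * (k + 1) * (9 / 10) ^ k * ((pu P : ℝ) ^ (-(5 / 4) : ℝ) * (3 / 4 : ℝ) ^ j) := by positivity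
      linarith
    · have := bad_term k f j (L := Real.log (pu P)) (log_ge hp) hf (fun h1 h2 => by
        have hf1 : f = 1 := Nat.eq_one_of_mul_eq_one_right h1
        have hj : j = 0 := by rw [hf1] at h1; omega
        rw [hf1, pow_one] at hN
        apply h
        simp only [hG, mem_product, mem_singleton, mem_biUnion, mem_TK]
        exact ⟨⟨_, mem_RR.2 ⟨hp, h2⟩, hN⟩, hj⟩)
      rw [add_zero, hN]
      push_cast
      rw [Real.log_pow, Real.rpow_def_of_pos (by exact_mod_cast hp.pos), mul_comm (Real.log _)]
      exact this
  have hind : Summable fun i : PP K × ℕ => if i ∈ G then wt k (N i.1.1) else 0 :=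
    summable_of_ne_finset_zero (s := G) fun i hi => if_neg hi
  rw [← tsum_div_const]
  refine ((hs.div_const _).tsum_le_tsum hpt ((hu.mul_left _).add hind)).trans ?_
  rw [(hu.mul_left _).tsum_add hind, tsum_mul_left, hut, add_comm]
  refine add_le_add (le_of_eq ?_) ?_
  · rw [tsum_eq_sum (s := G) (fun i hi => if_neg hi), hG, sum_product]
    simp only [sum_singleton]
    rw [sum_biUnion]
    · refine sum_congr rfl fun p hp => ?_
      rw [mul_comm, ← nsmul_eq_mul]
      refine sum_eq_card_nsmul fun P hP => ?_
      rw [if_pos (by simp only [mem_product, mem_biUnion, mem_singleton, and_true]; exact ⟨p, hp, hP⟩), (mem_TK K).1 hP]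
    · intro p _ q _ hpq
      rw [Function.onFun, Finset.disjoint_left]
      intro P h1 h2
      exact hpq (((mem_TK K).1 h1).symm.trans ((mem_TK K).1 h2))
  · have : (0 : ℝ) ≤ 8 * (k + 1) * (9 / 10) ^ k := by positivity
    calc _ ≤ 8 * (k + 1) * (9 / 10) ^ k * ((Module.finrank ℚ K * ∑' m : ℕ, ((m : ℝ) + 2) ^ (-(5 / 4) : ℝ)) * 4) := by gcongr
      _ = _ := by ring

end DZ

namespace DZ
open NumberField Filter Topology

lemma card_dvd {M : ℕ} (hM : M ≠ 0) (k : ℕ) : (#{p ∈ RR k | p ∣ M} : ℝ) ≤ 2 * Real.log M := by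
  have h1 : 2 ^ #{p ∈ RR k | p ∣ M} ≤ M := by
    refine le_trans ?_ (Nat.le_of_dvd (Nat.pos_of_ne_zero hM) (Finset.prod_primes_dvd (s := {p ∈ RR k | p ∣ M}) M ?_ ?_))
    · exact Finset.pow_card_le_prod _ _ _ fun p hp => (mem_RR.1 (mem_filter.1 hp).1).1.two_le
    · exact fun p hp => (mem_RR.1 (mem_filter.1 hp).1).1.prime
    · exact fun p hp => (mem_filter.1 hp).2
  have h2 : ((2 : ℝ)) ^ #{p ∈ RR k | p ∣ M} ≤ M := by exact_mod_cast h1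
  have := Real.log_le_log (by positivity) h2
  rw [Real.log_pow] at this
  have h3 := Real.log_two_gt_d9
  have h4 : (0 : ℝ) ≤ #{p ∈ RR k | p ∣ M} := by positivity
  nlinarith

theorem lowB (hRH : ∀ (K : Type) [Field K] [NumberField K], DedekindZetaRH K) :
    ∃ C2 : ℝ, 0 < C2 ∧ (∀ (K : Type) [Field K] [NumberField K] [IsTotallyReal K] (k M : ℕ), M ≠ 0 →
      1 - C2 * (k + 1) * (Module.finrank ℚ K + Real.log |(discr K : ℝ)| + Module.finrank ℚ K * Real.log M) * Real.exp (-(k / 10)) ≤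
      ∑ p ∈ RR k with ¬ p ∣ M, wt k p * #(TK K p)) ∧
      ∀ k : ℕ, ∑ p ∈ RR k, wt k p ≤ 1 + C2 * (k + 1) * Real.exp (-(k / 10)) := by
  obtain ⟨C1, hC1, hex⟩ := explicit hRH
  set Z := ∑' m : ℕ, ((m : ℝ) + 2) ^ (-(5 / 4) : ℝ)
  have hZ : 0 ≤ Z := tsum_nonneg fun m => by positivity
  have hexp : ∀ k : ℕ, (9 / 10 : ℝ) ^ k ≤ Real.exp (-(k / 10)) := fun k => by
    have : (9 / 10 : ℝ) ≤ Real.exp (-(1 / 10)) := by linarith [Real.add_one_le_exp (-(1 / 10) : ℝ)]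
    refine (pow_le_pow_left₀ (by norm_num) this k).trans (le_of_eq ?_)
    rw [← Real.exp_nat_mul]; ring_nf
  have hexp2 : ∀ k : ℕ, (4 / 5 : ℝ) ^ k ≤ Real.exp (-(k / 10)) := fun k =>
    (pow_le_pow_left₀ (by norm_num) (by norm_num) k).trans (hexp k)
  refine ⟨C1 + 32 * Z + 2, by positivity, fun K _ _ _ k M hM => ?_, fun k => ?_⟩
  · obtain ⟨hs, h1⟩ := hex K k
    have h2 := low1 K k hs
    have h3 := (abs_le.1 h1).2
    set S := (∑' i : PP K × ℕ, cc i * (-XX i) ^ (k + 1) * Real.exp (2 * XX i)) / k.factorial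
    set n : ℝ := (Module.finrank ℚ K : ℝ)
    have hn : 0 ≤ n := Nat.cast_nonneg _
    set E := Real.exp (-(k / 10))
    have hE : 0 < E := Real.exp_pos _
    have hD : 0 ≤ Real.log |(discr K : ℝ)| := Real.log_nonneg (by
      have := Int.one_le_abs (discr_ne_zero K)
      exact_mod_cast this)
    have hM0 : 0 ≤ Real.log (M : ℝ) := Real.log_natCast_nonneg M
    have h4 : ∑ p ∈ RR k with p ∣ M, wt k p * #(TK K p) ≤ (2 * Real.log M) * ((k + 1) * E * n) := by
      refine (Finset.sum_le_card_nsmul _ _ ((k + 1) * E * n) fun p hp => ?_).trans ?_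
      · obtain ⟨hp1, hp2, hp3⟩ := mem_RR.1 (mem_filter.1 hp).1
        have := vv_le k (Real.log_natCast_nonneg p) zero_lt_one
        have hl : Real.exp ((1 - 2) * Real.log p) ≤ E := Real.exp_le_exp.2 (by linarith)
        have hw : wt k p ≤ (k + 1) * E := by
          refine this.trans ?_
          rw [inv_one, one_pow, mul_one]; gcongr
        have hc : (#(TK K p) : ℝ) ≤ n := Nat.cast_le.2 (card_TK K hp1)
        gcongr
      · rw [nsmul_eq_mul]
        gcongr
        exact card_dvd hM k
    rw [← Finset.sum_filter_add_sum_filter_not (RR k) (fun p => p ∣ M)] at h2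
    have h5 : 32 * (k + 1) * (9 / 10) ^ k * (n * Z) ≤ 32 * (k + 1) * E * (n * Z) := by gcongr; exact hexp k
    have h6 : C1 * (k + 1) * (n + Real.log |(discr K : ℝ)|) * (4 / 5) ^ k ≤ C1 * (k + 1) * (n + Real.log |(discr K : ℝ)|) * E := by
      gcongr; exact hexp2 k
    have hkE : 0 ≤ (k + 1) * E := by positivity
    have g1 : 0 ≤ (k + 1) * E * (C1 * (n * Real.log M)) := by positivity
    have g2 : 0 ≤ (k + 1) * E * (32 * Z * (Real.log |(discr K : ℝ)| + n * Real.log M)) := by positivity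
    have g3 : 0 ≤ (k + 1) * E * (2 * (n + Real.log |(discr K : ℝ)|)) := by positivity
    linarith
  · obtain ⟨hs, h1⟩ := hex ℚ k
    have h3 := (abs_le.1 h1).1
    rw [Module.finrank_self, Rat.numberField_discr] at h3
    have hNp : ∀ p : ℕ, p.Prime → N (Ideal.span {(p : 𝓞 ℚ)}) = p := fun p hp => by
      have := Ideal.absNorm_span_natCast (S := 𝓞 ℚ) p
      rw [N, this, RingOfIntegers.rank, Module.finrank_self, pow_one]
    have hex : ∀ p : ℕ, p.Prime → ∃ P : PP ℚ, N P.1 = p := fun p hp => by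
      refine ⟨⟨Ideal.span {(p : 𝓞 ℚ)}, Ideal.prime_of_isPrime ?_ ?_⟩, hNp p hp⟩
      · intro h
        have := hNp p hp
        rw [h, N, Ideal.absNorm_bot] at this
        exact hp.ne_zero this.symm
      · exact Ideal.isPrime_of_irreducible_absNorm (by
          have := hNp p hp
          rw [N] at this; rw [this]; exact hp)
    have hP0 : Nonempty (PP ℚ) := ⟨(hex 2 Nat.prime_two).choose⟩
    choose! F hF using hex
    have hle : ∑ p ∈ RR k, wt k p ≤
        ∑' i : PP ℚ × ℕ, cc i * (-XX i) ^ (k + 1) * Real.exp (2 * XX i) / k.factorial := by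
      have hinj : Set.InjOn (fun p => (F p, 0)) (RR k : Set ℕ) := fun p hp q hq h => by
        simp only [Prod.mk.injEq, and_true] at h
        rw [← hF p (mem_RR.1 hp).1, ← hF q (mem_RR.1 hq).1, h]
      classical
      refine le_trans (le_of_eq ?_) ((hs.div_const (k.factorial : ℝ)).sum_le_tsum ((RR k).image fun p => (F p, 0)) fun i _ => ?_)
      · rw [sum_image hinj]
        refine sum_congr rfl fun p hp => ?_
        rw [term_eq, hF p (mem_RR.1 hp).1, wt, cc]; norm_num
      · have := cc_pos i
        have := XX_nonpos i
        have : 0 ≤ -XX i := by linarith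
        positivity
    rw [tsum_div_const] at hle
    norm_num at h3
    have h6 : C1 * (k + 1) * (4 / 5) ^ k ≤ C1 * (k + 1) * Real.exp (-(k / 10)) := by gcongr; exact hexp2 k
    have g2 : 0 ≤ (k + 1) * Real.exp (-(k / 10)) * (32 * Z + 2) := by positivity
    linarith

end DZ

namespace DZ
open NumberField Polynomial

section pbs
variable {K : Type} [Field K] [NumberField K]

lemma exists_hom {p : ℕ} (hp : p.Prime) {P : PP K} (hP : P ∈ TK K p) :
    ∃ ψ : 𝓞 K →+* ZMod p, ∀ x, ψ x = 0 ↔ x ∈ P.1 := by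
  have h : Nat.card (𝓞 K ⧸ P.1) = p := by rw [← (mem_TK K).1 hP]; rfl
  haveI : Finite (𝓞 K ⧸ P.1) := Nat.finite_of_card_ne_zero (by rw [h]; exact hp.ne_zero)
  letI := Fintype.ofFinite (𝓞 K ⧸ P.1)
  let e := ZMod.ringEquivOfPrime (𝓞 K ⧸ P.1) hp (by rw [← Nat.card_eq_fintype_card, h])
  refine ⟨e.symm.toRingHom.comp (Ideal.Quotient.mk P.1), fun x => ?_⟩
  have : (e.symm.toRingHom.comp (Ideal.Quotient.mk P.1)) x = e.symm (Ideal.Quotient.mk P.1 x) := rfl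
  rw [this, map_eq_zero_iff _ e.symm.injective, Ideal.Quotient.eq_zero_iff_mem]

lemma exists_D (pb : PowerBasis ℚ K) (θ : 𝓞 K) (hθ : (θ : K) = pb.gen) :
    ∃ D : ℤ, (D : ℚ) = Algebra.discr ℚ pb.basis ∧ D ≠ 0 := by
  have h : IsIntegral ℤ (Algebra.discr ℚ pb.basis) := Algebra.discr_isIntegral ℚ fun i => by
    rw [pb.basis_eq_pow, ← hθ]; exact θ.isIntegral_coe.pow _
  obtain ⟨D, hD⟩ := IsIntegrallyClosed.isIntegral_iff.1 h
  refine ⟨D, hD, fun h0 => Algebra.discr_not_zero_of_basis ℚ pb.basis ?_⟩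
  rw [← hD, h0]; simp

lemma hom_aeval {R S : Type*} [CommRing R] [CommRing S] (ψ : R →+* S) (θ : R) (h : ℤ[X]) :
    ψ (aeval θ h) = eval₂ (Int.castRingHom S) (ψ θ) h := by
  rw [aeval_def, hom_eval₂]; congr 1; exact RingHom.ext_int _ _

lemma emb (pb : PowerBasis ℚ K) (θ : 𝓞 K) (hθ : (θ : K) = pb.gen) {D : ℤ} (hD : (D : ℚ) = Algebra.discr ℚ pb.basis)
    {p : ℕ} (hp : p.Prime) (hpD : ¬ (p : ℤ) ∣ D) :
    ∃ f : TK K p → ZMod p, Function.Injective f ∧ ∀ P, ∀ h : ℤ[X],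
      eval₂ (Int.castRingHom (ZMod p)) (f P) h = 0 ↔ aeval θ h ∈ P.1.1 := by
  haveI := Fact.mk hp
  choose ψ hψ using fun P : TK K p => exists_hom hp P.2
  refine ⟨fun P => ψ P θ, fun P Q hPQ => ?_, fun P h => ?_⟩
  · have key : ∀ x, ψ P x = ψ Q x := fun x => by
      have h1 := Algebra.discr_mul_isIntegral_mem_adjoin ℚ (B := pb) (hθ ▸ θ.isIntegral_coe) x.isIntegral_coe
      rw [Algebra.adjoin_singleton_eq_range_aeval] at h1
      obtain ⟨f, hf⟩ := h1
      have h2 : aeval θ f = (D : 𝓞 K) * x := by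
        apply RingOfIntegers.coe_injective
        have : (algebraMap (𝓞 K) K) (aeval θ f) = aeval pb.gen f := by
          rw [← hθ]; exact (aeval_algebraMap_apply K θ f).symm
        rw [this]
        refine hf.trans ?_
        rw [← hD, Algebra.smul_def]; simp
      have h3 : (D : ZMod p) * ψ P x = D * ψ Q x := by
        have e1 := congrArg (ψ P) h2
        have e2 := congrArg (ψ Q) h2
        rw [hom_aeval, map_mul, map_intCast] at e1 e2
        rw [← e1, ← e2]; congr 1
      exact mul_left_cancel₀ (fun h => hpD ((ZMod.intCast_zmod_eq_zero_iff_dvd _ _).1 h)) h3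
    refine Subtype.ext (Subtype.ext (Ideal.ext fun x => ?_))
    rw [← hψ P, ← hψ Q, key]
  · rw [← hψ P, hom_aeval]

lemma D_bound (pb : PowerBasis ℚ K) {n : ℕ} (hn : 1 ≤ n) (hd : pb.dim ≤ n) {D : ℤ} (hD : (D : ℚ) = Algebra.discr ℚ pb.basis)
    (hσ : ∀ σ : K →ₐ[ℚ] ℂ, ‖σ pb.gen‖ ≤ n) : |(D : ℝ)| ≤ (2 * n) ^ (2 * n ^ 2) := by
  classical
  have e : Fin pb.dim ≃ (K →ₐ[ℚ] ℂ) := (Fintype.equivFinOfCardEq (by rw [AlgHom.card, pb.finrank])).symm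
  have h := Algebra.discr_powerBasis_eq_prod ℚ ℂ pb e
  rw [← hD] at h
  have h1 : |(D : ℝ)| = ‖(algebraMap ℚ ℂ) D‖ := by simp
  have hn' : (1 : ℝ) ≤ n := by exact_mod_cast hn
  have h2 : (1 : ℝ) ≤ 2 * n := by linarith
  rw [h1, h, norm_prod]
  have hi : ∀ i, ‖∏ j ∈ Ioi i, ((e j) pb.gen - (e i) pb.gen) ^ 2‖ ≤ (2 * n : ℝ) ^ (2 * n) := fun i => by
    rw [norm_prod]
    have hf : ∀ j ∈ Ioi i, ‖((e j) pb.gen - (e i) pb.gen) ^ 2‖ ≤ (2 * n : ℝ) ^ 2 := fun j _ => by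
      rw [norm_pow]
      have := (norm_sub_le ((e j) pb.gen) ((e i) pb.gen)).trans (add_le_add (hσ _) (hσ _))
      gcongr; linarith
    refine (prod_le_prod (fun _ _ => norm_nonneg _) hf).trans ?_
    rw [prod_const, ← pow_mul]
    refine pow_le_pow_right₀ h2 (Nat.mul_le_mul_left 2 ((card_le_univ _).trans ?_))
    simpa using hd
  refine (prod_le_prod (fun _ _ => norm_nonneg _) fun i _ => hi i).trans ?_
  rw [prod_const, ← pow_mul]
  refine pow_le_pow_right₀ h2 ?_
  have : #(univ : Finset (Fin pb.dim)) ≤ n := by simpa using hd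
  nlinarith

lemma discr_le (pb : PowerBasis ℚ K) (θ : 𝓞 K) (hθ : (θ : K) = pb.gen) {D : ℤ} (hD : (D : ℚ) = Algebra.discr ℚ pb.basis)
    (hD0 : D ≠ 0) : |(discr K : ℝ)| ≤ |(D : ℝ)| := by
  classical
  have e : Module.Free.ChooseBasisIndex ℤ (𝓞 K) ≃ Fin pb.dim := Fintype.equivOfCardEq (by
    rw [← Module.finrank_eq_card_basis (integralBasis K), pb.finrank, Fintype.card_fin])
  let b := (integralBasis K).reindex e
  have h1 := Algebra.discr_of_matrix_vecMul b (b.toMatrix pb.basis)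
  rw [b.toMatrix_map_vecMul] at h1
  have h2 : Algebra.discr ℚ b = discr K := by
    rw [coe_discr, ← Algebra.discr_reindex ℚ (integralBasis K) e]
    congr 1
    ext; simp [b]
  let A : Matrix (Fin pb.dim) (Fin pb.dim) ℤ := fun i j => (RingOfIntegers.basis K).repr (θ ^ (j : ℕ)) (e.symm i)
  have h3 : b.toMatrix pb.basis = A.map (Int.castRingHom ℚ) := by
    ext i j
    rw [Module.Basis.toMatrix_apply, Module.Basis.repr_reindex_apply, pb.basis_eq_pow, ← hθ]
    exact integralBasis_repr_apply K (θ ^ (j : ℕ)) (e.symm i)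
  have h4 : (b.toMatrix pb.basis).det = (A.det : ℚ) := by
    rw [h3]; exact ((Int.castRingHom ℚ).map_det A).symm
  have h5 : D = A.det ^ 2 * discr K := by
    rw [← hD, h4, h2] at h1
    exact_mod_cast h1
  have h6 : A.det ≠ 0 := fun h => hD0 (by rw [h5, h]; simp)
  have h7 : |discr K| ≤ |D| := by
    rw [h5, abs_mul, abs_pow]
    have := Int.one_le_abs h6
    have := abs_nonneg (discr K)
    nlinarith [one_le_pow₀ (n := 2) (Int.one_le_abs h6)]
  exact_mod_cast h7

lemma mul_prod_bound {n : ℕ} (hn : 1 ≤ n) {a : ℂ} (ha : ‖a‖ ≤ n) (s : Multiset ℂ) :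
    (∀ z ∈ s, ‖z‖ ≤ n) → ‖(s.map fun z => a - z).prod‖ ≤ (2 * n : ℝ) ^ s.card := by
  induction s using Multiset.induction with
  | empty => simp
  | cons z s ih =>
    intro h
    rw [Multiset.map_cons, Multiset.prod_cons, norm_mul, Multiset.card_cons, pow_succ']
    have h1 := (norm_sub_le a z).trans (add_le_add ha (h z (Multiset.mem_cons_self z s)))
    have h2 := ih fun w hw => h w (Multiset.mem_cons_of_mem hw)
    gcongr; linarith

lemma norm_bound (θ : 𝓞 K) {n : ℕ} (hn : 1 ≤ n) (hd : Module.finrank ℚ K ≤ n) (hσ : ∀ σ : K →ₐ[ℚ] ℂ, ‖σ θ‖ ≤ n)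
    (h : ℤ[X]) (hm : h.Monic) (hdeg : h.natDegree ≤ n) (hroot : ∀ z : ℂ, aeval z h = 0 → ‖z‖ ≤ n) :
    |((Algebra.norm ℤ (aeval θ h) : ℤ) : ℝ)| ≤ (2 * n) ^ (2 * n ^ 2) := by
  have hn' : (1 : ℝ) ≤ n := by exact_mod_cast hn
  have h2 : (1 : ℝ) ≤ 2 * n := by linarith
  have h1 : |((Algebra.norm ℤ (aeval θ h) : ℤ) : ℝ)| = ‖(algebraMap ℚ ℂ) (Algebra.norm ℚ (aeval θ h : K))‖ := by
    rw [← Algebra.coe_norm_int]; simp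
  rw [h1, Algebra.norm_eq_prod_embeddings, norm_prod]
  have hi : ∀ σ : K →ₐ[ℚ] ℂ, ‖σ (aeval θ h : 𝓞 K)‖ ≤ (2 * n : ℝ) ^ n := fun σ => by
    have e1 : σ (aeval θ h : 𝓞 K) = eval (σ θ) (h.map (Int.castRingHom ℂ)) := by
      rw [eval_map]
      exact hom_aeval ((σ : K →+* ℂ).comp (algebraMap (𝓞 K) K)) θ h
    have hm' := hm.map (Int.castRingHom ℂ)
    rw [e1, (IsAlgClosed.splits (h.map (Int.castRingHom ℂ))).eval_eq_prod_roots_of_monic hm']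
    refine (mul_prod_bound hn (hσ σ) _ fun z hz => hroot z ?_).trans (pow_le_pow_right₀ h2 ?_)
    · have := (mem_roots'.1 hz).2
      rwa [IsRoot, eval_map, ← RingHom.ext_int (algebraMap ℤ ℂ) (Int.castRingHom ℂ)] at this
    · exact (card_roots' _).trans ((natDegree_map_le).trans hdeg)
  refine (prod_le_prod (fun _ _ => norm_nonneg _) fun σ _ => hi σ).trans ?_
  rw [prod_const, ← pow_mul]
  refine pow_le_pow_right₀ h2 ?_
  have : #(univ : Finset (K →ₐ[ℚ] ℂ)) ≤ n := by rw [card_univ, AlgHom.card]; exact hd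
  nlinarith
end pbs
end DZ

namespace DZ
open NumberField Polynomial

def Good (n : ℕ) (g : ℤ[X]) : Prop := g.Monic ∧ g.natDegree ≤ n ∧ ∀ z : ℂ, aeval z g = 0 → z.im = 0 ∧ ‖z‖ ≤ n

lemma log_bd {n : ℕ} (hn : 1 ≤ n) {x : ℝ} (hx : |x| ≤ (2 * n) ^ (2 * n ^ 2)) : Real.log |x| ≤ 4 * n ^ 3 := by
  have hn' : (1 : ℝ) ≤ n := by exact_mod_cast hn
  rcases eq_or_ne x 0 with rfl | h0
  · simp
  refine (Real.log_le_log (abs_pos.2 h0) hx).trans ?_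
  rw [Real.log_pow]; push_cast
  have := Real.log_le_sub_one_of_pos (by linarith : (0 : ℝ) < 2 * n)
  nlinarith [sq_nonneg (n : ℝ)]

lemma exists_pb {n : ℕ} {g : ℤ[X]} (hg : Good n g) (hirr : Irreducible g) :
    ∃ (K : Type) (_ : Field K) (_ : NumberField K) (pb : PowerBasis ℚ K), pb.dim ≤ n ∧
      ∀ h : ℤ[X], eval₂ (Int.castRingHom K) pb.gen h = 0 ↔ g ∣ h := by
  set G : ℚ[X] := g.map (algebraMap ℤ ℚ) with hG
  have hGi : Irreducible G := (hg.1.irreducible_iff_irreducible_map_fraction_map).1 hirr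
  haveI := Fact.mk hGi
  have key : ∀ i : Algebra ℚ (AdjoinRoot G), ∃ pb : @PowerBasis ℚ (AdjoinRoot G) _ _ i, pb.dim ≤ n ∧
      ∀ h : ℤ[X], eval₂ (Int.castRingHom (AdjoinRoot G)) pb.gen h = 0 ↔ g ∣ h := fun i => by
    obtain rfl : i = AdjoinRoot.instAlgebra G := Subsingleton.elim _ _
    refine ⟨AdjoinRoot.powerBasis hGi.ne_zero, ?_, fun h => ?_⟩
    · rw [AdjoinRoot.powerBasis_dim, hG, natDegree_map_eq_of_injective (IsFractionRing.injective ℤ ℚ)]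
      exact hg.2.1
    · rw [← map_dvd_map (algebraMap ℤ ℚ) (IsFractionRing.injective ℤ ℚ) hg.1, ← hG, ← AdjoinRoot.mk_eq_zero,
        AdjoinRoot.powerBasis_gen, ← AdjoinRoot.aeval_eq, aeval_def, eval₂_map]
      exact Iff.of_eq (by congr 2)
  exact ⟨AdjoinRoot G, inferInstance, inferInstance, key _⟩

lemma pack {n : ℕ} (hn : 1 ≤ n) {g : ℤ[X]} (hg : Good n g) (hirr : Irreducible g) :
    ∃ (K : Type) (_ : Field K) (_ : NumberField K) (_ : IsTotallyReal K) (θ : 𝓞 K) (D : ℕ), D ≠ 0 ∧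
      Module.finrank ℚ K ≤ n ∧ Real.log |(discr K : ℝ)| ≤ 4 * n ^ 3 ∧ Real.log D ≤ 4 * n ^ 3 ∧
      (∀ h : ℤ[X], aeval θ h = 0 ↔ g ∣ h) ∧
      (∀ p : ℕ, p.Prime → ¬ p ∣ D → ∃ f : TK K p → ZMod p, Function.Injective f ∧ ∀ P, ∀ h : ℤ[X],
        eval₂ (Int.castRingHom (ZMod p)) (f P) h = 0 ↔ aeval θ h ∈ P.1.1) ∧
      ∀ h : ℤ[X], Good n h → Real.log |((Algebra.norm ℤ (aeval θ h) : ℤ) : ℝ)| ≤ 4 * n ^ 3 := by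
  obtain ⟨K, _, _, pb, hdim, hdvd⟩ := exists_pb hg hirr
  have h0 : eval₂ (Int.castRingHom K) pb.gen g = 0 := (hdvd g).2 dvd_rfl
  have hσ : ∀ σ : K →+* ℂ, (σ pb.gen).im = 0 ∧ ‖σ pb.gen‖ ≤ n := fun σ => hg.2.2 _ (by
    have := hom_eval₂ g (Int.castRingHom K) σ pb.gen
    rw [h0, map_zero] at this
    rw [aeval_def, this]; congr 1; exact RingHom.ext_int _ _)
  haveI : IsTotallyReal K := ⟨fun v => by
    rw [InfinitePlace.isReal_iff, ComplexEmbedding.isReal_iff]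
    have : ((ComplexEmbedding.conjugate v.embedding).toRatAlgHom) = v.embedding.toRatAlgHom := pb.algHom_ext (by
      exact Complex.conj_eq_iff_im.2 (hσ v.embedding).1)
    ext x
    exact DFunLike.congr_fun this x⟩
  let θ : 𝓞 K := ⟨pb.gen, ⟨g, hg.1, h0⟩⟩
  have hθ : (θ : K) = pb.gen := rfl
  obtain ⟨D, hD, hD0⟩ := exists_D pb θ hθ
  have hb := D_bound pb hn hdim hD fun σ => (hσ σ).2
  have hfr : Module.finrank ℚ K ≤ n := by rw [pb.finrank]; exact hdim
  refine ⟨K, inferInstance, inferInstance, inferInstance, θ, D.natAbs, Int.natAbs_ne_zero.2 hD0, hfr,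
    log_bd hn ((discr_le pb θ hθ hD hD0).trans hb), ?_, fun h => ?_, fun p hp hpD => ?_, fun h hh => ?_⟩
  · rw [Nat.cast_natAbs, Int.cast_abs]; exact log_bd hn hb
  · rw [← hdvd, ← hθ]
    have : (algebraMap (𝓞 K) K) (aeval θ h) = aeval (θ : K) h := (aeval_algebraMap_apply K θ h).symm
    rw [show eval₂ (Int.castRingHom K) (θ : K) h = aeval (θ : K) h from rfl, ← this]
    exact (map_eq_zero_iff _ RingOfIntegers.coe_injective).symm
  · exact emb pb θ hθ hD hp fun h => hpD (Int.natCast_dvd.1 h)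
  · exact log_bd hn (norm_bound θ hn hfr (fun σ => (hσ σ).2) h hh.1 hh.2.1 fun z hz => (hh.2.2 z hz).2)

def nr (p : ℕ) (φ : ℤ[X]) : ℕ := Set.ncard {x : ZMod p | eval₂ (Int.castRingHom (ZMod p)) x φ = 0}

def Two (φ : ℤ[X]) : Prop := ∃ g h : ℤ[X], g.Monic ∧ h.Monic ∧ Irreducible g ∧ Irreducible h ∧ g ≠ h ∧ g ∣ φ ∧ h ∣ φ

lemma Good.dvd {n : ℕ} {φ g : ℤ[X]} (h : Good n φ) (hg : g.Monic) (hd : g ∣ φ) : Good n g := by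
  refine ⟨hg, (natDegree_le_of_dvd hd h.1.ne_zero).trans h.2.1, fun z hz => h.2.2 z ?_⟩
  obtain ⟨q, rfl⟩ := hd
  rw [map_mul, hz, zero_mul]

theorem roots_low (hRH : ∀ (K : Type) [Field K] [NumberField K], DedekindZetaRH K) :
    ∃ C : ℝ, 0 < C ∧ (∀ (n k : ℕ) (φ : ℤ[X]), 1 ≤ n → Good n φ →
      ((∃ g : ℤ[X], g.Monic ∧ Irreducible g ∧ g ∣ φ) → 1 - C * (k + 1) * n ^ 4 * Real.exp (-(k / 10)) ≤ ∑ p ∈ RR k, wt k p * nr p φ) ∧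
      (Two φ → 2 * (1 - C * (k + 1) * n ^ 4 * Real.exp (-(k / 10))) ≤ ∑ p ∈ RR k, wt k p * nr p φ)) ∧
      ∀ k : ℕ, ∑ p ∈ RR k, wt k p ≤ 1 + C * (k + 1) * Real.exp (-(k / 10)) := by
  obtain ⟨C, hC, hlow, hup⟩ := lowB hRH
  have hfin : ∀ p : ℕ, p.Prime → ∀ φ : ℤ[X], {x : ZMod p | eval₂ (Int.castRingHom (ZMod p)) x φ = 0}.Finite := fun p hp φ => by
    haveI := Fact.mk hp
    exact Set.toFinite _
  have hev : ∀ (p : ℕ) (g φ : ℤ[X]) (x : ZMod p), g ∣ φ → eval₂ (Int.castRingHom (ZMod p)) x g = 0 →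
      eval₂ (Int.castRingHom (ZMod p)) x φ = 0 := fun p g φ x ⟨q, hq⟩ h => by
    rw [hq, eval₂_mul, h, zero_mul]
  have hlow2 : ∀ (n : ℕ) (K : Type) [Field K] [NumberField K] [IsTotallyReal K] (k M : ℕ), M ≠ 0 → 1 ≤ n → Module.finrank ℚ K ≤ n →
      Real.log |(discr K : ℝ)| ≤ 4 * n ^ 3 → Real.log M ≤ 12 * n ^ 3 → 1 - (17 * C) * (k + 1) * n ^ 4 * Real.exp (-(k / 10)) ≤
      ∑ p ∈ RR k with ¬ p ∣ M, wt k p * #(TK K p) := by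
    intro n K _ _ _ k M hM hn hf hd hl
    refine le_trans ?_ (hlow K k M hM)
    have hn' : (1 : ℝ) ≤ n := by exact_mod_cast hn
    have hf' : (Module.finrank ℚ K : ℝ) ≤ n := by exact_mod_cast hf
    have hM0 : 0 ≤ Real.log (M : ℝ) := Real.log_natCast_nonneg M
    have h1 : (Module.finrank ℚ K : ℝ) * Real.log M ≤ n * (12 * n ^ 3) := by gcongr
    have h2 : (Module.finrank ℚ K + Real.log |(discr K : ℝ)| + Module.finrank ℚ K * Real.log M) ≤ 17 * n ^ 4 := by
      have a1 : (n : ℝ) ≤ n ^ 4 := le_self_pow₀ hn' (by norm_num)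
      have a2 : (n : ℝ) ^ 3 ≤ n ^ 4 := pow_le_pow_right₀ hn' (by norm_num)
      nlinarith
    have := mul_le_mul_of_nonneg_left h2 (by positivity : 0 ≤ C * (k + 1) * Real.exp (-(k / 10)))
    nlinarith
  refine ⟨17 * C, by positivity, fun n k φ hn hφ => ⟨?_, ?_⟩, fun k => ?_⟩
  · rintro ⟨g, hgm, hgi, hgd⟩
    obtain ⟨K, _, _, _, θ, D, hD0, hfr, hdisc, hDl, hdvd, hemb, -⟩ := pack hn (hφ.dvd hgm hgd) hgi
    refine (hlow2 n K k D hD0 hn hfr hdisc (hDl.trans (by gcongr; norm_num))).trans ?_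
    refine (sum_le_sum fun p hp => ?_).trans (sum_le_sum_of_subset_of_nonneg (filter_subset _ _) fun p _ _ => mul_nonneg (wt_nonneg k p) (Nat.cast_nonneg _))
    rw [mem_filter] at hp
    have hpp := (mem_RR.1 hp.1).1
    obtain ⟨f, hf, hfr⟩ := hemb p hpp hp.2
    refine mul_le_mul_of_nonneg_left (Nat.cast_le.2 ?_) (wt_nonneg k p)
    rw [nr, ← Fintype.card_coe, ← Nat.card_eq_fintype_card, ← Set.ncard_range_of_injective hf]
    refine Set.ncard_le_ncard ?_ (hfin p hpp φ)
    rintro _ ⟨P, rfl⟩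
    exact hev p g φ _ hgd ((hfr P g).2 (by rw [(hdvd g).2 dvd_rfl]; exact zero_mem _))
  · rintro ⟨g, h, hgm, hhm, hgi, hhi, hne, hgd, hhd⟩
    obtain ⟨K, _, _, _, θ, D, hD0, hfr, hdisc, hDl, hdvd, hemb, hno⟩ := pack hn (hφ.dvd hgm hgd) hgi
    obtain ⟨K', _, _, _, θ', D', hD0', hfr', hdisc', hDl', hdvd', hemb', -⟩ := pack hn (hφ.dvd hhm hhd) hhi
    have hnd : ¬ g ∣ h := fun hd => hne (eq_of_monic_of_associated hgm hhm (hgi.associated_of_dvd hhi hd))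
    set R := (Algebra.norm ℤ (aeval θ h)).natAbs with hR
    have hR0 : R ≠ 0 := by
      rw [hR, Int.natAbs_ne_zero, Algebra.norm_ne_zero_iff]
      exact fun h0 => hnd ((hdvd h).1 h0)
    have hRl : Real.log R ≤ 4 * n ^ 3 := by
      rw [hR, Nat.cast_natAbs, Int.cast_abs]; exact hno h (hφ.dvd hhm hhd)
    set M := D * D' * R with hM
    have hM0 : M ≠ 0 := mul_ne_zero (mul_ne_zero hD0 hD0') hR0
    have hMl : Real.log M ≤ 12 * n ^ 3 := by
      rw [hM]; push_cast
      rw [Real.log_mul (by positivity) (by positivity), Real.log_mul (by positivity) (by positivity)]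
      linarith
    have e1 := hlow2 n K k M hM0 hn hfr hdisc hMl
    have e2 := hlow2 n K' k M hM0 hn hfr' hdisc' hMl
    rw [two_mul]
    refine (add_le_add e1 e2).trans ?_
    rw [← sum_add_distrib]
    refine (sum_le_sum fun p hp => ?_).trans (sum_le_sum_of_subset_of_nonneg (filter_subset _ _) fun p _ _ => mul_nonneg (wt_nonneg k p) (Nat.cast_nonneg _))
    rw [mem_filter] at hp
    have hpp := (mem_RR.1 hp.1).1
    obtain ⟨f, hf, hfr⟩ := hemb p hpp fun h => hp.2 ((h.mul_right _).mul_right _)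
    obtain ⟨f', hf', hfr'⟩ := hemb' p hpp fun h => hp.2 ((h.mul_left _).mul_right _)
    rw [← mul_add, ← Nat.cast_add]
    refine mul_le_mul_of_nonneg_left (Nat.cast_le.2 ?_) (wt_nonneg k p)
    have hh0 : ∀ P, eval₂ (Int.castRingHom (ZMod p)) (f' P) h = 0 := fun P =>
      (hfr' P h).2 (by rw [(hdvd' h).2 dvd_rfl]; exact zero_mem _)
    have hdis : Disjoint (Set.range f) (Set.range f') := by
      rw [Set.disjoint_left]
      rintro _ ⟨P, rfl⟩ ⟨Q, hQ⟩
      have h1 := (hfr P h).1 (by rw [← hQ]; exact hh0 Q)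
      have h2 := Ideal.absNorm_dvd_absNorm_of_le ((Ideal.span_singleton_le_iff_mem _).2 h1)
      rw [Ideal.absNorm_span_singleton, show Ideal.absNorm P.1.1 = p from (mem_TK K).1 P.2] at h2
      exact hp.2 (h2.mul_left _)
    rw [nr, ← Fintype.card_coe, ← Nat.card_eq_fintype_card, ← Set.ncard_range_of_injective hf, ← Fintype.card_coe,
      ← Nat.card_eq_fintype_card, ← Set.ncard_range_of_injective hf',
      ← Set.ncard_union_eq hdis (Set.finite_range f) (Set.finite_range f')]
    refine Set.ncard_le_ncard ?_ (hfin p hpp φ)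
    rintro _ (⟨P, rfl⟩ | ⟨P, rfl⟩)
    · exact hev p g φ _ hgd ((hfr P g).2 (by rw [(hdvd g).2 dvd_rfl]; exact zero_mem _))
    · exact hev p h φ _ hhd (hh0 P)
  · refine (hup k).trans ?_
    gcongr; linarith
end DZ

namespace FN
open Polynomial DZ

def ph {n : ℕ} (ω : Fin n → Fin n → Bool) : ℤ[X] := (symMat ℤ ω).charpoly

lemma symMat_map (R : Type*) [CommRing R] {n : ℕ} (ω : Fin n → Fin n → Bool) :
    (symMat ℤ ω).map (Int.castRingHom R) = symMat R ω := by
  ext i j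
  simp only [symMat, Matrix.map_apply, Matrix.of_apply, signb]
  split_ifs <;> simp

lemma ph_map (R : Type*) [CommRing R] {n : ℕ} (ω : Fin n → Fin n → Bool) :
    (ph ω).map (Int.castRingHom R) = (symMat R ω).charpoly := by
  rw [ph, ← Matrix.charpoly_map, symMat_map]

lemma herm (𝕜 : Type*) [RCLike 𝕜] {n : ℕ} (ω : Fin n → Fin n → Bool) : (symMat 𝕜 ω).IsHermitian := by
  ext i j
  simp only [symMat, Matrix.conjTranspose_apply, Matrix.of_apply, signb, min_comm j i, max_comm j i]
  split_ifs <;> simp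

lemma ph_monic {n : ℕ} (ω : Fin n → Fin n → Bool) : (ph ω).Monic := Matrix.charpoly_monic _
lemma ph_deg {n : ℕ} (ω : Fin n → Fin n → Bool) : (ph ω).natDegree = n := by
  rw [ph, Matrix.charpoly_natDegree_eq_dim, Fintype.card_fin]

lemma ph_good {n : ℕ} (ω : Fin n → Fin n → Bool) : Good n (ph ω) := by
  refine ⟨ph_monic ω, (ph_deg ω).le, fun z hz => ?_⟩
  have h1 : (symMat ℂ ω).charpoly.IsRoot z := by
    rw [← ph_map, IsRoot, eval_map]; exact hz
  constructor
  · rw [(herm ℂ ω).charpoly_eq, IsRoot, eval_prod, prod_eq_zero_iff] at h1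
    obtain ⟨i, -, hi⟩ := h1
    rw [eval_sub, eval_X, eval_C, sub_eq_zero] at hi
    rw [hi]; exact Complex.ofReal_im _
  · rw [← Matrix.charpoly_toLin', ← Module.End.hasEigenvalue_iff_isRoot_charpoly] at h1
    obtain ⟨i, hi⟩ := eigenvalue_mem_ball h1
    have hs : ∀ j, ‖symMat ℂ ω i j‖ = 1 := fun j => by
      simp only [symMat, Matrix.of_apply, signb]; split_ifs <;> simp
    simp only [hs] at hi
    rw [mem_closedBall_iff_norm] at hi
    have h2 := norm_le_norm_add_norm_sub' z (symMat ℂ ω i i)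
    rw [hs] at h2
    have h3 : ∑ j ∈ univ.erase i, (1 : ℝ) = n - 1 := by
      rw [sum_const, card_erase_of_mem (mem_univ i), card_univ, Fintype.card_fin, nsmul_eq_mul, mul_one,
        Nat.cast_sub (by have := i.2; omega)]; simp
    linarith

lemma exists_fac {q : ℤ[X]} (hq : q.Monic) (h1 : q.natDegree ≠ 0) : ∃ g : ℤ[X], g.Monic ∧ Irreducible g ∧ g ∣ q := by
  obtain ⟨g, hg, r, hr⟩ := WfDvdMonoid.exists_irreducible_factor (a := q)
    (fun h => h1 (natDegree_eq_zero_of_isUnit h)) hq.ne_zero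
  have hu : g.leadingCoeff * r.leadingCoeff = 1 := by rw [← leadingCoeff_mul, ← hr]; exact hq
  have hu' : IsUnit (C r.leadingCoeff) := (IsUnit.of_mul_eq_one _ (by rw [mul_comm]; exact hu)).map C
  have ha : Associated g (C r.leadingCoeff * g) := by
    rw [mul_comm]; exact (associated_mul_unit_right g _ hu')
  refine ⟨C r.leadingCoeff * g, ?_, ha.irreducible_iff.1 hg, ha.symm.dvd.trans ⟨r, hr⟩⟩
  rw [Monic, leadingCoeff_mul, leadingCoeff_C, mul_comm]; exact hu

lemma one_lt_deg {g : ℤ[X]} (hg : g.Monic) (hi : Irreducible g) : g.natDegree ≠ 0 := fun h =>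
  hi.not_isUnit (by rw [hg.natDegree_eq_zero.1 h]; exact isUnit_one)

lemma exists_pow {φ : ℤ[X]} (hφ : φ.Monic) (h2 : ¬ Two φ) {g : ℤ[X]} (hg : g.Monic) (hi : Irreducible g) (hd : g ∣ φ) :
    ∃ m, φ = g ^ m := by
  obtain ⟨q, hq, hnd⟩ := (finiteMultiplicity_of_degree_pos_of_monic
    (natDegree_pos_iff_degree_pos.1 (Nat.pos_of_ne_zero (one_lt_deg hg hi))) hg hφ.ne_zero).exists_eq_pow_mul_and_not_dvd
  have hqm : q.Monic := (hg.pow _).of_mul_monic_left (hq ▸ hφ)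
  by_cases h0 : q.natDegree = 0
  · rw [hqm.natDegree_eq_zero.1 h0, mul_one] at hq
    exact ⟨_, hq⟩
  · obtain ⟨h, hm, hhi, hhd⟩ := exists_fac hqm h0
    exact absurd ⟨g, h, hg, hm, hi, hhi, fun e => hnd (e ▸ hhd), hd, hhd.trans ⟨_, hq.trans (mul_comm _ _)⟩⟩ h2

def res {N : ℕ} (ω : Fin (N + 1) → Fin (N + 1) → Bool) : Fin N → Fin N → Bool := fun i j => ω i.succ j.succ

lemma res_root {N : ℕ} (ω : Fin (N + 1) → Fin (N + 1) → Bool) {lam : ℝ}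
    (h : (X - C lam) ^ 2 ∣ (symMat ℝ ω).charpoly) : (symMat ℝ (res ω)).charpoly.IsRoot lam := by
  have hA := herm ℝ ω
  have hc : 2 ≤ (symMat ℝ ω).charpoly.roots.count lam := by
    rw [count_roots]
    exact (le_rootMultiplicity_iff (Matrix.charpoly_monic _).ne_zero).2 h
  rw [hA.roots_charpoly_eq_eigenvalues, Multiset.count_map] at hc
  have hc' : 1 < #{i | lam = hA.eigenvalues i} := hc
  obtain ⟨i, hi, j, hj, hij⟩ := one_lt_card.1 hc'
  rw [mem_filter] at hi hj
  have hv := fun i => hA.mulVec_eigenvectorBasis i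
  set v := hA.eigenvectorBasis
  have hw : ∃ w : Fin (N + 1) → ℝ, w ≠ 0 ∧ w 0 = 0 ∧ (symMat ℝ ω).mulVec w = lam • w := by
    by_cases h0 : (v i) 0 = 0
    · refine ⟨(v i).ofLp, fun h => ?_, h0, ?_⟩
      · exact v.orthonormal.ne_zero i (WithLp.ofLp_injective 2 h)
      · rw [hv i, ← hi.2]
    · refine ⟨(v j) 0 • (v i).ofLp - (v i) 0 • (v j).ofLp, fun h => ?_, ?_, ?_⟩
      · have h' : (v j) 0 • v i - (v i) 0 • v j = 0 := WithLp.ofLp_injective 2 h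
        have := congrArg (inner ℝ (v j)) h'
        rw [inner_sub_right, inner_smul_right, inner_smul_right, v.orthonormal.2 hij.symm, inner_zero_right,
          real_inner_self_eq_norm_sq, v.orthonormal.1] at this
        apply h0; linarith
      · simp; ring
      · rw [Matrix.mulVec_sub, Matrix.mulVec_smul, Matrix.mulVec_smul, hv i, hv j, ← hi.2, ← hj.2, smul_sub,
          smul_comm lam, smul_comm lam]
  obtain ⟨w, hw0, hw1, hw2⟩ := hw
  rw [IsRoot, Matrix.eval_charpoly, ← Matrix.exists_mulVec_eq_zero_iff]
  refine ⟨fun i => w i.succ, fun h => hw0 (funext fun i => ?_), ?_⟩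
  · refine Fin.cases hw1 (fun i => congrFun h i) i
  · ext i
    have h3 := congrFun hw2 i.succ
    rw [Matrix.mulVec, dotProduct, Fin.sum_univ_succ, hw1, mul_zero, zero_add] at h3
    rw [Matrix.sub_mulVec, Pi.sub_apply, Matrix.scalar_apply, Matrix.mulVec_diagonal, Pi.zero_apply, sub_eq_zero]
    refine h3.symm.trans ?_
    rw [Matrix.mulVec, dotProduct]
    refine sum_congr rfl fun j _ => ?_
    simp only [symMat, Matrix.of_apply, res]
    have h4 : min i.succ j.succ = (min i j).succ := (Fin.strictMono_succ.monotone.map_min).symm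
    have h5 : max i.succ j.succ = (max i j).succ := (Fin.strictMono_succ.monotone.map_max).symm
    rw [h4, h5]

lemma scal {n : ℕ} (hn : 2 ≤ n) (ω : Fin n → Fin n → Bool) (a : ℝ) : (symMat ℝ ω).charpoly ≠ (X - C a) ^ n := fun h => by
  have hA := herm ℝ ω
  have he : hA.eigenvalues = fun _ => a := funext fun i => by
    have h1 : (symMat ℝ ω).charpoly.IsRoot (hA.eigenvalues i) := by
      rw [hA.charpoly_eq, IsRoot, eval_prod]
      exact prod_eq_zero (mem_univ i) (by simp)
    rw [h, IsRoot, eval_pow] at h1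
    have := eq_zero_of_pow_eq_zero h1
    rw [eval_sub, eval_X, eval_C] at this; linarith
  have h2 := hA.spectral_theorem
  have h3 : Matrix.diagonal (RCLike.ofReal ∘ hA.eigenvalues) = a • (1 : Matrix (Fin n) (Fin n) ℝ) := by
    rw [he, Matrix.smul_one_eq_diagonal]; rfl
  rw [h3, map_smul, map_one] at h2
  have h4 := congrFun (congrFun h2 ⟨0, by omega⟩) ⟨1, by omega⟩
  rw [Matrix.smul_apply, Matrix.one_apply_ne (by simp)] at h4
  simp only [symMat, Matrix.of_apply, signb] at h4
  split_ifs at h4 <;> simp at h4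

theorem reduce {N : ℕ} (hN : 1 ≤ N) (ω : Fin (N + 1) → Fin (N + 1) → Bool) (h1 : ¬ Two (ph ω)) (h2 : ¬ Two (ph (res ω))) :
    Irreducible (symMat ℚ ω).charpoly := by
  obtain ⟨g, hg, hi, hd⟩ := exists_fac (ph_monic ω) (by rw [ph_deg]; omega)
  obtain ⟨m, hm⟩ := exists_pow (ph_monic ω) h1 hg hi hd
  have hdeg := ph_deg ω
  rw [hm, natDegree_pow] at hdeg
  have hm0 : m ≠ 0 := by rintro rfl; omega
  by_cases hm1 : m = 1
  · rw [hm1, pow_one] at hm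
    rw [← ph_map]
    exact ((ph_monic ω).irreducible_iff_irreducible_map_fraction_map (K := ℚ)).1 (hm ▸ hi)
  exfalso
  have hroot : ∃ lam : ℝ, aeval lam g = 0 := by
    have hz : (g.map (Int.castRingHom ℂ)).degree ≠ 0 := by
      rw [hg.degree_map, degree_eq_natDegree hg.ne_zero]
      exact_mod_cast one_lt_deg hg hi
    obtain ⟨z, hz⟩ := IsAlgClosed.exists_root _ hz
    have hz' : aeval z g = 0 := by rw [IsRoot, eval_map] at hz; exact hz
    have him := (((ph_good ω).dvd hg hd).2.2 z hz').1
    refine ⟨z.re, ?_⟩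
    have e : z = algebraMap ℝ ℂ z.re := Complex.ext (by simp) (by simp [him])
    rw [e, aeval_algebraMap_apply] at hz'
    exact (map_eq_zero_iff _ (algebraMap ℝ ℂ).injective).1 hz'
  obtain ⟨lam, hlam⟩ := hroot
  have hgl : (X - C lam) ∣ g.map (Int.castRingHom ℝ) := dvd_iff_isRoot.2 (by rw [IsRoot, eval_map]; exact hlam)
  have hr := res_root ω (lam := lam) (by
    rw [← ph_map, hm, Polynomial.map_pow]
    exact (pow_dvd_pow_of_dvd hgl 2).trans (pow_dvd_pow _ (by omega)))
  rw [← ph_map, IsRoot, eval_map] at hr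
  have hint : IsIntegral ℤ lam := ⟨g, hg, hlam⟩
  have hmin : Associated (minpoly ℤ lam) g := (minpoly.irreducible hint).associated_of_dvd hi
    (minpoly.isIntegrallyClosed_dvd hint hlam)
  have hgd : g ∣ ph (res ω) := hmin.symm.dvd.trans (minpoly.isIntegrallyClosed_dvd hint hr)
  obtain ⟨m', hm'⟩ := exists_pow (ph_monic (res ω)) h2 hg hi hgd
  have hdeg' := ph_deg (res ω)
  rw [hm', natDegree_pow] at hdeg'
  have hd1 : g.natDegree = 1 := Nat.dvd_one.1 ((Nat.dvd_add_right (hdeg' ▸ Dvd.intro_left _ rfl)).1 (hdeg ▸ Dvd.intro_left _ rfl : g.natDegree ∣ N + 1))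
  have hge : g.map (Int.castRingHom ℝ) = X - C lam := (eq_of_monic_of_dvd_of_natDegree_le (monic_X_sub_C lam) (hg.map _) hgl
    (by rw [natDegree_X_sub_C, hg.natDegree_map, hd1]))
  refine scal (by omega : 2 ≤ N + 1) ω lam ?_
  rw [← ph_map, hm, Polynomial.map_pow, hge]
  congr 1
  rw [hd1] at hdeg; omega
end FN

namespace FN
open Polynomial DZ

abbrev Om (n : ℕ) := Fin n → Fin n → Bool

lemma prob_eq {Ω : Type*} [Fintype Ω] (E : Ω → Prop) [DecidablePred E] : prob E = (#{ω | E ω} : ℝ) / Fintype.card Ω := by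
  unfold prob; congr!

lemma prob_le_one {Ω : Type*} [Fintype Ω] (E : Ω → Prop) : prob E ≤ 1 := by
  classical
  exact div_le_one_of_le₀ (by exact_mod_cast card_le_univ _) (Nat.cast_nonneg _)

lemma prob_nonneg {Ω : Type*} [Fintype Ω] (E : Ω → Prop) : 0 ≤ prob E := by
  unfold prob; positivity

lemma prob_mono {Ω : Type*} [Fintype Ω] {E F : Ω → Prop} (h : ∀ ω, E ω → F ω) : prob E ≤ prob F := by
  classical
  rw [prob_eq, prob_eq]
  gcongr
  exact h _

lemma prob_or {Ω : Type*} [Fintype Ω] (E F : Ω → Prop) : prob (fun ω => E ω ∨ F ω) ≤ prob E + prob F := by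
  classical
  rw [prob_eq, prob_eq, prob_eq, ← add_div]
  gcongr
  rw [filter_or]
  exact_mod_cast card_union_le _ _

lemma prob_compl {Ω : Type*} [Fintype Ω] [Nonempty Ω] (E : Ω → Prop) : prob E = 1 - prob fun ω => ¬ E ω := by
  classical
  rw [prob_eq, prob_eq]
  have h : (Fintype.card Ω : ℝ) ≠ 0 := by exact_mod_cast Fintype.card_ne_zero
  have := card_filter_add_card_filter_not (s := (univ : Finset Ω)) E
  rw [card_univ] at this
  rw [eq_sub_iff_add_eq, ← add_div, div_eq_one_iff_eq h]
  exact_mod_cast this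

lemma prob_res {N : ℕ} (E : Om N → Prop) : prob (fun ω : Om (N + 1) => E (res ω)) = prob E := by
  classical
  let e : Om (N + 1) ≃ ((Fin (N + 1) → Bool) × (Fin N → Bool)) × Om N :=
    { toFun := fun ω => ((ω 0, fun i => ω i.succ 0), res ω)
      invFun := fun x => Fin.cons x.1.1 fun i => Fin.cons (x.1.2 i) (x.2 i)
      left_inv := fun ω => by
        ext i j
        refine Fin.cases rfl (fun i => ?_) i
        refine Fin.cases rfl (fun j => rfl) j
      right_inv := fun x => rfl }
  rw [prob_eq, prob_eq]
  have h1 : #{ω : Om (N + 1) | E (res ω)} = Fintype.card ((Fin (N + 1) → Bool) × (Fin N → Bool)) * #{ω | E ω} := by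
    rw [← card_univ, ← card_product]
    refine card_nbij' e e.symm ?_ ?_ ?_ ?_
    · intro ω h
      have : (e ω).2 = res ω := rfl
      simpa [this] using h
    · intro x h
      have : res (e.symm x) = x.2 := rfl
      simpa [this] using h
    · intro ω _; simp
    · intro ω _; simp
  have h2 : Fintype.card (Om (N + 1)) = Fintype.card ((Fin (N + 1) → Bool) × (Fin N → Bool)) * Fintype.card (Om N) := by
    rw [Fintype.card_congr e, Fintype.card_prod]
  rw [h1, h2]; push_cast
  rw [mul_div_mul_left]
  positivity

open Classical in
lemma nr_eq {p : ℕ} [Fact p.Prime] {n : ℕ} (ω : Om n) : nr p (ph ω) = #{x : ZMod p | (symMat (ZMod p) ω).charpoly.eval x = 0} := by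
  rw [nr, ← Set.ncard_coe_finset]
  congr 1
  ext x
  simp [← ph_map, eval_map]


lemma eps_le {k n p : ℕ} (hk : 2 ^ 14 ≤ k) (h1 : k ^ 4 ≤ n) (h2 : n < (k + 1) ^ 4) (hp : p ∈ RR k) :
    RM.epsm p n (2 ^ 21 * k) ≤ Real.exp (-(k / 10)) := by
  obtain ⟨hpp, -, hp2⟩ := mem_RR.1 hp
  have hk' : (2 : ℝ) ^ 14 ≤ k := by exact_mod_cast hk
  have hk0 : (0 : ℝ) < k := by linarith [show (0 : ℝ) < 2 ^ 14 by norm_num]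
  have hpe : (p : ℝ) ≤ Real.exp (8 * k) := by
    rwa [← Real.log_le_iff_le_exp (by exact_mod_cast hpp.pos)]
  have hn1 : (n : ℝ) + 1 ≤ Real.exp (4 * k) := by
    have : (n : ℝ) + 1 ≤ (k + 1) ^ 4 := by exact_mod_cast h2
    refine this.trans ((pow_le_pow_left₀ (by positivity) (Real.add_one_le_exp _) 4).trans (le_of_eq ?_))
    rw [← Real.exp_nat_mul]; norm_num
  set s := 2 ^ 21 * k with hs
  have hsr : (s : ℝ) = 2 ^ 21 * k := by rw [hs]; push_cast; ring
  have h4 : (4 : ℝ) ≤ Real.exp 3 := by linarith [Real.add_one_le_exp (3 : ℝ)]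
  have h34 : ((3 : ℝ) / 4) ^ (n - (s + 1)) ≤ Real.exp (-(1 / 4) * (k ^ 4 - s - 1)) := by
    have : (3 / 4 : ℝ) ≤ Real.exp (-(1 / 4)) := by linarith [Real.add_one_le_exp (-(1 / 4) : ℝ)]
    refine (pow_le_pow_left₀ (by norm_num) this _).trans ?_
    rw [← Real.exp_nat_mul]
    refine Real.exp_le_exp.2 ?_
    have e1 : (k : ℝ) ^ 4 - s - 1 ≤ ((n - (s + 1) : ℕ) : ℝ) := by
      have : k ^ 4 ≤ (n - (s + 1)) + s + 1 := by omega
      have : (k : ℝ) ^ 4 ≤ ((n - (s + 1) : ℕ) : ℝ) + s + 1 := by exact_mod_cast this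
      linarith
    linarith
  have hn0 : (n : ℝ) ≤ Real.exp (4 * k) := by linarith
  calc RM.epsm p n s = (n + 1) ^ s * n * 4 * (p ^ (s + 1) * (3 / 4) ^ (n - (s + 1))) := rfl
    _ ≤ Real.exp (4 * k) ^ s * Real.exp (4 * k) * Real.exp 3 * (Real.exp (8 * k) ^ (s + 1) * Real.exp (-(1 / 4) * (k ^ 4 - s - 1))) := by
        gcongr
    _ = Real.exp (s * (4 * k) + 4 * k + 3 + ((s + 1 : ℕ) * (8 * k) + -(1 / 4) * (k ^ 4 - s - 1))) := by
        rw [← Real.exp_nat_mul, ← Real.exp_nat_mul]; simp only [Real.exp_add]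
    _ ≤ _ := by
        refine Real.exp_le_exp.2 ?_
        push_cast
        rw [hsr]
        have a1 : (2 : ℝ) ^ 28 ≤ k ^ 2 := by nlinarith
        have a2 : (2 : ℝ) ^ 28 * k ^ 2 ≤ k ^ 4 := by nlinarith [sq_nonneg (k : ℝ)]
        nlinarith

lemma avg_nr {k n p : ℕ} (hk : 2 ^ 14 ≤ k) (h1 : k ^ 4 ≤ n) (h2 : n < (k + 1) ^ 4) (hp : p ∈ RR k) :
    ∑ ω : Om n, (nr p (ph ω) : ℝ) ≤ Fintype.card (Om n) * (1 + 5 * Real.exp (-(k / 10))) := by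
  obtain ⟨hpp, hp1, hp2⟩ := mem_RR.1 hp
  haveI := Fact.mk hpp
  classical
  have hk' : (2 : ℝ) ^ 14 ≤ k := by exact_mod_cast hk
  have hp0 : (0 : ℝ) < p := by exact_mod_cast hpp.pos
  have hpe : (p : ℝ) ≤ Real.exp (8 * k) := by rwa [← Real.log_le_iff_le_exp hp0]
  have hpl : Real.exp (k / 10) < p := by rwa [← Real.lt_log_iff_exp_lt hp0]
  have hp12 : (12 : ℝ) ≤ p := by linarith [Real.add_one_le_exp ((k : ℝ) / 10)]
  have he := eps_le hk h1 h2 hp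
  have hE : Real.exp (-(k / 10)) * Real.exp (k / 10) = 1 := by rw [← Real.exp_add]; simp
  set E := Real.exp (-((k : ℝ) / 10))
  have hE0 : 0 < E := Real.exp_pos _
  have hEp : 1 ≤ E * p := by nlinarith
  have hE1 : E ≤ 1 := Real.exp_le_one_iff.2 (by have : (0 : ℝ) ≤ k := Nat.cast_nonneg _; linarith [div_nonneg this (by norm_num : (0 : ℝ) ≤ 10)])
  have hx := RM.expected_roots (p := p) (m := n) (by exact_mod_cast hp12) (2 ^ 21 * k) (by
    have hb : (0 : ℝ) ≤ 1 - RM.β0 / 2 := by unfold RM.β0; norm_num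
    have h3 : (1 - RM.β0 / 2) ^ (2 ^ 21 * k) ≤ Real.exp (-(16 * k)) := by
      have : 1 - RM.β0 / 2 ≤ Real.exp (-(RM.β0 / 2)) := by linarith [Real.add_one_le_exp (-(RM.β0 / 2))]
      refine (pow_le_pow_left₀ hb this _).trans (le_of_eq ?_)
      rw [← Real.exp_nat_mul]; unfold RM.β0; push_cast; ring_nf
    have h4 : Real.exp (-(16 * k)) * p ≤ 1 / 2 := by
      have h5 : Real.exp (-(16 * k)) * p ≤ Real.exp (-(16 * k)) * Real.exp (8 * k) := by gcongr
      rw [← Real.exp_add] at h5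
      have h6 : Real.exp (-(16 * k) + 8 * k) ≤ Real.exp (-1) := Real.exp_le_exp.2 (by linarith)
      linarith [Real.exp_neg_one_lt_half]
    calc (1 - RM.β0 / 2) ^ (2 ^ 21 * k) * (p : ℝ) ^ 2 ≤ Real.exp (-(16 * k)) * p ^ 2 := by gcongr
      _ = (Real.exp (-(16 * k)) * p) * p := by ring
      _ ≤ 1 / 2 * p := by gcongr
      _ = p / 2 := by ring)
  rw [← sum_mul] at hx
  have hx2 : (∑ ω : Om n, (nr p (ph ω) : ℝ)) * (p - 1) ≤ (Fintype.card (Om n) * (1 + 5 * E)) * (p - 1) := by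
    simp only [nr_eq]
    refine hx.trans ?_
    rw [mul_assoc]
    refine mul_le_mul_of_nonneg_left ?_ (Nat.cast_nonneg _)
    calc (p : ℝ) * (1 + RM.epsm p n (2 ^ 21 * k)) ≤ p * (1 + E) := by gcongr
      _ ≤ (1 + 5 * E) * (p - 1) := by nlinarith
  exact le_of_mul_le_mul_right hx2 (by linarith)
end FN

namespace FN
open Polynomial DZ

lemma two_bd (hRH : ∀ (K : Type) [Field K] [NumberField K], DedekindZetaRH K) :
    ∃ C : ℝ, 0 < C ∧ ∀ k n : ℕ, 2 ^ 14 ≤ k → k ^ 4 ≤ n → n < (k + 1) ^ 4 →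
      prob (fun ω : Om n => Two (ph ω)) ≤ C * (k + 1) ^ 17 * Real.exp (-(k / 10)) := by
  classical
  obtain ⟨C, hC, hlow, hup⟩ := roots_low hRH
  refine ⟨24 * (C + 1), by positivity, fun k n hk h1 h2 => ?_⟩
  have hn : 1 ≤ n := le_trans (Nat.one_le_pow _ _ (by omega)) h1
  have hn4 : (n : ℝ) ≤ (k + 1) ^ 4 := by exact_mod_cast h2.le
  have hcard : (0 : ℝ) < Fintype.card (Om n) := by exact_mod_cast Fintype.card_pos
  have hup := hup k
  have hlow := fun ω : Om n => hlow n k (ph ω) hn (ph_good ω)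
  have havg := fun p hp => avg_nr (p := p) hk h1 h2 hp
  set E := Real.exp (-((k : ℝ) / 10))
  have hE0 : 0 < E := Real.exp_pos _
  set δ := (C + 1) * (k + 1) ^ 17 * E with hδ
  set ε := C * (k + 1) * n ^ 4 * E with hε
  have hε0 : 0 ≤ ε := by positivity
  have hk1 : (1 : ℝ) ≤ k + 1 := by linarith [(Nat.cast_nonneg k : (0 : ℝ) ≤ k)]
  have hεδ : ε ≤ δ := by
    calc ε ≤ C * (k + 1) * ((k + 1) ^ 4) ^ 4 * E := by rw [hε]; gcongr
      _ = C * (k + 1) ^ 17 * E := by ring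
      _ ≤ δ := by rw [hδ]; gcongr; linarith
  have hEδ : E ≤ δ := by
    have : 1 ≤ (C + 1) * ((k : ℝ) + 1) ^ 17 := one_le_mul_of_one_le_of_one_le (by linarith) (one_le_pow₀ hk1)
    rw [hδ]; nlinarith
  have hCδ : C * (k + 1) * E ≤ δ := by
    rw [hδ]
    have : (k + 1 : ℝ) ≤ (k + 1) ^ 17 := le_self_pow₀ hk1 (by norm_num)
    gcongr; linarith
  set P := prob (fun ω : Om n => Two (ph ω))
  have hP1 : P ≤ 1 := prob_le_one _
  have hP0 : 0 ≤ P := prob_nonneg _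
  have hgoal : 24 * (C + 1) * (k + 1) ^ 17 * E = 24 * δ := by rw [hδ]; ring
  rw [hgoal]
  by_cases hδ2 : 1 / 10 ≤ δ
  · linarith
  push Not at hδ2
  have hup2 : ∑ ω : Om n, ∑ p ∈ RR k, wt k p * nr p (ph ω) ≤ Fintype.card (Om n) * ((1 + 5 * δ) * (1 + δ)) := by
    rw [sum_comm]
    calc ∑ p ∈ RR k, ∑ ω : Om n, wt k p * nr p (ph ω)
        ≤ ∑ p ∈ RR k, wt k p * (Fintype.card (Om n) * (1 + 5 * E)) := sum_le_sum fun p hp => by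
          rw [← mul_sum]; exact mul_le_mul_of_nonneg_left (havg p hp) (wt_nonneg k p)
      _ = Fintype.card (Om n) * ((1 + 5 * E) * ∑ p ∈ RR k, wt k p) := by rw [← sum_mul]; ring
      _ ≤ _ := by
          have := hup.trans (add_le_add_right hCδ 1)
          gcongr
          exact sum_nonneg fun p _ => wt_nonneg k p
  have hlow2 : Fintype.card (Om n) * ((1 - ε) * (1 + P)) ≤ ∑ ω : Om n, ∑ p ∈ RR k, wt k p * nr p (ph ω) := by
    have : Fintype.card (Om n) * ((1 - ε) * (1 + P)) = ∑ ω : Om n, ((1 - ε) + (1 - ε) * if Two (ph ω) then 1 else 0) := by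
      have hPe : Fintype.card (Om n) * P = #{ω : Om n | Two (ph ω)} := by
        simp only [P]; rw [prob_eq]; field_simp
      rw [sum_add_distrib, ← mul_sum, sum_boole, sum_const, nsmul_eq_mul, card_univ, ← hPe]; ring
    rw [this]
    refine sum_le_sum fun ω _ => ?_
    split_ifs with h
    · have := (hlow ω).2 h; linarith
    · have := (hlow ω).1 (exists_fac (ph_monic ω) (by rw [ph_deg]; omega)); linarith
  have h3 := le_of_mul_le_mul_left (hlow2.trans hup2) hcard
  nlinarith

lemma pow_bd (k : ℕ) : ((k : ℝ) + 1) ^ 17 * Real.exp (-(k / 10)) ≤ 20 ^ 17 * (17 : ℕ).factorial * 3 * Real.exp (-((k + 1) / 20)) := by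
  have h1 := Real.pow_div_factorial_le_exp (((k : ℝ) + 1) / 20) (by positivity) 17
  rw [div_le_iff₀ (by positivity), div_pow, div_le_iff₀ (by positivity)] at h1
  have h2 : Real.exp ((k + 1) / 20) * Real.exp (-(k / 10)) = Real.exp (1 / 10) * Real.exp (-((k + 1) / 20)) := by
    rw [← Real.exp_add, ← Real.exp_add]; ring_nf
  have h3 : Real.exp (1 / 10) ≤ 3 := by
    refine (Real.exp_le_exp.2 (by norm_num : (1 / 10 : ℝ) ≤ 1)).trans ?_
    linarith [Real.exp_one_lt_d9]
  calc ((k : ℝ) + 1) ^ 17 * Real.exp (-(k / 10))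
      ≤ Real.exp ((k + 1) / 20) * (17 : ℕ).factorial * 20 ^ 17 * Real.exp (-(k / 10)) := by gcongr
    _ = 20 ^ 17 * (17 : ℕ).factorial * (Real.exp ((k + 1) / 20) * Real.exp (-(k / 10))) := by ring
    _ ≤ _ := by rw [h2, mul_assoc _ 3]; gcongr

lemma two_bd2 (hRH : ∀ (K : Type) [Field K] [NumberField K], DedekindZetaRH K) :
    ∃ C : ℝ, 0 < C ∧ ∀ n : ℕ, prob (fun ω : Om n => Two (ph ω)) ≤ C * Real.exp (-((n : ℝ) ^ ((1 : ℝ) / 4) / 20)) := by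
  obtain ⟨C, hC, h⟩ := two_bd hRH
  refine ⟨C * (20 ^ 17 * (17 : ℕ).factorial * 3) + Real.exp ((2 ^ 14 + 1) / 20), by positivity, fun n => ?_⟩
  set x : ℝ := (n : ℝ) ^ ((1 : ℝ) / 4)
  have hx0 : 0 ≤ x := by positivity
  have hx4 : x ^ 4 = n := by
    simp only [x]
    rw [← Real.rpow_natCast, ← Real.rpow_mul (Nat.cast_nonneg n)]; norm_num
  set k := ⌊x⌋₊
  have hk1 : (k : ℝ) ≤ x := Nat.floor_le hx0
  have hk2 : x < k + 1 := Nat.lt_floor_add_one x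
  rw [add_mul]
  by_cases hk : 2 ^ 14 ≤ k
  · have e1 : k ^ 4 ≤ n := by
      have : (k : ℝ) ^ 4 ≤ n := by rw [← hx4]; gcongr
      exact_mod_cast this
    have e2 : n < (k + 1) ^ 4 := by
      have : (n : ℝ) < (k + 1) ^ 4 := by rw [← hx4]; gcongr
      exact_mod_cast this
    refine (h k n hk e1 e2).trans (le_add_of_le_of_nonneg ?_ (by positivity))
    rw [mul_assoc, mul_assoc]
    refine mul_le_mul_of_nonneg_left ((pow_bd k).trans ?_) hC.le
    gcongr
  · refine (prob_le_one _).trans (le_add_of_nonneg_of_le (by positivity) ?_)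
    rw [← Real.exp_add]
    refine Real.one_le_exp ?_
    have : (k : ℝ) + 1 ≤ 2 ^ 14 + 1 := by push Not at hk; gcongr; exact_mod_cast hk.le
    linarith

end FN

open FN DZ in
theorem irreducible_charpoly_symmetric_rademacher
    (hRH : ∀ (K : Type) [Field K] [NumberField K], DedekindZetaRH K) :
    ∃ c : ℝ, 0 < c ∧ ∀ n : ℕ,
      prob (fun ω : Fin n → Fin n → Bool =>
          Irreducible (Matrix.charpoly (symMat ℚ ω))) ≥
        1 - 2 * Real.exp (-c * (n : ℝ) ^ ((1 : ℝ) / 4)) := by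
  obtain ⟨C, hC, hbd⟩ := two_bd2 hRH
  have hfail : ∀ n : ℕ, prob (fun ω : Om n => ¬ Irreducible (symMat ℚ ω).charpoly) ≤
      (3 * C + 3) * Real.exp (-((n : ℝ) ^ ((1 : ℝ) / 4) / 20)) := by
    intro n
    by_cases hn : n ≤ 1
    · refine (prob_le_one _).trans ?_
      have hx : (n : ℝ) ^ ((1 : ℝ) / 4) ≤ 1 := Real.rpow_le_one (Nat.cast_nonneg n) (by exact_mod_cast hn) (by norm_num)
      have := Real.add_one_le_exp (-((n : ℝ) ^ ((1 : ℝ) / 4) / 20))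
      nlinarith
    obtain ⟨N, rfl⟩ : ∃ N, n = N + 1 := ⟨n - 1, by omega⟩
    have h1 : prob (fun ω : Om (N + 1) => ¬ Irreducible (symMat ℚ ω).charpoly) ≤
        prob (fun ω : Om (N + 1) => Two (ph ω)) + prob (fun ω : Om N => Two (ph ω)) := by
      rw [← prob_res (fun ω : Om N => Two (ph ω))]
      refine le_trans (prob_mono fun ω hω => ?_) (prob_or _ _)
      by_contra hc
      push Not at hc
      exact hω (reduce (by omega) ω hc.1 hc.2)
    refine h1.trans ((add_le_add (hbd _) (hbd _)).trans ?_)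
    have h2 : ((N + 1 : ℕ) : ℝ) ^ ((1 : ℝ) / 4) ≤ (N : ℝ) ^ ((1 : ℝ) / 4) + 1 := by
      have := Real.rpow_add_le_add_rpow (Nat.cast_nonneg N) zero_le_one (by norm_num : (0 : ℝ) ≤ 1 / 4) (by norm_num)
      push_cast; simpa using this
    set x := ((N + 1 : ℕ) : ℝ) ^ ((1 : ℝ) / 4)
    have h3 : Real.exp (-((N : ℝ) ^ ((1 : ℝ) / 4) / 20)) ≤ 2 * Real.exp (-(x / 20)) := by
      have h4 : Real.exp (1 / 20) ≤ 2 := by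
        have := Real.exp_one_lt_d9
        have h5 : Real.exp (1 / 2) ^ 2 = Real.exp 1 := by rw [← Real.exp_nat_mul]; norm_num
        have h6 : Real.exp (1 / 2) ≤ 2 := by nlinarith [Real.exp_pos (1 / 2)]
        exact (Real.exp_le_exp.2 (by norm_num)).trans h6
      calc Real.exp (-((N : ℝ) ^ ((1 : ℝ) / 4) / 20)) ≤ Real.exp (1 / 20 + -(x / 20)) := Real.exp_le_exp.2 (by linarith)
        _ ≤ _ := by rw [Real.exp_add]; gcongr
    have := Real.exp_pos (-(x / 20))
    nlinarith
  set L := Real.log (3 * C + 3)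
  have hL2 : Real.log 2 ≤ L := Real.log_le_log (by norm_num) (by linarith)
  have h20 : 0 < Real.log 2 := Real.log_pos (by norm_num)
  have hL : 0 < L := by linarith
  refine ⟨Real.log 2 / (20 * L), by positivity, fun n => ?_⟩
  rw [prob_compl]
  set x := (n : ℝ) ^ ((1 : ℝ) / 4)
  have h1 := hfail n
  have h2 := prob_le_one (fun ω : Om n => ¬ Irreducible (symMat ℚ ω).charpoly)
  rw [← Real.exp_log (by positivity : (0 : ℝ) < 3 * C + 3), ← Real.exp_add] at h1
  have h3 : 2 * Real.exp (-(Real.log 2 / (20 * L)) * x) = Real.exp (Real.log 2 / L * (L + -(x / 20))) := by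
    nth_rewrite 1 [← Real.exp_log (by norm_num : (0 : ℝ) < 2)]
    rw [← Real.exp_add]
    congr 1
    field_simp
  rw [h3]
  have hq : Real.log 2 / L ≤ 1 := (div_le_one hL).2 hL2
  have hq0 : 0 < Real.log 2 / L := by positivity
  suffices prob (fun ω : Om n => ¬ Irreducible (symMat ℚ ω).charpoly) ≤ Real.exp (Real.log 2 / L * (L + -(x / 20))) by linarith
  rcases le_total 0 (L + -(x / 20)) with ht | ht
  · exact h2.trans (Real.one_le_exp (by positivity))
  · exact h1.trans (Real.exp_le_exp.2 (by nlinarith))
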